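/- arXiv:2604.02042 — 3 statements merged into one kernel-verified Lean document; each statement's English description precedes it below -/
import Mathlib

section
/- Let γ ∈ W^{1,1}_{i,r}(𝕋, ℝ^n). Then for all w ∈ (0,1) one has ∫₀¹ |∂_u φ_γ(u,w)| du ≥ 2π, and equality holds for all w ∈ (0,1) if and only if γ is a planar convex curve. -/
open MeasureTheory Real Set intervalIntegral
open scoped ENNReal RealInnerProductSpace

noncomputable section

/-- A closed `W^{1,1}`-curve on the torus `𝕋 = ℝ/ℤ` with values in `ℝⁿ`, encoded as a
`1`-periodic absolutely continuous function `toFun : ℝ → ℝⁿ` together with its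
(weak) derivative `deriv'`. -/
structure ClosedCurve (n : ℕ) where
  toFun : ℝ → EuclideanSpace ℝ (Fin n)
  deriv' : ℝ → EuclideanSpace ℝ (Fin n)
  periodic : Function.Periodic toFun 1
  deriv'_periodic : Function.Periodic deriv' 1
  integrableOn : MeasureTheory.IntegrableOn deriv' (Set.Icc (0:ℝ) 1)
  eq_integral : ∀ t : ℝ, toFun t = toFun 0 + ∫ s in (0:ℝ)..t, deriv' s

namespace ClosedCurve

variable {n : ℕ}

/-- Injectivity as a map on the torus `ℝ/ℤ`. -/
def IsInj (γ : ClosedCurve n) : Prop :=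
  ∀ s t : ℝ, γ.toFun s = γ.toFun t → ∃ k : ℤ, s - t = (k : ℝ)

/-- Regularity: the derivative does not vanish a.e. -/
def IsRegular (γ : ClosedCurve n) : Prop := ∀ᵐ t : ℝ ∂volume, γ.deriv' t ≠ 0

/-- Parametrization by arc length: `|γ'| = 1` a.e. -/
def IsArclength (γ : ClosedCurve n) : Prop := ∀ᵐ t : ℝ ∂volume, ‖γ.deriv' t‖ = 1

/-- The length of a closed curve. -/
def length (γ : ClosedCurve n) : ℝ := ∫ t in (0:ℝ)..1, ‖γ.deriv' t‖

end ClosedCurve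

/-- Orthogonal projection onto the orthogonal complement of `span {v}` (for `v ≠ 0`). -/
def projPerp {F : Type*} [NormedAddCommGroup F] [InnerProductSpace ℝ F] (v x : F) : F :=
  x - (⟪v, x⟫ / ‖v‖ ^ 2) • v

/-- The Gauss map `φ_γ(u,w)`: the unit secant direction. -/
def gaussMap {n : ℕ} (γ : ClosedCurve n) (u w : ℝ) : EuclideanSpace ℝ (Fin n) :=
  ‖γ.toFun (u + w) - γ.toFun u‖⁻¹ • (γ.toFun (u + w) - γ.toFun u)

/-- `|∂_u φ_γ(u,w)|`, expressed via the identity (1.8) of the paper. -/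
def gaussDerivU {n : ℕ} (γ : ClosedCurve n) (u w : ℝ) : ℝ :=
  ‖projPerp (gaussMap γ u w) (γ.deriv' (u + w) - γ.deriv' u)‖ /
    ‖γ.toFun (u + w) - γ.toFun u‖

/-- `|∂_w φ_γ(u,w)|`, expressed via the identity (1.7) of the paper. -/
def gaussDerivW {n : ℕ} (γ : ClosedCurve n) (u w : ℝ) : ℝ :=
  ‖projPerp (gaussMap γ u w) (γ.deriv' (u + w))‖ / ‖γ.toFun (u + w) - γ.toFun u‖

/-- The generalized tangent-point energy `TP^{(p,q)}` (with values in `[0,∞]`). -/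
def TP {n : ℕ} (p q : ℝ) (γ : ClosedCurve n) : ℝ≥0∞ :=
  ∫⁻ u in Set.Ioc (0:ℝ) 1, ∫⁻ w in Set.Ioc (0:ℝ) 1,
    ENNReal.ofReal
      (‖projPerp (γ.deriv' u) (γ.toFun (u + w) - γ.toFun u)‖ ^ q /
        ‖γ.toFun (u + w) - γ.toFun u‖ ^ p * (‖γ.deriv' u‖ * ‖γ.deriv' (u + w)‖))

/-- The minorant `G^{(p,q)}_w`. -/
def Gw {n : ℕ} (p q : ℝ) (γ : ClosedCurve n) (w : ℝ) : ℝ≥0∞ :=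
  ∫⁻ u in Set.Ioc (0:ℝ) 1,
    ENNReal.ofReal ((1/2 * gaussDerivU γ u w) ^ q *
      ‖γ.toFun (u + w) - γ.toFun u‖ ^ (2*q - p))

/-- The minorant `G^{(p,q)}`. -/
def G {n : ℕ} (p q : ℝ) (γ : ClosedCurve n) : ℝ≥0∞ :=
  ∫⁻ w in Set.Ioc (0:ℝ) 1, Gw p q γ w

/-- A round circle in a euclidean space: a sphere intersected with a 2-dimensional plane
through its center. -/
def IsCircle {F : Type*} [NormedAddCommGroup F] [InnerProductSpace ℝ F] (S : Set F) : Prop :=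
  ∃ (c : F) (r : ℝ) (V : Submodule ℝ F), 0 < r ∧ Module.finrank ℝ V = 2 ∧
    S = {x | ‖x - c‖ = r ∧ x - c ∈ V}

/-- A great circle of the unit sphere. -/
def IsGreatCircle {F : Type*} [NormedAddCommGroup F] [InnerProductSpace ℝ F]
    (S : Set F) : Prop :=
  ∃ V : Submodule ℝ F, Module.finrank ℝ V = 2 ∧ S = {x | ‖x‖ = 1 ∧ x ∈ V}

/-- Half of a great circle of the unit sphere: a great-circle arc of angular length `π`. -/
def IsHalfGreatCircle {F : Type*} [NormedAddCommGroup F] [InnerProductSpace ℝ F]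
    (S : Set F) : Prop :=
  ∃ a b : F, ‖a‖ = 1 ∧ ‖b‖ = 1 ∧ ⟪a, b⟫ = 0 ∧
    S = (fun t : ℝ => Real.cos t • a + Real.sin t • b) '' Set.Icc 0 π

/-- A curve is convex if its image is the boundary (within its affine hull) of a convex
planar (2-dimensional) set. -/
def ClosedCurve.IsConvex {n : ℕ} (γ : ClosedCurve n) : Prop :=
  ∃ K : Set (EuclideanSpace ℝ (Fin n)), Convex ℝ K ∧
    Module.finrank ℝ (affineSpan ℝ K).direction = 2 ∧
    Set.range γ.toFun = intrinsicFrontier ℝ K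

namespace GaussFenchel

/-! ### Absolutely continuous curves -/

section Primitive

variable {E F : Type*} [NormedAddCommGroup E] [NormedSpace ℝ E]
  [NormedAddCommGroup F] [NormedSpace ℝ F]

/-- `f` is a primitive of the locally integrable function `f'`. -/
structure IsPrimitive (f f' : ℝ → E) : Prop where
  intervalIntegrable : ∀ a b : ℝ, IntervalIntegrable f' volume a b
  sub_eq : ∀ a b : ℝ, f b - f a = ∫ t in a..b, f' t

theorem absolutelyContinuousOnInterval_of_dist_le {X : Type*} [PseudoMetricSpace X]
    {f : ℝ → X} {P : ℝ → ℝ} {a b K : ℝ}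
    (hP : AbsolutelyContinuousOnInterval P a b)
    (h : ∀ s ∈ uIcc a b, ∀ t ∈ uIcc a b, dist (f s) (f t) ≤ K * dist (P s) (P t)) :
    AbsolutelyContinuousOnInterval f a b := by
  unfold AbsolutelyContinuousOnInterval at hP ⊢
  have hP' := hP.const_mul K
  rw [mul_zero] at hP'
  refine tendsto_of_tendsto_of_tendsto_of_le_of_le' tendsto_const_nhds hP' ?_ ?_
  · exact Filter.Eventually.of_forall fun E => Finset.sum_nonneg fun i _ => dist_nonneg
  · have : ∀ᶠ E in (AbsolutelyContinuousOnInterval.totalLengthFilter ⊓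
        Filter.principal (AbsolutelyContinuousOnInterval.disjWithin a b)),
        E ∈ AbsolutelyContinuousOnInterval.disjWithin a b :=
      Filter.eventually_inf_principal.2 (Filter.Eventually.of_forall fun _ h => h)
    filter_upwards [this] with E hE
    rw [Finset.mul_sum]
    exact Finset.sum_le_sum fun i hi => h _ (hE.1 i hi).1 _ (hE.1 i hi).2

namespace IsPrimitive

theorem locallyIntegrable {f f' : ℝ → E} (h : IsPrimitive f f') : LocallyIntegrable f' := by
  rw [locallyIntegrable_iff]
  intro k hk
  obtain ⟨a, b, hab⟩ : ∃ a b : ℝ, k ⊆ Ioc a b := by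
    obtain ⟨R, hR⟩ := hk.isBounded.subset_closedBall 0
    refine ⟨-R - 1, R, hR.trans fun x hx => ?_⟩
    rw [Metric.mem_closedBall, dist_zero_right, Real.norm_eq_abs, abs_le] at hx
    exact ⟨by linarith [hx.1], hx.2⟩
  exact (h.intervalIntegrable a b).1.mono_set hab

theorem ae_hasDerivAt [CompleteSpace E] {f f' : ℝ → E} (h : IsPrimitive f f') :
    ∀ᵐ t : ℝ, HasDerivAt f (f' t) t := by
  filter_upwards [_root_.LocallyIntegrable.ae_hasDerivAt_integral h.locallyIntegrable] with t ht
  have : f = fun x => f 0 + ∫ s in (0 : ℝ)..x, f' s := by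
    funext x
    rw [← h.sub_eq]
    abel
  rw [this]
  exact (ht 0).const_add _

theorem dist_le {f f' : ℝ → E} (h : IsPrimitive f f') (a s t : ℝ) :
    dist (f s) (f t) ≤ dist (∫ u in a..s, ‖f' u‖) (∫ u in a..t, ‖f' u‖) := by
  have hi : ∀ a b, IntervalIntegrable (fun u => ‖f' u‖) volume a b :=
    fun a b => (h.intervalIntegrable a b).norm
  rw [dist_comm, dist_eq_norm, h.sub_eq, dist_comm, Real.dist_eq,
    intervalIntegral.integral_interval_sub_left (hi a t) (hi a s)]
  exact intervalIntegral.norm_integral_le_abs_integral_norm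

theorem continuous {f f' : ℝ → E} (h : IsPrimitive f f') : Continuous f := by
  have : f = fun x => f 0 + ∫ s in (0 : ℝ)..x, f' s := by
    funext x
    rw [← h.sub_eq]
    abel
  rw [this]
  exact continuous_const.add (intervalIntegral.continuous_primitive h.intervalIntegrable 0)

theorem comp_add {f f' : ℝ → E} (h : IsPrimitive f f') (w : ℝ) :
    IsPrimitive (fun u => f (u + w)) (fun u => f' (u + w)) where
  intervalIntegrable a b := by
    have := (h.intervalIntegrable (a + w) (b + w)).comp_add_right w
    simpa using this
  sub_eq a b := by
    rw [intervalIntegral.integral_comp_add_right]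
    exact h.sub_eq _ _

theorem sub {f f' g g' : ℝ → E} (h : IsPrimitive f f') (hg : IsPrimitive g g') :
    IsPrimitive (fun u => f u - g u) (fun u => f' u - g' u) where
  intervalIntegrable a b := (h.intervalIntegrable a b).sub (hg.intervalIntegrable a b)
  sub_eq a b := by
    rw [intervalIntegral.integral_sub (h.intervalIntegrable a b) (hg.intervalIntegrable a b),
      ← h.sub_eq, ← hg.sub_eq]
    abel

theorem clm_comp [CompleteSpace E] [CompleteSpace F] {f f' : ℝ → E} (h : IsPrimitive f f')
    (L : E →L[ℝ] F) :
    IsPrimitive (fun u => L (f u)) (fun u => L (f' u)) where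
  intervalIntegrable a b := ⟨L.integrable_comp (h.intervalIntegrable a b).1,
    L.integrable_comp (h.intervalIntegrable a b).2⟩
  sub_eq a b := by
    rw [L.intervalIntegral_comp_comm (h.intervalIntegrable a b), ← h.sub_eq, map_sub]

theorem const (c : E) : IsPrimitive (fun _ => c) (fun _ => (0 : E)) where
  intervalIntegrable a b := _root_.intervalIntegrable_const
  sub_eq a b := by simp

theorem prodMk [CompleteSpace E] [CompleteSpace F] {f f' : ℝ → E} {g g' : ℝ → F}
    (h : IsPrimitive f f') (hg : IsPrimitive g g') :
    IsPrimitive (fun u => (f u, g u)) (fun u => (f' u, g' u)) where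
  intervalIntegrable a b :=
    ⟨(h.intervalIntegrable a b).1.prodMk (hg.intervalIntegrable a b).1,
      (h.intervalIntegrable a b).2.prodMk (hg.intervalIntegrable a b).2⟩
  sub_eq a b := by
    have key : IntervalIntegrable (fun u => (f' u, g' u)) volume a b :=
      ⟨(h.intervalIntegrable a b).1.prodMk (hg.intervalIntegrable a b).1,
        (h.intervalIntegrable a b).2.prodMk (hg.intervalIntegrable a b).2⟩
    refine Prod.ext ?_ ?_
    · have := (ContinuousLinearMap.fst ℝ E F).intervalIntegral_comp_comm key
      simp only [ContinuousLinearMap.coe_fst'] at this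
      rw [← this]
      exact h.sub_eq a b
    · have := (ContinuousLinearMap.snd ℝ E F).intervalIntegral_comp_comm key
      simp only [ContinuousLinearMap.coe_snd'] at this
      rw [← this]
      exact hg.sub_eq a b

/-- The fundamental theorem of calculus along an absolutely continuous curve. -/
theorem integral_comp_eq_sub {f f' : ℝ → E} (h : IsPrimitive f f')
    {G : E → ℝ} {H : ℝ → ℝ} {a b : ℝ}
    (hG : ∀ t ∈ uIcc a b, ContDiffAt ℝ 1 G (f t))
    (hH : ∀ᵐ t : ℝ, t ∈ uIcc a b → HasDerivAt (fun u => G (f u)) (H t) t) :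
    IntervalIntegrable H volume a b ∧ ∫ t in a..b, H t = G (f b) - G (f a) := by
  have hcomp : IsCompact (f '' uIcc a b) := isCompact_uIcc.image h.continuous
  have hloc : LocallyLipschitzOn (f '' uIcc a b) G := by
    rintro _ ⟨t, ht, rfl⟩
    obtain ⟨K, s, hs, hK⟩ := (hG t ht).exists_lipschitzOnWith
    exact ⟨K, s, mem_nhdsWithin_of_mem_nhds hs, hK⟩
  obtain ⟨K, hK⟩ := hloc.exists_lipschitzOnWith_of_compact hcomp
  have hac : AbsolutelyContinuousOnInterval (fun u => G (f u)) a b := by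
    refine absolutelyContinuousOnInterval_of_dist_le (K := K)
      ((h.intervalIntegrable a b).norm.absolutelyContinuousOnInterval_intervalIntegral
        (c := a) left_mem_uIcc) fun s hs t ht => ?_
    exact (hK.dist_le_mul _ (mem_image_of_mem f hs) _ (mem_image_of_mem f ht)).trans
      (mul_le_mul_of_nonneg_left (h.dist_le a s t) K.2)
  have hae : ∀ᵐ t : ℝ, t ∈ uIoc a b → deriv (fun u => G (f u)) t = H t := by
    filter_upwards [hH] with t ht htm
    exact (ht (uIoc_subset_uIcc htm)).deriv
  refine ⟨hac.intervalIntegrable_deriv.congr_ae ?_, ?_⟩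
  · exact (ae_restrict_iff' measurableSet_uIoc).2 hae
  · rw [← hac.integral_deriv_eq_sub]
    exact (intervalIntegral.integral_congr_ae hae).symm

end IsPrimitive

end Primitive

/-! ### Closed curves on the unit sphere -/

section Sphere

open InnerProductGeometry

variable {E : Type*} [NormedAddCommGroup E] [InnerProductSpace ℝ E]

/-- The radial projection of a curve to the unit sphere. -/
def unitDir (X : ℝ → E) (t : ℝ) : E := ‖X t‖⁻¹ • X t

/-- The speed of the radial projection of a curve `X` with derivative `X'`. -/
def turnRate (X X' : ℝ → E) (t : ℝ) : ℝ := ‖projPerp (unitDir X t) (X' t)‖ / ‖X t‖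

theorem norm_unitDir {X : ℝ → E} {t : ℝ} (h : X t ≠ 0) : ‖unitDir X t‖ = 1 := by
  rw [unitDir, norm_smul, norm_inv, norm_norm, inv_mul_cancel₀ (norm_ne_zero_iff.2 h)]

theorem unitDir_ne_zero {X : ℝ → E} {t : ℝ} (h : X t ≠ 0) : unitDir X t ≠ 0 := by
  rw [← norm_ne_zero_iff, norm_unitDir h]
  exact one_ne_zero

theorem smul_unitDir {X : ℝ → E} {t : ℝ} (h : X t ≠ 0) : ‖X t‖ • unitDir X t = X t := by
  rw [unitDir, smul_smul, mul_inv_cancel₀ (norm_ne_zero_iff.2 h), one_smul]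

theorem turnRate_nonneg (X X' : ℝ → E) (t : ℝ) : 0 ≤ turnRate X X' t := by
  unfold turnRate
  positivity

theorem continuous_unitDir {X : ℝ → E} (hX : Continuous X) (h0 : ∀ t, X t ≠ 0) :
    Continuous (unitDir X) :=
  (hX.norm.inv₀ fun t => norm_ne_zero_iff.2 (h0 t)).smul hX

theorem hasDerivAt_unitDir {X : ℝ → E} {v : E} {t : ℝ} (h : HasDerivAt X v t) (h0 : X t ≠ 0) :
    HasDerivAt (unitDir X) (‖X t‖⁻¹ • projPerp (unitDir X t) v) t := by
  have hn : ‖X t‖ ≠ 0 := norm_ne_zero_iff.2 h0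
  have h1 : HasDerivAt (fun u => ‖X u‖) (⟪X t, v⟫ / ‖X t‖) t := by
    have h2 := (h.norm_sq).sqrt (pow_ne_zero 2 hn)
    simp only [Real.sqrt_sq (norm_nonneg _)] at h2
    convert h2 using 1
    field_simp
  refine ((h1.inv hn).smul h).congr_deriv ?_
  have h3 : projPerp (unitDir X t) v = v - ⟪unitDir X t, v⟫ • unitDir X t := by
    rw [projPerp, norm_unitDir h0]
    simp
  rw [h3]
  simp only [unitDir, real_inner_smul_left, smul_sub, smul_smul, Pi.inv_apply]
  rw [sub_eq_add_neg, ← neg_smul]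
  congr 2
  field_simp

theorem norm_projPerp_le (x y : E) (hx : ‖x‖ = 1) : ‖projPerp x y‖ ≤ ‖y‖ := by
  have h : ‖projPerp x y‖ ^ 2 = ‖y‖ ^ 2 - ⟪x, y⟫ ^ 2 := by
    rw [projPerp, hx, norm_sub_sq_real, norm_smul, real_inner_smul_right, hx,
      real_inner_comm, Real.norm_eq_abs, mul_one, sq_abs]
    ring
  exact (sq_le_sq₀ (norm_nonneg _) (norm_nonneg _)).1 (by rw [h]; nlinarith [sq_nonneg ⟪x, y⟫])

theorem intervalIntegrable_turnRate {X X' : ℝ → E} (hX : IsPrimitive X X') (h0 : ∀ t, X t ≠ 0)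
    (a b : ℝ) : IntervalIntegrable (turnRate X X') volume a b := by
  have hc := hX.continuous
  have hci : Continuous fun t => ‖X t‖⁻¹ := hc.norm.inv₀ fun t => norm_ne_zero_iff.2 (h0 t)
  have hu := continuous_unitDir hc h0
  have hb : IntervalIntegrable (fun t => ‖X t‖⁻¹ * ‖X' t‖) volume a b :=
    (hX.intervalIntegrable a b).norm.continuousOn_mul hci.continuousOn
  have hmeas : AEStronglyMeasurable X' (volume.restrict (uIoc a b)) :=
    (hX.intervalIntegrable a b).aestronglyMeasurable_restrict_uIoc
  refine hb.mono_fun ?_ (Filter.Eventually.of_forall fun t => ?_)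
  · have h1 : AEStronglyMeasurable (fun t => projPerp (unitDir X t) (X' t))
        (volume.restrict (uIoc a b)) := by
      have : (fun t => projPerp (unitDir X t) (X' t)) =
          fun t => X' t - ⟪unitDir X t, X' t⟫ • unitDir X t := by
        funext t
        rw [projPerp, norm_unitDir (h0 t)]
        simp
      rw [this]
      exact hmeas.sub ((hu.aestronglyMeasurable.inner hmeas).smul hu.aestronglyMeasurable)
    have h2 := hci.aestronglyMeasurable.mul h1.norm (μ := volume.restrict (uIoc a b))
    refine h2.congr (Filter.Eventually.of_forall fun t => ?_)
    simp only [turnRate, Pi.mul_apply]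
    rw [div_eq_inv_mul]
  · beta_reduce
    rw [Real.norm_of_nonneg (turnRate_nonneg _ _ _), turnRate, div_eq_inv_mul,
      Real.norm_of_nonneg (by positivity)]
    exact mul_le_mul_of_nonneg_left (norm_projPerp_le _ _ (norm_unitDir (h0 t))) (by positivity)

theorem norm_unitDir_sub_le [CompleteSpace E] {X X' : ℝ → E} (hX : IsPrimitive X X')
    (h0 : ∀ t, X t ≠ 0) {s t : ℝ} (hst : s ≤ t) :
    ‖unitDir X t - unitDir X s‖ ≤ ∫ u in s..t, turnRate X X' u := by
  set v := unitDir X t - unitDir X s with hv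
  have hg0 : 0 ≤ ∫ u in s..t, turnRate X X' u :=
    intervalIntegral.integral_nonneg hst fun u _ => turnRate_nonneg _ _ _
  rcases eq_or_ne v 0 with h | h
  · rw [h, norm_zero]
    exact hg0
  have hG : ∀ u ∈ uIcc s t, ContDiffAt ℝ 1 (fun x : E => ⟪v, ‖x‖⁻¹ • x⟫) (X u) := by
    intro u _
    exact contDiffAt_const.inner ℝ (((contDiffAt_norm ℝ (h0 u)).inv
      (norm_ne_zero_iff.2 (h0 u))).smul contDiffAt_id)
  obtain ⟨hint, heq⟩ := hX.integral_comp_eq_sub (a := s) (b := t)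
    (H := fun u => ⟪v, ‖X u‖⁻¹ • projPerp (unitDir X u) (X' u)⟫) hG (by
      filter_upwards [hX.ae_hasDerivAt] with u hu _
      have := (hasDerivAt_const u v).inner ℝ (hasDerivAt_unitDir hu (h0 u))
      simpa [unitDir] using this)
  have h1 : ⟪v, unitDir X t⟫ - ⟪v, unitDir X s⟫ = ‖v‖ ^ 2 := by
    rw [← inner_sub_right, ← hv, real_inner_self_eq_norm_sq]
  have h2 : ‖v‖ ^ 2 ≤ ∫ u in s..t, ‖v‖ * turnRate X X' u := by
    rw [← h1]
    change ⟪v, ‖X t‖⁻¹ • X t⟫ - ⟪v, ‖X s‖⁻¹ • X s⟫ ≤ _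
    rw [← heq]
    refine intervalIntegral.integral_mono_on hst hint
      ((intervalIntegrable_turnRate hX h0 s t).const_mul _) fun u _ => ?_
    refine (real_inner_le_norm _ _).trans ?_
    rw [norm_smul, norm_inv, norm_norm, turnRate, div_eq_inv_mul]
  rw [intervalIntegral.integral_const_mul, sq] at h2
  exact le_of_mul_le_mul_left h2 (norm_pos_iff.2 h)

theorem norm_sub_eq_two_mul_sin {x y : E} (hx : ‖x‖ = 1) (hy : ‖y‖ = 1) :
    ‖y - x‖ = 2 * Real.sin (angle x y / 2) := by
  have hs : 0 ≤ Real.sin (angle x y / 2) :=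
    Real.sin_nonneg_of_nonneg_of_le_pi (by linarith [angle_nonneg x y])
      (by linarith [angle_le_pi x y, Real.pi_pos])
  have hc : Real.cos (angle x y) = ⟪x, y⟫ := by rw [cos_angle, hx, hy]; simp
  have h1 : Real.cos (angle x y) = 1 - 2 * Real.sin (angle x y / 2) ^ 2 := by
    have := Real.cos_two_mul (angle x y / 2)
    rw [mul_div_cancel₀ _ two_ne_zero] at this
    nlinarith [Real.sin_sq_add_cos_sq (angle x y / 2)]
  have h2 : ‖y - x‖ ^ 2 = (2 * Real.sin (angle x y / 2)) ^ 2 := by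
    rw [norm_sub_sq_real, hx, hy, real_inner_comm, ← hc, h1]
    ring
  exact (sq_eq_sq₀ (norm_nonneg _) (by positivity)).1 h2

theorem exists_angle_le_mul_norm_sub {c : ℝ} (hc : 1 < c) :
    ∃ δ > 0, ∀ x y : E, ‖x‖ = 1 → ‖y‖ = 1 → ‖y - x‖ < δ → angle x y ≤ c * ‖y - x‖ := by
  have hc0 : 0 < c := by linarith
  have hη : 0 < 1 - c⁻¹ := sub_pos.2 (inv_lt_one_of_one_lt₀ hc)
  refine ⟨1 - c⁻¹, hη, fun x y hx hy h => ?_⟩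
  set θ := angle x y with hθ
  have hθ0 : 0 ≤ θ := angle_nonneg x y
  have hθπ : θ ≤ π := angle_le_pi x y
  have hη1 : 1 - c⁻¹ < 1 := by linarith [inv_pos.2 hc0]
  rw [norm_sub_eq_two_mul_sin hx hy, ← hθ] at h ⊢
  have h1 := Real.mul_le_sin (x := θ / 2) (by linarith) (by linarith)
  have h2 : θ ≤ 2 * (2 * Real.sin (θ / 2)) := by
    have h3 : (1 / 2 : ℝ) ≤ 2 / π := by
      rw [div_le_div_iff₀ two_pos Real.pi_pos]
      linarith [Real.pi_lt_four]
    nlinarith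
  rcases hθ0.eq_or_lt with h0 | h0
  · rw [← h0]
    simp
  have h4 := Real.sin_gt_sub_cube (x := θ / 2) (by linarith)
  have h5 : θ * c⁻¹ ≤ 2 * Real.sin (θ / 2) := by
    have h6 : θ ≤ 2 * (1 - c⁻¹) := by linarith
    have h7 : θ ^ 2 ≤ 4 * (1 - c⁻¹) := by nlinarith
    nlinarith
  calc θ = c * (θ * c⁻¹) := by field_simp
    _ ≤ c * (2 * Real.sin (θ / 2)) := by gcongr

theorem continuous_angle_unitDir {X : ℝ → E} (hX : Continuous X) (h0 : ∀ t, X t ≠ 0) (s : ℝ) :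
    Continuous fun t => angle (unitDir X s) (unitDir X t) := by
  have : (fun t => angle (unitDir X s) (unitDir X t)) =
      fun t => Real.arccos ⟪unitDir X s, unitDir X t⟫ := by
    funext t
    rw [angle, norm_unitDir (h0 _), norm_unitDir (h0 _)]
    simp
  rw [this]
  exact Real.continuous_arccos.comp (continuous_const.inner (continuous_unitDir hX h0))

theorem angle_unitDir_le [CompleteSpace E] {X X' : ℝ → E} (hX : IsPrimitive X X')
    (h0 : ∀ t, X t ≠ 0) {s t : ℝ} (hst : s ≤ t) :
    angle (unitDir X s) (unitDir X t) ≤ ∫ u in s..t, turnRate X X' u := by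
  have hint := intervalIntegrable_turnRate hX h0
  have hcu := continuous_unitDir hX.continuous h0
  suffices h : ∀ c > (1 : ℝ), angle (unitDir X s) (unitDir X t) ≤
      c * ∫ u in s..t, turnRate X X' u by
    refine ge_of_tendsto (x := nhdsWithin (1 : ℝ) (Ioi 1))
      (f := fun c : ℝ => c * ∫ u in s..t, turnRate X X' u) ?_ ?_
    · have : ContinuousAt (fun c : ℝ => c * ∫ u in s..t, turnRate X X' u) 1 := by fun_prop
      have h2 := this.tendsto
      rw [one_mul] at h2
      exact h2.mono_left nhdsWithin_le_nhds
    · filter_upwards [self_mem_nhdsWithin] with c hc using h c hc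
  intro c hc
  obtain ⟨δ, hδ, hsmall⟩ := exists_angle_le_mul_norm_sub (E := E) hc
  set S := {z : ℝ | angle (unitDir X s) (unitDir X z) ≤ c * ∫ u in s..z, turnRate X X' u} with hS
  have hclosed : IsClosed S :=
    isClosed_le (continuous_angle_unitDir hX.continuous h0 s)
      (continuous_const.mul (intervalIntegral.continuous_primitive hint s))
  have key : Icc s t ⊆ S := by
    refine IsClosed.Icc_subset_of_forall_exists_gt (hclosed.inter isClosed_Icc) ?_ ?_
    · simp only [hS, mem_ofPred_eq, intervalIntegral.integral_same, mul_zero]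
      rw [angle_self (unitDir_ne_zero (h0 s))]
    · rintro x ⟨hxS, hx⟩ y hy
      have hnear : ∀ᶠ z in nhds x, ‖unitDir X z - unitDir X x‖ < δ := by
        have := (hcu.sub continuous_const).norm.tendsto x (f := fun z => ‖unitDir X z - unitDir X x‖)
        rw [sub_self, norm_zero] at this
        exact this.eventually_lt_const hδ
      have h3 : ∀ᶠ z in nhdsWithin x (Ioi x), z ∈ Ioc x y := Ioc_mem_nhdsGT hy
      obtain ⟨z, hz1, hz2⟩ := ((hnear.filter_mono nhdsWithin_le_nhds).and h3).exists
      refine ⟨z, ?_, hz2⟩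
      have h4 := hsmall _ _ (norm_unitDir (h0 x)) (norm_unitDir (h0 z)) hz1
      have h5 := norm_unitDir_sub_le hX h0 hz2.1.le
      have h6 := angle_le_angle_add_angle (unitDir X s) (unitDir X x) (unitDir X z)
      have h7 := intervalIntegral.integral_add_adjacent_intervals (hint s x) (hint x z)
      have hxS' : angle (unitDir X s) (unitDir X x) ≤ c * ∫ u in s..x, turnRate X X' u := hxS
      change angle (unitDir X s) (unitDir X z) ≤ c * ∫ u in s..z, turnRate X X' u
      rw [← h7]
      nlinarith
  exact key ⟨hst, le_rfl⟩

end Sphere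

/-! ### Spherical closed curves of length at most `2π` -/

section SphereLength

open InnerProductGeometry

variable {E : Type*} [NormedAddCommGroup E] [InnerProductSpace ℝ E]

theorem inner_eq_cos_angle {x y : E} (hx : ‖x‖ = 1) (hy : ‖y‖ = 1) :
    ⟪x, y⟫ = Real.cos (angle x y) := by
  rw [cos_angle, hx, hy]
  simp

theorem inner_add_nonneg_of_angle_le {a b x : E} (ha : ‖a‖ = 1) (hb : ‖b‖ = 1) (hx : ‖x‖ = 1)
    (h : angle a x + angle x b ≤ π) : 0 ≤ ⟪x, a + b⟫ := by
  have h1 := Real.cos_le_cos_of_nonneg_of_le_pi (angle_nonneg x b)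
    (show π - angle a x ≤ π by linarith [angle_nonneg a x]) (by linarith)
  rw [Real.cos_pi_sub, ← inner_eq_cos_angle ha hx, ← inner_eq_cos_angle hx hb,
    real_inner_comm] at h1
  rw [inner_add_right]
  linarith

theorem inner_add_pos_of_angle_lt {a b x : E} (ha : ‖a‖ = 1) (hb : ‖b‖ = 1) (hx : ‖x‖ = 1)
    (h : angle a x + angle x b < π) : 0 < ⟪x, a + b⟫ := by
  have h1 := Real.cos_lt_cos_of_nonneg_of_le_pi (angle_nonneg x b)
    (show π - angle a x ≤ π by linarith [angle_nonneg a x]) (by linarith)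
  rw [Real.cos_pi_sub, ← inner_eq_cos_angle ha hx, ← inner_eq_cos_angle hx hb,
    real_inner_comm] at h1
  rw [inner_add_right]
  linarith

/-- Three consecutive arcs joining `a` to `-a` of total length at most `π` cannot leave and
re-enter the open half space `0 < l`. -/
theorem apply_nonpos_of_angle_add_le_pi {a x y : E} (hy : y ≠ 0)
    (h : angle a x + angle x y + angle y (-a) ≤ π) (l : E →ₗ[ℝ] ℝ) (hla : 0 < l a)
    (hlx : l x < 0) : l y ≤ 0 := by
  have h1 := angle_le_angle_add_angle x y (-a)
  have h2 : angle x (-a) = π - angle a x := by rw [angle_neg_right, angle_comm]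
  have h3 : angle x (-a) = angle x y + angle y (-a) := by linarith
  rcases (angle_eq_angle_add_angle_iff hy).1 h3 with h4 | h4
  · have h5 : angle a x = 0 := by linarith
    obtain ⟨-, r, hr, rfl⟩ := angle_eq_zero_iff.1 h5
    rw [map_smul, smul_eq_mul] at hlx
    nlinarith
  · obtain ⟨p, q, rfl⟩ := Submodule.mem_span_pair.1 h4
    rw [map_add, NNReal.smul_def, NNReal.smul_def, map_smul, map_smul, map_neg, smul_eq_mul,
      smul_eq_mul]
    nlinarith [p.2, q.2, mul_nonneg p.2 (neg_nonneg.2 hlx.le), mul_nonneg q.2 hla.le]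

variable {X X' : ℝ → E}

theorem turnRate_periodic (hp : Function.Periodic X 1) (hp' : Function.Periodic X' 1) :
    Function.Periodic (turnRate X X') 1 := by
  intro t
  simp only [turnRate, unitDir, hp t, hp' t]

theorem unitDir_periodic (hp : Function.Periodic X 1) : Function.Periodic (unitDir X) 1 := by
  intro t
  simp only [unitDir, hp t]

theorem integral_inner_eq_zero [CompleteSpace E] (hX : Continuous X)
    (hp : Function.Periodic X 1) (hmean : ∫ t in (0 : ℝ)..1, X t = 0) (c : E) (u : ℝ) :
    ∫ t in u..(u + 1), ⟪X t, c⟫ = 0 := by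
  have hper : Function.Periodic (fun t => ⟪X t, c⟫) 1 := fun t => by simp only [hp t]
  rw [hper.intervalIntegral_add_eq u 0, zero_add]
  have h1 := (innerSL ℝ c).intervalIntegral_comp_comm (hX.intervalIntegrable (μ := volume) 0 1)
  rw [hmean, map_zero] at h1
  simpa only [innerSL_apply_apply, real_inner_comm] using h1

theorem exists_bisecting_time (hX : IsPrimitive X X') (h0 : ∀ t, X t ≠ 0)
    (hp : Function.Periodic X 1) (hp' : Function.Periodic X' 1) (u : ℝ) :
    ∃ m ∈ Icc u (u + 1),
      ∫ t in u..m, turnRate X X' t = (∫ t in (0 : ℝ)..1, turnRate X X' t) / 2 ∧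
      ∫ t in m..(u + 1), turnRate X X' t = (∫ t in (0 : ℝ)..1, turnRate X X' t) / 2 := by
  have hint := intervalIntegrable_turnRate hX h0
  have hL : ∫ t in u..(u + 1), turnRate X X' t = ∫ t in (0 : ℝ)..1, turnRate X X' t := by
    rw [(turnRate_periodic hp hp').intervalIntegral_add_eq u 0, zero_add]
  have hL0 : 0 ≤ ∫ t in (0 : ℝ)..1, turnRate X X' t :=
    intervalIntegral.integral_nonneg zero_le_one fun t _ => turnRate_nonneg _ _ _
  have hc := intervalIntegral.continuous_primitive hint u
  obtain ⟨m, hm, hmeq⟩ := intermediate_value_Icc (show u ≤ u + 1 by linarith) hc.continuousOn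
    (show (∫ t in (0 : ℝ)..1, turnRate X X' t) / 2 ∈ _ by
      rw [intervalIntegral.integral_same, hL]
      constructor <;> linarith)
  refine ⟨m, hm, hmeq, ?_⟩
  have := intervalIntegral.integral_add_adjacent_intervals (hint u m) (hint m (u + 1))
  dsimp only at hmeq
  linarith

theorem inner_eq_norm_mul (h0 : ∀ t, X t ≠ 0) (t : ℝ) (c : E) :
    ⟪X t, c⟫ = ‖X t‖ * ⟪unitDir X t, c⟫ := by
  conv_lhs => rw [← smul_unitDir (h0 t)]
  rw [real_inner_smul_left]

theorem apply_unitDir (h0 : ∀ t, X t ≠ 0) (l : E →ₗ[ℝ] ℝ) (t : ℝ) :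
    l (X t) = ‖X t‖ * l (unitDir X t) := by
  conv_lhs => rw [← smul_unitDir (h0 t)]
  rw [map_smul, smul_eq_mul]

variable [CompleteSpace E]

theorem angle_add_angle_le_half (hX : IsPrimitive X X') (h0 : ∀ t, X t ≠ 0)
    (hp : Function.Periodic X 1) {u m c : ℝ}
    (h1 : ∫ t in u..m, turnRate X X' t = c) (h2 : ∫ t in m..(u + 1), turnRate X X' t = c)
    {t : ℝ} (ht : t ∈ Icc u (u + 1)) :
    angle (unitDir X u) (unitDir X t) + angle (unitDir X t) (unitDir X m) ≤ c := by
  have hint := intervalIntegrable_turnRate hX h0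
  rcases le_total t m with htm | htm
  · rw [← h1, ← intervalIntegral.integral_add_adjacent_intervals (hint u t) (hint t m)]
    exact add_le_add (angle_unitDir_le hX h0 ht.1) (angle_unitDir_le hX h0 htm)
  · rw [← h2, ← intervalIntegral.integral_add_adjacent_intervals (hint m t) (hint t (u + 1)),
      add_comm, angle_comm, ← unitDir_periodic hp u, angle_comm (unitDir X (u + 1))]
    exact add_le_add (angle_unitDir_le hX h0 htm) (angle_unitDir_le hX h0 ht.2)

/-- A closed curve whose mean vanishes has a radial projection of length at least `2π`. -/
theorem two_pi_le_integral_turnRate (hX : IsPrimitive X X') (h0 : ∀ t, X t ≠ 0)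
    (hp : Function.Periodic X 1) (hp' : Function.Periodic X' 1)
    (hmean : ∫ t in (0 : ℝ)..1, X t = 0) :
    2 * π ≤ ∫ t in (0 : ℝ)..1, turnRate X X' t := by
  by_contra! hlt
  obtain ⟨m, hm, h1, h2⟩ := exists_bisecting_time hX h0 hp hp' 0
  have hpos : 0 < ∫ t in (0 : ℝ)..(0 + 1), ⟪X t, unitDir X 0 + unitDir X m⟫ := by
    refine intervalIntegral.intervalIntegral_pos_of_pos_on ?_ (fun t ht => ?_) (by norm_num)
    · exact (hX.continuous.inner continuous_const).intervalIntegrable _ _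
    · rw [inner_eq_norm_mul h0]
      refine mul_pos (norm_pos_iff.2 (h0 t)) (inner_add_pos_of_angle_lt (norm_unitDir (h0 _))
        (norm_unitDir (h0 _)) (norm_unitDir (h0 _)) ?_)
      linarith [angle_add_angle_le_half hX h0 hp h1 h2 ⟨ht.1.le, ht.2.le⟩]
  rw [integral_inner_eq_zero hX.continuous hp hmean] at hpos
  exact hpos.false

theorem exists_antipodal_time (hX : IsPrimitive X X') (h0 : ∀ t, X t ≠ 0)
    (hp : Function.Periodic X 1) (hp' : Function.Periodic X' 1)
    (hmean : ∫ t in (0 : ℝ)..1, X t = 0)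
    (hL : ∫ t in (0 : ℝ)..1, turnRate X X' t = 2 * π) (u : ℝ) :
    ∃ m ∈ Icc u (u + 1), unitDir X m = -unitDir X u ∧
      ∫ t in u..m, turnRate X X' t = π ∧ ∫ t in m..(u + 1), turnRate X X' t = π := by
  obtain ⟨m, hm, h1, h2⟩ := exists_bisecting_time hX h0 hp hp' u
  rw [hL, mul_div_cancel_left₀ _ two_ne_zero] at h1 h2
  refine ⟨m, hm, ?_, h1, h2⟩
  set a := unitDir X u
  set b := unitDir X m
  have ha : ‖a‖ = 1 := norm_unitDir (h0 _)
  have hb : ‖b‖ = 1 := norm_unitDir (h0 _)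
  have hnn : ∀ t ∈ Icc u (u + 1), 0 ≤ ⟪X t, a + b⟫ := fun t ht => by
    rw [inner_eq_norm_mul h0]
    exact mul_nonneg (norm_nonneg _) (inner_add_nonneg_of_angle_le ha hb (norm_unitDir (h0 _))
      (angle_add_angle_le_half hX h0 hp h1 h2 ht))
  have hzero : ⟪X u, a + b⟫ = 0 := by
    by_contra hne
    have hlt : 0 < ⟪X u, a + b⟫ :=
      lt_of_le_of_ne (hnn u ⟨le_rfl, by linarith⟩) (Ne.symm hne)
    have := intervalIntegral.integral_pos (f := fun t => ⟪X t, a + b⟫)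
      (show u < u + 1 by linarith) (hX.continuous.inner continuous_const).continuousOn
      (fun t ht => hnn t ⟨ht.1.le, ht.2⟩) ⟨u, ⟨le_rfl, by linarith⟩, hlt⟩
    rw [integral_inner_eq_zero hX.continuous hp hmean] at this
    exact this.false
  rw [inner_eq_norm_mul h0, mul_eq_zero, or_iff_right (norm_ne_zero_iff.2 (h0 u)),
    inner_add_right] at hzero
  change ⟪a, a⟫ + ⟪a, b⟫ = 0 at hzero
  rw [real_inner_self_eq_norm_sq, ha] at hzero
  have : ‖a + b‖ ^ 2 = 0 := by
    rw [norm_add_sq_real, ha, hb]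
    linarith
  rw [sq_eq_zero_iff, norm_eq_zero] at this
  exact (neg_eq_of_add_eq_zero_right this).symm

theorem apply_nonpos_of_antipodal (hX : IsPrimitive X X') (h0 : ∀ t, X t ≠ 0) {s m t t' : ℝ}
    (hm : unitDir X m = -unitDir X s) (hL : ∫ v in s..m, turnRate X X' v = π)
    (hst : s ≤ t) (htt' : t ≤ t') (htm : t' ≤ m) (l : E →ₗ[ℝ] ℝ)
    (hs : 0 < l (unitDir X s)) (ht : l (unitDir X t) < 0) : l (unitDir X t') ≤ 0 := by
  have hint := intervalIntegrable_turnRate hX h0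
  refine apply_nonpos_of_angle_add_le_pi (unitDir_ne_zero (h0 t')) ?_ l hs ht
  rw [← hm, ← hL, ← intervalIntegral.integral_add_adjacent_intervals (hint s t') (hint t' m),
    ← intervalIntegral.integral_add_adjacent_intervals (hint s t) (hint t t')]
  exact add_le_add (add_le_add (angle_unitDir_le hX h0 hst) (angle_unitDir_le hX h0 htt'))
    (angle_unitDir_le hX h0 htm)

/-- If the radial projection has length exactly `2π`, every linear functional changes sign at
most twice along the curve. -/
theorem not_four_sign_changes (hX : IsPrimitive X X') (h0 : ∀ t, X t ≠ 0)
    (hp : Function.Periodic X 1) (hp' : Function.Periodic X' 1)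
    (hmean : ∫ t in (0 : ℝ)..1, X t = 0)
    (hL : ∫ t in (0 : ℝ)..1, turnRate X X' t = 2 * π) (l : E →ₗ[ℝ] ℝ) {a b c d : ℝ}
    (hab : a < b) (hbc : b < c) (hcd : c < d) (hda : d < a + 1)
    (ha : 0 < l (X a)) (hb : l (X b) < 0) (hc : 0 < l (X c)) : 0 ≤ l (X d) := by
  by_contra! hd
  have hpos : ∀ {t}, 0 < l (X t) → 0 < l (unitDir X t) := fun {t} h => by
    rw [apply_unitDir h0] at h
    exact pos_of_mul_pos_right h (norm_nonneg _)
  have hneg : ∀ {t}, l (X t) < 0 → l (unitDir X t) < 0 := fun {t} h => by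
    rw [apply_unitDir h0] at h
    exact neg_of_mul_neg_right h (norm_nonneg _)
  obtain ⟨m, hm, hanti, h1, h2⟩ := exists_antipodal_time hX h0 hp hp' hmean hL a
  rcases le_or_gt c m with hcm | hcm
  · have := apply_nonpos_of_antipodal hX h0 hanti h1 hab.le hbc.le hcm l (hpos ha) (hneg hb)
    exact absurd (hpos hc) this.not_gt
  · have := apply_nonpos_of_antipodal hX h0 (s := m) (m := a + 1)
      (by rw [unitDir_periodic hp, hanti, neg_neg]) h2 hcm.le hcd.le hda.le (-l)
      (by rw [hanti]; simpa using hpos ha) (by simpa using hpos hc)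
    have h3 := hneg hd
    simp only [LinearMap.neg_apply] at this
    linarith

end SphereLength

/-! ### Curves crossing every hyperplane at most twice -/

section TwoCrossing

/-- Injectivity of a `1`-periodic curve modulo its period. -/
def InjectiveModOne {X : Type*} (γ : ℝ → X) : Prop :=
  ∀ s t : ℝ, γ s = γ t → ∃ k : ℤ, s - t = k

theorem InjectiveModOne.eq_of_abs_lt {X : Type*} {γ : ℝ → X} (h : InjectiveModOne γ) {s t : ℝ}
    (hst : |s - t| < 1) (heq : γ s = γ t) : s = t := by
  obtain ⟨k, hk⟩ := h s t heq
  rw [hk] at hst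
  have hk0 : |k| < 1 := by exact_mod_cast hst
  rw [Int.abs_lt_one_iff.1 hk0, Int.cast_zero, sub_eq_zero] at hk
  exact hk

variable {E : Type*} [NormedAddCommGroup E] [NormedSpace ℝ E]

/-- No hyperplane separates two points of the `1`-periodic curve `γ` from two points interlaced
with them. -/
def TwoCrossing (γ : ℝ → E) : Prop :=
  ∀ (l : E →L[ℝ] ℝ) (κ a b c d : ℝ), a < b → b < c → c < d → d < a + 1 →
    l (γ a) < κ → κ < l (γ b) → l (γ c) < κ → l (γ d) ≤ κ

theorem exists_forall_exists_lt_add {h : ℝ → ℝ} (hc : Continuous h) {p q : ℝ} (hpq : p < q)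
    (hlt : h p < h q) :
    ∃ δ > 0, ∀ w, 0 < w → w < δ → ∃ u, p ≤ u ∧ u + w ≤ q ∧ h u < h (u + w) := by
  obtain ⟨δ, hδ, hball⟩ := Metric.eventually_nhds_iff.1 (hc.continuousAt.eventually_const_lt hlt)
  refine ⟨δ, hδ, fun w hw hwδ => ?_⟩
  by_contra! hcon
  set N := ⌊(q - p) / w⌋₊ with hN
  have h1 : N * w ≤ q - p :=
    (le_div_iff₀ hw).1 (Nat.floor_le (div_nonneg (sub_nonneg.2 hpq.le) hw.le))
  have h2 : q - p < (N + 1) * w := (div_lt_iff₀ hw).1 (Nat.lt_floor_add_one _)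
  have hstep : ∀ k : ℕ, k ≤ N → h (p + k * w) ≤ h p := by
    intro k
    induction k with
    | zero => simp
    | succ k ih =>
      intro hk
      have hk' : ((k : ℝ) + 1) * w ≤ N * w := by
        gcongr
        exact_mod_cast hk
      have h3 := hcon (p + k * w) (by nlinarith [Nat.cast_nonneg (α := ℝ) k]) (by nlinarith)
      have h4 : p + ((k + 1 : ℕ) : ℝ) * w = p + k * w + w := by
        push_cast
        ring
      rw [h4]
      exact h3.trans (ih (by omega))
  have h5 := hball (y := p + N * w) (by
    rw [Real.dist_eq, abs_lt]
    constructor <;> nlinarith)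
  exact (hstep N le_rfl).not_gt h5

theorem twoCrossing_of_secants {γ : ℝ → E} (hc : Continuous γ) (hp : Function.Periodic γ 1)
    (h : ∀ w, 0 < w → w < 1 → ∀ (l : E →L[ℝ] ℝ) (a b c d : ℝ), a < b → b < c → c < d →
      d < a + 1 → 0 < l (γ (a + w) - γ a) → l (γ (b + w) - γ b) < 0 →
      0 < l (γ (c + w) - γ c) → 0 ≤ l (γ (d + w) - γ d)) :
    TwoCrossing γ := by
  intro l κ a b c d hab hbc hcd hda ha hb hcκ
  by_contra! hd
  have hl : Continuous fun t => l (γ t) := l.continuous.comp hc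
  obtain ⟨δ₁, hδ₁, h1⟩ := exists_forall_exists_lt_add hl hab (ha.trans hb)
  obtain ⟨δ₂, hδ₂, h2⟩ := exists_forall_exists_lt_add hl.neg hbc
    (by simpa using hcκ.trans hb)
  obtain ⟨δ₃, hδ₃, h3⟩ := exists_forall_exists_lt_add hl hcd (hcκ.trans hd)
  obtain ⟨δ₄, hδ₄, h4⟩ := exists_forall_exists_lt_add hl.neg hda
    (by simpa [hp a] using ha.trans hd)
  obtain ⟨w, hw, hwlt⟩ := exists_between
    (show 0 < min 1 (min (min δ₁ δ₂) (min δ₃ δ₄)) by positivity)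
  simp only [lt_min_iff] at hwlt
  obtain ⟨hw1, ⟨hwδ₁, hwδ₂⟩, hwδ₃, hwδ₄⟩ := hwlt
  obtain ⟨u₁, h11, h12, h13⟩ := h1 w hw hwδ₁
  obtain ⟨u₂, h21, h22, h23⟩ := h2 w hw hwδ₂
  obtain ⟨u₃, h31, h32, h33⟩ := h3 w hw hwδ₃
  obtain ⟨u₄, h41, h42, h43⟩ := h4 w hw hwδ₄
  simp only [Pi.neg_apply, neg_lt_neg_iff] at h23 h43
  have := h w hw hw1 l u₁ u₂ u₃ u₄ (by linarith) (by linarith) (by linarith) (by linarith)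
    (by rw [map_sub]; linarith) (by rw [map_sub]; linarith) (by rw [map_sub]; linarith)
  rw [map_sub] at this
  linarith

theorem TwoCrossing.exists_chord_inter {γ : ℝ → E} (h : TwoCrossing γ) {a b c d : ℝ}
    (hab : a < b) (hbc : b < c) (hcd : c < d) (hda : d < a + 1) :
    ∃ r ∈ Icc (0 : ℝ) 1, ∃ s ∈ Icc (0 : ℝ) 1,
      (1 - r) • γ a + r • γ c = (1 - s) • γ b + s • γ d := by
  have hcpt : ∀ x y : E, IsCompact (segment ℝ x y) := fun x y => by
    rw [segment_eq_image]
    exact isCompact_Icc.image (by fun_prop)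
  by_cases hdisj : Disjoint (segment ℝ (γ a) (γ c)) (segment ℝ (γ b) (γ d))
  · obtain ⟨l, κ, κ', h1, h2, h3⟩ := geometric_hahn_banach_compact_closed
      (convex_segment (𝕜 := ℝ) (γ a) (γ c)) (hcpt _ _) (convex_segment (𝕜 := ℝ) (γ b) (γ d))
      (hcpt _ _).isClosed hdisj
    have := h l κ a b c d hab hbc hcd hda (h1 _ (left_mem_segment ℝ _ _))
      (h2.trans (h3 _ (left_mem_segment ℝ _ _))) (h1 _ (right_mem_segment ℝ _ _))
    linarith [h3 _ (right_mem_segment ℝ (γ b) (γ d))]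
  · obtain ⟨x, hx1, hx2⟩ := Set.not_disjoint_iff.1 hdisj
    rw [segment_eq_image] at hx1 hx2
    obtain ⟨r, hr, rfl⟩ := hx1
    obtain ⟨s, hs, hrs⟩ := hx2
    exact ⟨r, hr, s, hs, hrs.symm⟩

/-- An injective closed curve is not contained in a line. -/
theorem InjectiveModOne.exists_linearIndependent {γ : ℝ → E} (hinj : InjectiveModOne γ)
    (hc : Continuous γ) (hp : Function.Periodic γ 1) :
    ∃ x y : ℝ, 0 < x ∧ x < y ∧ y < 1 ∧ LinearIndependent ℝ ![γ x - γ 0, γ y - γ 0] := by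
  set e := γ (1 / 2) - γ 0 with he
  have hne : ∀ {s t : ℝ}, |s - t| < 1 → s ≠ t → γ s ≠ γ t := fun h1 h2 h3 =>
    h2 (hinj.eq_of_abs_lt h1 h3)
  have he0 : e ≠ 0 := sub_ne_zero.2 (hne (by norm_num [abs_of_pos]) (by norm_num))
  obtain ⟨v, hv, hvI⟩ : ∃ v ∈ Ioo (0 : ℝ) 1, LinearIndependent ℝ ![e, γ v - γ 0] := by
    by_contra! hcon
    obtain ⟨l, -, hl⟩ := exists_dual_vector ℝ e (norm_ne_zero_iff.2 he0)
    have hl0 : l e ≠ 0 := by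
      rw [hl]
      simpa using he0
    set F : ℝ → ℝ := fun t => l (γ t - γ 0) / l e with hF
    have hFc : Continuous F := (l.continuous.comp (hc.sub continuous_const)).div_const _
    have hFt : ∀ t ∈ Ioo (0 : ℝ) 1, γ t = γ 0 + F t • e := by
      intro t ht
      have h1 := hcon t ht
      rw [LinearIndependent.pair_iff' he0] at h1
      push Not at h1
      obtain ⟨c, hce⟩ := h1
      have : F t = c := by
        rw [hF]
        simp only [← hce, map_smul, smul_eq_mul]
        field_simp
      rw [this, hce]
      abel
    have hF0 : F 0 = 0 := by simp [hF]
    have hF1 : F 1 = 0 := by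
      have := hp 0
      rw [zero_add] at this
      simp [hF, this]
    have hFh : F (1 / 2) = 1 := by
      simp only [hF, ← he]
      exact div_self hl0
    obtain ⟨s, hs, hs2⟩ := intermediate_value_Icc (show (0 : ℝ) ≤ 1 / 2 by norm_num)
      hFc.continuousOn (show (1 / 2 : ℝ) ∈ _ by rw [hF0, hFh]; constructor <;> norm_num)
    obtain ⟨t, ht, ht2⟩ := intermediate_value_Icc' (show (1 / 2 : ℝ) ≤ 1 by norm_num)
      hFc.continuousOn (show (1 / 2 : ℝ) ∈ _ by rw [hF1, hFh]; constructor <;> norm_num)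
    have hs0 : 0 < s := lt_of_le_of_ne hs.1 fun h => by
      rw [← h, hF0] at hs2
      norm_num at hs2
    have ht1 : t < 1 := lt_of_le_of_ne ht.2 fun h => by
      rw [h, hF1] at ht2
      norm_num at ht2
    have hs1 : s ≠ 1 / 2 := fun h => by
      rw [h, hFh] at hs2
      norm_num at hs2
    have hslt : s < t := (lt_of_le_of_ne hs.2 hs1).trans_le ht.1
    refine hne (s := s) (t := t) ?_ hslt.ne ?_
    · rw [abs_lt]
      constructor <;> linarith
    · rw [hFt s ⟨hs0, hslt.trans ht1⟩, hFt t ⟨hs0.trans hslt, ht1⟩, hs2, ht2]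
  have hvne : v ≠ 1 / 2 := by
    rintro rfl
    have := hvI.injective (a₁ := 0) (a₂ := 1) (by simp [he])
    simp at this
  rcases lt_or_gt_of_ne hvne with h | h
  · refine ⟨v, 1 / 2, hv.1, h, by norm_num, ?_⟩
    rw [LinearIndependent.pair_symm_iff]
    exact hvI
  · exact ⟨1 / 2, v, by norm_num, h, hv.2, hvI⟩

/-- A nondegenerate closed curve crossing every hyperplane at most twice is planar. -/
theorem TwoCrossing.sub_mem_span {γ : ℝ → E} (h : TwoCrossing γ) (hp : Function.Periodic γ 1)
    {x y : ℝ} (hx : 0 < x) (hxy : x < y) (hy : y < 1)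
    (hI : LinearIndependent ℝ ![γ x - γ 0, γ y - γ 0]) (t : ℝ) :
    γ t - γ 0 ∈ Submodule.span ℝ {γ x - γ 0, γ y - γ 0} := by
  rw [LinearIndependent.pair_iff] at hI
  set V := Submodule.span ℝ {γ x - γ 0, γ y - γ 0} with hV
  have hmem : ∀ {k α β : ℝ} {t : ℝ}, k ≠ 0 →
      k • (γ t - γ 0) = α • (γ x - γ 0) + β • (γ y - γ 0) → γ t - γ 0 ∈ V := by
    intro k α β t hk h1
    rw [← Submodule.smul_mem_iff _ hk, h1]
    exact Submodule.mem_span_pair.2 ⟨α, β, rfl⟩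
  obtain ⟨t', ht, htt'⟩ := hp.exists_mem_Ico₀ one_pos t
  rw [htt']
  clear htt' t
  rename ℝ => t
  rcases ht.1.eq_or_lt with h0 | h0
  · rw [← h0, sub_self]
    exact V.zero_mem
  rcases lt_trichotomy t x with htx | rfl | htx
  · obtain ⟨r, -, s, -, hrs⟩ := h.exists_chord_inter h0 htx hxy (by linarith)
    have key : (1 - s) • (γ t - γ 0) = r • (γ x - γ 0) + (-s) • (γ y - γ 0) := by
      linear_combination (norm := module) (-1 : ℝ) • hrs
    refine hmem (fun hs => ?_) key
    rw [hs, zero_smul] at key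
    have := (hI _ _ key.symm).2
    linarith
  · exact Submodule.subset_span (by simp)
  rcases lt_trichotomy t y with hty | rfl | hty
  · obtain ⟨r, -, s, -, hrs⟩ := h.exists_chord_inter hx htx hty (by linarith)
    have key : r • (γ t - γ 0) = (1 - s) • (γ x - γ 0) + s • (γ y - γ 0) := by
      linear_combination (norm := module) (1 : ℝ) • hrs
    refine hmem (fun hs => ?_) key
    rw [hs, zero_smul] at key
    have := hI _ _ key.symm
    linarith
  · exact Submodule.subset_span (by simp)
  · obtain ⟨r, -, s, -, hrs⟩ := h.exists_chord_inter hx hxy hty (by linarith [ht.2])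
    have key : s • (γ t - γ 0) = (s - 1) • (γ x - γ 0) + r • (γ y - γ 0) := by
      linear_combination (norm := module) (-1 : ℝ) • hrs
    refine hmem (fun hs => ?_) key
    rw [hs, zero_smul] at key
    have := hI _ _ key.symm
    linarith

end TwoCrossing

/-! ### Orientation of planar curves -/

section Orientation

/-- The oriented area of the parallelogram spanned by two complex numbers. -/
def cross (x y : ℂ) : ℝ := x.re * y.im - x.im * y.re

/-- All triples of points of the curve in increasing order are positively oriented, in the weak
sense. -/
def Counterclockwise (z : ℝ → ℂ) : Prop :=
  ∀ a b c : ℝ, a < b → b < c → c < a + 1 → 0 ≤ cross (z b - z a) (z c - z a)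

theorem cross_conj (x y : ℂ) :
    cross (starRingEnd ℂ x) (starRingEnd ℂ y) = -cross x y := by
  simp only [cross, Complex.conj_re, Complex.conj_im]
  ring

theorem cross_rotate (x y z : ℂ) : cross (y - x) (z - x) = cross (x - z) (y - z) := by
  simp only [cross, Complex.sub_re, Complex.sub_im]
  ring

/-- If the diagonals of a quadrilateral intersect, its four triangles are oriented alike. -/
theorem cross_of_chord_inter {x y z w : ℂ} {r s : ℝ}
    (h : (1 - r) • x + r • z = (1 - s) • y + s • w) :
    ∃ k : ℝ, cross (y - x) (z - x) = s * k ∧ cross (z - x) (w - x) = (1 - s) * k ∧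
      cross (y - x) (w - x) = r * k ∧ cross (z - y) (w - y) = (1 - r) * k := by
  have h1 := congrArg Complex.re h
  have h2 := congrArg Complex.im h
  simp only [Complex.add_re, Complex.add_im, Complex.smul_re, Complex.smul_im, smul_eq_mul]
    at h1 h2
  refine ⟨cross (z - x) (w - x) + cross (y - x) (z - x), ?_, ?_, ?_, ?_⟩
  all_goals simp only [cross, Complex.sub_re, Complex.sub_im]
  · linear_combination (z.re - x.re) * h2 - (z.im - x.im) * h1
  · linear_combination -(z.re - x.re) * h2 + (z.im - x.im) * h1
  · linear_combination (w.re - y.re) * h2 - (w.im - y.im) * h1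
  · linear_combination -(w.re - y.re) * h2 + (w.im - y.im) * h1

theorem TwoCrossing.cross_same_sign {z : ℝ → ℂ} (h : TwoCrossing z) {a b c d : ℝ}
    (hab : a < b) (hbc : b < c) (hcd : c < d) (hda : d < a + 1) :
    ∃ k : ℝ, ∃ r ∈ Icc (0 : ℝ) 1, ∃ s ∈ Icc (0 : ℝ) 1,
      cross (z b - z a) (z c - z a) = s * k ∧ cross (z c - z a) (z d - z a) = (1 - s) * k ∧
      cross (z b - z a) (z d - z a) = r * k ∧ cross (z c - z b) (z d - z b) = (1 - r) * k := by
  obtain ⟨r, hr, s, hs, hrs⟩ := h.exists_chord_inter hab hbc hcd hda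
  obtain ⟨k, hk⟩ := cross_of_chord_inter hrs
  exact ⟨k, r, hr, s, hs, hk⟩

/-- Symmetrized area of the triangle with vertices `z 0`, `z s`, `z t`. -/
def baseArea (z : ℝ → ℂ) (s t : ℝ) : ℝ :=
  cross (z (min s t) - z 0) (z (max s t) - z 0)

theorem baseArea_comm (z : ℝ → ℂ) (s t : ℝ) : baseArea z s t = baseArea z t s := by
  rw [baseArea, min_comm, max_comm, baseArea]

theorem cross_self (x : ℂ) : cross x x = 0 := by
  rw [cross]
  ring

theorem cross_swap (x y : ℂ) : cross x y = -cross y x := by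
  rw [cross, cross]
  ring

theorem baseArea_self (z : ℝ → ℂ) (s : ℝ) : baseArea z s s = 0 := by
  rw [baseArea, min_self, max_self, cross_self]

theorem baseArea_of_le (z : ℝ → ℂ) {s t : ℝ} (h : s ≤ t) :
    baseArea z s t = cross (z s - z 0) (z t - z 0) := by
  rw [baseArea, min_eq_left h, max_eq_right h]

theorem abs_baseArea (z : ℝ → ℂ) (s t : ℝ) :
    |baseArea z s t| = |cross (z s - z 0) (z t - z 0)| := by
  rcases le_total s t with h | h
  · rw [baseArea_of_le z h]
  · rw [baseArea_comm, baseArea_of_le z h, cross_swap, abs_neg]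

theorem TwoCrossing.baseArea_mul_nonneg {z : ℝ → ℂ} (h : TwoCrossing z) {s t v : ℝ}
    (hs : s ∈ Ioo (0 : ℝ) 1) (ht : t ∈ Ioo (0 : ℝ) 1) (hv : v ∈ Ioo (0 : ℝ) 1) :
    0 ≤ baseArea z s t * baseArea z t v := by
  have main : ∀ {a b c : ℝ}, a ∈ Ioo (0 : ℝ) 1 → b ∈ Ioo (0 : ℝ) 1 → c ∈ Ioo (0 : ℝ) 1 →
      a < b → b < c → 0 ≤ baseArea z a b * baseArea z b c ∧
      0 ≤ baseArea z a b * baseArea z a c ∧ 0 ≤ baseArea z a c * baseArea z b c := by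
    intro a b c ha hb hc hab hbc
    obtain ⟨k, r, hr, q, hq, h1, h2, h3, -⟩ :=
      h.cross_same_sign ha.1 hab hbc (by linarith [hc.2])
    rw [baseArea_of_le z hab.le, baseArea_of_le z hbc.le, baseArea_of_le z (hab.trans hbc).le,
      h1, h2, h3]
    have hq' : 0 ≤ 1 - q := sub_nonneg.2 hq.2
    refine ⟨?_, ?_, ?_⟩
    · calc (0 : ℝ) ≤ (q * (1 - q)) * (k * k) :=
            mul_nonneg (mul_nonneg hq.1 hq') (mul_self_nonneg k)
        _ = _ := by ring
    · calc (0 : ℝ) ≤ (q * r) * (k * k) := mul_nonneg (mul_nonneg hq.1 hr.1) (mul_self_nonneg k)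
        _ = _ := by ring
    · calc (0 : ℝ) ≤ (r * (1 - q)) * (k * k) :=
            mul_nonneg (mul_nonneg hr.1 hq') (mul_self_nonneg k)
        _ = _ := by ring
  rcases lt_trichotomy s t with hst | rfl | hst
  · rcases lt_trichotomy t v with htv | rfl | htv
    · exact (main hs ht hv hst htv).1
    · simp [baseArea_self]
    · rw [baseArea_comm z t v]
      rcases lt_trichotomy s v with hsv | rfl | hsv
      · rw [mul_comm, mul_comm]
        exact (main hs hv ht hsv htv).2.2
      · exact mul_self_nonneg _
      · rw [baseArea_comm z v t, baseArea_comm z t v, mul_comm]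
        exact (main hv hs ht hsv hst).2.2
  · simp [baseArea_self]
  · rw [baseArea_comm z s t]
    rcases lt_trichotomy t v with htv | rfl | htv
    · rcases lt_trichotomy s v with hsv | rfl | hsv
      · exact (main ht hs hv hst hsv).2.1
      · exact mul_self_nonneg _
      · rw [mul_comm]
        exact (main ht hv hs htv hsv).2.1
    · simp [baseArea_self]
    · rw [baseArea_comm z t v, mul_comm]
      exact (main hv ht hs htv hst).1

theorem eq_zero_of_cross_eq_zero {x y w : ℂ} (h : cross x y ≠ 0) (h1 : cross x w = 0)
    (h2 : cross y w = 0) : w = 0 := by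
  simp only [cross] at h h1 h2
  have h3 : (x.re * y.im - x.im * y.re) * w.re = 0 := by
    linear_combination y.re * h1 - x.re * h2
  have h4 : (x.re * y.im - x.im * y.re) * w.im = 0 := by
    linear_combination y.im * h1 - x.im * h2
  exact Complex.ext ((mul_eq_zero.1 h3).resolve_left h) ((mul_eq_zero.1 h4).resolve_left h)

theorem TwoCrossing.baseArea_sign {z : ℝ → ℂ} (h : TwoCrossing z) (hinj : InjectiveModOne z)
    {s t s' t' : ℝ} (hs : s ∈ Ioo (0 : ℝ) 1) (ht : t ∈ Ioo (0 : ℝ) 1)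
    (hs' : s' ∈ Ioo (0 : ℝ) 1) (ht' : t' ∈ Ioo (0 : ℝ) 1) (hst : 0 < baseArea z s t) :
    0 ≤ baseArea z s' t' := by
  by_contra! hneg
  have hne : z s' - z 0 ≠ 0 := sub_ne_zero.2 fun heq => by
    have := hinj.eq_of_abs_lt (by rw [sub_zero, abs_of_pos hs'.1]; exact hs'.2) heq
    exact hs'.1.ne' this
  have hcross : cross (z s - z 0) (z t - z 0) ≠ 0 := by
    rw [← abs_ne_zero, ← abs_baseArea, abs_ne_zero]
    exact hst.ne'
  have hor : baseArea z s s' ≠ 0 ∨ baseArea z t s' ≠ 0 := by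
    by_contra! hz
    rw [← abs_eq_zero, abs_baseArea, abs_eq_zero, ← abs_eq_zero (a := baseArea z t s'),
      abs_baseArea, abs_eq_zero] at hz
    exact hne (eq_zero_of_cross_eq_zero hcross hz.1 hz.2)
  rcases hor with h0 | h0
  · have h1 := h.baseArea_mul_nonneg ht hs hs'
    rw [baseArea_comm z t s] at h1
    have h2 : 0 < baseArea z s s' :=
      lt_of_le_of_ne (nonneg_of_mul_nonneg_right h1 hst) h0.symm
    exact (h.baseArea_mul_nonneg hs hs' ht').not_gt (mul_neg_of_pos_of_neg h2 hneg)
  · have h1 := h.baseArea_mul_nonneg hs ht hs'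
    have h2 : 0 < baseArea z t s' :=
      lt_of_le_of_ne (nonneg_of_mul_nonneg_right h1 hst) h0.symm
    exact (h.baseArea_mul_nonneg ht hs' ht').not_gt (mul_neg_of_pos_of_neg h2 hneg)

theorem TwoCrossing.counterclockwise_of_base {z : ℝ → ℂ} (h : TwoCrossing z)
    (hp : Function.Periodic z 1)
    (hbase : ∀ s t : ℝ, 0 < s → s < t → t < 1 → 0 ≤ cross (z s - z 0) (z t - z 0)) :
    Counterclockwise z := by
  have main : ∀ a b c : ℝ, 0 ≤ a → a < b → b < c → c < 1 →
      0 ≤ cross (z b - z a) (z c - z a) := by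
    intro a b c ha hab hbc hc
    rcases ha.eq_or_lt with rfl | ha
    · exact hbase b c hab hbc hc
    obtain ⟨k, r, hr, s, hs, h1, h2, h3, h4⟩ := h.cross_same_sign ha hab hbc (by linarith)
    rcases le_or_gt 0 k with hk | hk
    · rw [h4]
      exact mul_nonneg (sub_nonneg.2 hr.2) hk
    · have e1 := hbase a b ha hab (hbc.trans hc)
      have e2 := hbase b c (ha.trans hab) hbc hc
      rw [h1] at e1
      rw [h2] at e2
      nlinarith [hs.1, hs.2]
  intro a b c hab hbc hca
  have hz : ∀ (t : ℝ) (n : ℤ), z (t - n) = z t := fun t n => by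
    have := hp.sub_int_mul_eq (x := t) n
    rwa [mul_one] at this
  set n := ⌊a⌋ with hn
  have hn0 : (n : ℝ) ≤ a := Int.floor_le a
  have hn1 : a < n + 1 := Int.lt_floor_add_one a
  rw [← hz a n, ← hz b n, ← hz c n]
  have hz' : ∀ t : ℝ, z (t - n) = z (t - n - 1) := fun t => by
    have := hz (t - n) 1
    rw [Int.cast_one] at this
    exact this.symm
  rcases lt_or_ge (c - n) 1 with hc1 | hc1
  · exact main _ _ _ (by linarith) (by linarith) (by linarith) hc1
  rcases lt_or_ge (b - n) 1 with hb1 | hb1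
  · rw [cross_rotate, hz' c]
    exact main _ _ _ (by linarith) (by linarith) (by linarith) hb1
  · rw [cross_rotate, cross_rotate, hz' c, hz' b]
    exact main _ _ _ (by linarith) (by linarith) (by linarith) (by linarith)

theorem TwoCrossing.conj {z : ℝ → ℂ} (h : TwoCrossing z) :
    TwoCrossing fun t => starRingEnd ℂ (z t) := fun l κ a b c d hab hbc hcd hda =>
  h (l.comp (Complex.conjCLE : ℂ →L[ℝ] ℂ)) κ a b c d hab hbc hcd hda

/-- A closed planar curve crossing every line at most twice is oriented, up to a reflection. -/
theorem TwoCrossing.counterclockwise_or {z : ℝ → ℂ} (h : TwoCrossing z)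
    (hinj : InjectiveModOne z) (hp : Function.Periodic z 1) :
    Counterclockwise z ∨ Counterclockwise fun t => starRingEnd ℂ (z t) := by
  by_cases hex : ∃ s ∈ Ioo (0 : ℝ) 1, ∃ t ∈ Ioo (0 : ℝ) 1, 0 < baseArea z s t
  · left
    obtain ⟨s, hs, t, ht, hst⟩ := hex
    refine h.counterclockwise_of_base hp fun s' t' hs' hst' ht' => ?_
    rw [← baseArea_of_le z hst'.le]
    exact h.baseArea_sign hinj hs ht ⟨hs', hst'.trans ht'⟩ ⟨hs'.trans hst', ht'⟩ hst
  · right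
    push Not at hex
    refine h.conj.counterclockwise_of_base (fun t => by simp only [hp t])
      fun s' t' hs' hst' ht' => ?_
    rw [← map_sub, ← map_sub, cross_conj, ← baseArea_of_le z hst'.le]
    exact neg_nonneg.2 (hex s' ⟨hs', hst'.trans ht'⟩ t' ⟨hs'.trans hst', ht'⟩)

end Orientation

/-! ### The total turning of the secants of an oriented curve -/

section Turning

theorem div_im_eq_cross_div (x y : ℂ) :
    (y / x).im = cross x y / Complex.normSq x := by
  rw [Complex.div_im, cross]
  ring

theorem div_im_nonneg {x y : ℂ} (h : 0 ≤ cross x y) : 0 ≤ (y / x).im := by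
  rw [div_im_eq_cross_div x y]
  exact div_nonneg h (Complex.normSq_nonneg x)

theorem norm_projPerp_unitDir (X : ℝ → ℂ) (t : ℝ) (h0 : X t ≠ 0) (v : ℂ) :
    ‖projPerp (unitDir X t) v‖ = |cross (X t) v| / ‖X t‖ := by
  have h1 : projPerp (unitDir X t) v = v - ⟪unitDir X t, v⟫ • unitDir X t := by
    rw [projPerp, norm_unitDir h0]
    simp
  have h2 : cross (X t) v / ‖X t‖ = cross (unitDir X t) v := by
    simp only [cross, unitDir, Complex.smul_re, Complex.smul_im, smul_eq_mul]
    ring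
  have h3 : (unitDir X t).re * (unitDir X t).re + (unitDir X t).im * (unitDir X t).im = 1 := by
    rw [← Complex.normSq_apply, ← Complex.sq_norm, norm_unitDir h0, one_pow]
  have h4 : ‖projPerp (unitDir X t) v‖ ^ 2 = cross (unitDir X t) v ^ 2 := by
    rw [h1, norm_sub_sq_real, norm_smul, norm_unitDir h0, real_inner_smul_right,
      real_inner_comm, Real.norm_eq_abs, mul_one, sq_abs, Complex.sq_norm, Complex.normSq_apply,
      Complex.inner]
    simp only [Complex.mul_re, Complex.conj_re, Complex.conj_im, cross]
    linear_combination -(v.re * v.re + v.im * v.im) * h3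
  rw [← abs_of_nonneg (norm_nonneg (projPerp (unitDir X t) v)), (sq_eq_sq_iff_abs_eq_abs _ _).1 h4,
    ← h2, abs_div, abs_norm]

theorem turnRate_eq_div_im {X X' : ℝ → ℂ} {t : ℝ} (h0 : X t ≠ 0)
    (h : 0 ≤ cross (X t) (X' t)) : turnRate X X' t = (X' t / X t).im := by
  rw [turnRate, norm_projPerp_unitDir X t h0, abs_of_nonneg h,
    div_im_eq_cross_div, ← Complex.sq_norm, sq, div_div]

theorem intervalIntegrable_div_im {X X' : ℝ → ℂ} (hX : IsPrimitive X X') (h0 : ∀ t, X t ≠ 0)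
    (a b : ℝ) : IntervalIntegrable (fun t => (X' t / X t).im) volume a b := by
  have h1 : IntervalIntegrable (fun t => X' t * (X t)⁻¹) volume a b :=
    (hX.intervalIntegrable a b).mul_continuousOn (hX.continuous.inv₀ h0).continuousOn
  exact ⟨Complex.imCLM.integrable_comp h1.1, Complex.imCLM.integrable_comp h1.2⟩

/-- Two planar curves whose quotient stays in the closed upper half plane turn alike. -/
theorem integral_div_im_sub {x x' y y' : ℝ → ℂ} (hx : IsPrimitive x x') (hy : IsPrimitive y y')
    (hx0 : ∀ t, x t ≠ 0) (hy0 : ∀ t, y t ≠ 0) {a b : ℝ} (hab : a ≤ b)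
    (h : ∀ t ∈ Icc a b, 0 ≤ cross (x t) (y t)) :
    (∫ t in a..b, (y' t / y t).im) - ∫ t in a..b, (x' t / x t).im =
      (-Complex.I * (y b / x b)).arg - (-Complex.I * (y a / x a)).arg := by
  have hslit : ∀ t ∈ uIcc a b, -Complex.I * (y t / x t) ∈ Complex.slitPlane := by
    intro t ht
    rw [uIcc_of_le hab] at ht
    have h1 : -Complex.I * (y t / x t) ≠ 0 :=
      mul_ne_zero (neg_ne_zero.2 Complex.I_ne_zero) (div_ne_zero (hy0 t) (hx0 t))
    have h2 : (-Complex.I * (y t / x t)).re = (y t / x t).im := by simp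
    rcases (div_im_nonneg (h t ht)).eq_or_lt with h3 | h3
    · refine Or.inr fun h4 => h1 (Complex.ext ?_ h4)
      rw [h2, ← h3, Complex.zero_re]
    · exact Or.inl (by rw [h2]; exact h3)
  have := (hx.prodMk hy).integral_comp_eq_sub (a := a) (b := b)
    (G := fun p : ℂ × ℂ => (Complex.log (-Complex.I * (p.2 / p.1))).im)
    (H := fun t => (y' t / y t).im - (x' t / x t).im) (fun t ht => ?_) ?_
  · rw [← intervalIntegral.integral_sub (intervalIntegrable_div_im hy hy0 a b)
      (intervalIntegrable_div_im hx hx0 a b), this.2]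
    simp only [Complex.log_im]
  · refine (Complex.imCLM.contDiff (n := 1)).comp_contDiffAt (x t, y t)
      (f := fun p : ℂ × ℂ => Complex.log (-Complex.I * (p.2 / p.1))) ?_
    have h1 : ContDiffAt ℝ 1 Complex.log (-Complex.I * (y t / x t)) :=
      (Complex.contDiffAt_log (hslit t ht)).restrict_scalars ℝ
    refine ContDiffAt.comp (x t, y t) (f := fun p : ℂ × ℂ => -Complex.I * (p.2 / p.1)) h1 ?_
    simp only [div_eq_mul_inv]
    exact contDiffAt_const.mul (contDiffAt_snd.mul (contDiffAt_fst.inv (hx0 t)))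
  · filter_upwards [hx.ae_hasDerivAt, hy.ae_hasDerivAt] with t htx hty ht
    have h1 := ((hty.div htx (hx0 t)).const_mul (-Complex.I)).clog_real (hslit t ht)
    have h2 := Complex.imCLM.hasFDerivAt.comp_hasDerivAt t h1
    refine h2.congr_deriv ?_
    rw [Complex.imCLM_apply, ← Complex.sub_im]
    congr 1
    have := hx0 t
    have := hy0 t
    simp only [Pi.div_apply]
    field_simp

variable {z z' : ℝ → ℂ}

theorem Counterclockwise.cross_secant_nonneg (h : Counterclockwise z) {w u u' : ℝ}
    (h1 : u < u') (h2 : u' < u + w) (h3 : u' + w < u + 1) :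
    0 ≤ cross (z (u + w) - z u) (z (u' + w) - z u') := by
  have e1 := h u (u + w) (u' + w) (by linarith) (by linarith) h3
  have e2 := h u u' (u + w) h1 h2 (by linarith)
  have : cross (z (u + w) - z u) (z (u' + w) - z u') =
      cross (z (u + w) - z u) (z (u' + w) - z u) + cross (z u' - z u) (z (u + w) - z u) := by
    simp only [cross, Complex.sub_re, Complex.sub_im]
    ring
  rw [this]
  exact add_nonneg e1 e2

theorem cross_deriv_nonneg {X : ℝ → ℂ} {v : ℂ} {t ε : ℝ} (hε : 0 < ε) (hX : HasDerivAt X v t)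
    (h : ∀ s, t < s → s < t + ε → 0 ≤ cross (X t) (X s)) : 0 ≤ cross (X t) v := by
  have h1 := (hX.hasDerivWithinAt (s := Ioi t))
  rw [hasDerivWithinAt_iff_tendsto_slope' (by simp)] at h1
  have hc : Continuous fun y => cross (X t) y := by
    unfold cross
    fun_prop
  refine ge_of_tendsto ((hc.tendsto v).comp h1) ?_
  filter_upwards [Ioo_mem_nhdsGT (show t < t + ε by linarith)] with s hs
  have h2 : cross (X t) (slope X t s) = (s - t)⁻¹ * cross (X t) (X s) := by
    simp only [slope_def_module, cross, Complex.sub_re, Complex.sub_im, Complex.smul_re,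
      Complex.smul_im, smul_eq_mul]
    ring
  simp only [Function.comp_apply]
  rw [h2]
  exact mul_nonneg (inv_nonneg.2 (sub_nonneg.2 hs.1.le)) (h s hs.1 hs.2)

theorem InjectiveModOne.secant_ne_zero {E : Type*} [AddGroup E] {γ : ℝ → E}
    (h : InjectiveModOne γ) {w : ℝ} (hw : w ∈ Ioo (0 : ℝ) 1) (u : ℝ) : γ (u + w) - γ u ≠ 0 :=
  sub_ne_zero.2 fun heq => by
    have := h.eq_of_abs_lt (by rw [add_sub_cancel_left, abs_of_pos hw.1]; exact hw.2) heq
    linarith [hw.1]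

theorem IsPrimitive.secant {E : Type*} [NormedAddCommGroup E] [NormedSpace ℝ E] {γ γ' : ℝ → E}
    (h : IsPrimitive γ γ') (w : ℝ) :
    IsPrimitive (fun u => γ (u + w) - γ u) (fun u => γ' (u + w) - γ' u) :=
  (h.comp_add w).sub h

theorem Counterclockwise.integral_half_secant (h : Counterclockwise z) (hz : IsPrimitive z z')
    (hp : Function.Periodic z 1) (hinj : InjectiveModOne z) (a : ℝ) :
    ∫ u in a..(a + 1 / 2), ((z' (u + 1 / 2) - z' u) / (z (u + 1 / 2) - z u)).im = π := by
  have hw : (1 / 2 : ℝ) ∈ Ioo (0 : ℝ) 1 := by constructor <;> norm_num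
  have h0 := hinj.secant_ne_zero hw
  have hb : z (a + 1 / 2 + 1 / 2) = z a := by
    rw [add_assoc, add_halves, hp]
  have key := integral_div_im_sub (IsPrimitive.const (z (a + 1 / 2) - z a)) (hz.secant (1 / 2))
    (fun _ => h0 a) h0 (show a ≤ a + 1 / 2 by linarith) (fun t ht => by
      rcases ht.1.eq_or_lt with rfl | h1
      · rw [cross_self]
      rcases ht.2.eq_or_lt with rfl | h2
      · rw [hb, ← neg_sub, cross, Complex.neg_re, Complex.neg_im]
        apply le_of_eq
        ring
      · exact h.cross_secant_nonneg h1 h2 (by linarith))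
  simp only [zero_div, Complex.zero_im, intervalIntegral.integral_zero, sub_zero] at key
  rw [key, hb, div_self (h0 a), ← neg_sub (z (a + 1 / 2)), neg_div, div_self (h0 a), mul_neg,
    mul_one, neg_neg, Complex.arg_I, Complex.arg_neg_I]
  ring

theorem Counterclockwise.integral_secant (h : Counterclockwise z) (hz : IsPrimitive z z')
    (hp : Function.Periodic z 1) (hinj : InjectiveModOne z) {w : ℝ}
    (hw : w ∈ Ioo (0 : ℝ) 1) :
    ∫ u in (0 : ℝ)..1, ((z' (u + w) - z' u) / (z (u + w) - z u)).im = 2 * π := by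
  have hh : (1 / 2 : ℝ) ∈ Ioo (0 : ℝ) 1 := by constructor <;> norm_num
  have hhalf : ∫ u in (0 : ℝ)..1, ((z' (u + 1 / 2) - z' u) / (z (u + 1 / 2) - z u)).im =
      2 * π := by
    have hi := intervalIntegrable_div_im (hz.secant (1 / 2)) (hinj.secant_ne_zero hh)
    rw [← intervalIntegral.integral_add_adjacent_intervals (hi 0 (1 / 2)) (hi (1 / 2) 1)]
    have e1 := h.integral_half_secant hz hp hinj 0
    have e2 := h.integral_half_secant hz hp hinj (1 / 2)
    rw [zero_add] at e1
    rw [add_halves] at e2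
    rw [e1, e2]
    ring
  have hend : ∀ w, z (1 + w) - z 1 = z (0 + w) - z 0 := fun w => by
    have h1 := hp 0
    have h2 := hp w
    rw [zero_add] at h1 ⊢
    rw [add_comm, h1, h2]
  rcases lt_trichotomy w (1 / 2) with hlt | rfl | hlt
  · have key := integral_div_im_sub (hz.secant w) (hz.secant (1 / 2)) (hinj.secant_ne_zero hw)
      (hinj.secant_ne_zero hh) zero_le_one fun t _ =>
        h t (t + w) (t + 1 / 2) (by linarith [hw.1]) (by linarith) (by linarith)
    simp only [hend, sub_self] at key
    linarith
  · exact hhalf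
  · have key := integral_div_im_sub (hz.secant (1 / 2)) (hz.secant w) (hinj.secant_ne_zero hh)
      (hinj.secant_ne_zero hw) zero_le_one fun t _ =>
        h t (t + 1 / 2) (t + w) (by linarith) (by linarith) (by linarith [hw.2])
    simp only [hend, sub_self] at key
    linarith

/-- The secant directions of an oriented closed planar curve run once around the circle. -/
theorem Counterclockwise.integral_turnRate_secant (h : Counterclockwise z)
    (hz : IsPrimitive z z') (hp : Function.Periodic z 1) (hinj : InjectiveModOne z) {w : ℝ}
    (hw : w ∈ Ioo (0 : ℝ) 1) :
    ∫ u in (0 : ℝ)..1, turnRate (fun u => z (u + w) - z u) (fun u => z' (u + w) - z' u) u =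
      2 * π := by
  rw [← h.integral_secant hz hp hinj hw]
  refine intervalIntegral.integral_congr_ae ?_
  filter_upwards [(hz.secant w).ae_hasDerivAt] with u hu _
  refine turnRate_eq_div_im (X := fun u => z (u + w) - z u)
    (X' := fun u => z' (u + w) - z' u) (hinj.secant_ne_zero hw u)
    (cross_deriv_nonneg (X := fun u => z (u + w) - z u) (lt_min hw.1 (sub_pos.2 hw.2)) hu fun s hs1 hs2 => ?_)
  have h1 := min_le_left w (1 - w)
  have h2 := min_le_right w (1 - w)
  exact h.cross_secant_nonneg hs1 (by linarith) (by linarith)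

end Turning

/-- In a finite-dimensional space the convex hull of a compact set is compact. -/
theorem isCompact_convexHull {E : Type*} [NormedAddCommGroup E] [NormedSpace ℝ E]
    [FiniteDimensional ℝ E] {s : Set E} (hs : IsCompact s) : IsCompact (convexHull ℝ s) := by
  have key : convexHull ℝ s = ⋃ k ∈ Finset.range (Module.finrank ℝ E + 2),
      (fun q : (Fin k → ℝ) × (Fin k → E) => ∑ i, q.1 i • q.2 i) ''
        (stdSimplex ℝ (Fin k) ×ˢ Set.univ.pi fun _ => s) := by
    refine Subset.antisymm (fun x hx => ?_) ?_
    · obtain ⟨ι, _, p, w, hp, hind, hw, hsum, rfl⟩ := eq_pos_convex_span_of_mem_convexHull hx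
      have hcard := hind.card_le_finrank_succ
      have hle : Module.finrank ℝ (vectorSpan ℝ (Set.range p)) ≤ Module.finrank ℝ E :=
        Submodule.finrank_le _
      let e := Fintype.equivFin ι
      refine mem_biUnion (x := Fintype.card ι) (by simp; omega)
        ⟨(w ∘ e.symm, p ∘ e.symm), ⟨⟨fun i => (hw _).le, ?_⟩, fun i _ => hp ⟨_, rfl⟩⟩, ?_⟩
      · simpa using (e.symm.sum_comp w).trans hsum
      · simpa using e.symm.sum_comp fun i => w i • p i
    · refine iUnion₂_subset fun k _ => ?_
      rintro _ ⟨⟨w, p⟩, ⟨hw, hp⟩, rfl⟩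
      exact (convex_convexHull ℝ s).sum_mem (fun i _ => hw.1 i) hw.2
        fun i _ => subset_convexHull ℝ s (hp i (mem_univ i))
  rw [key]
  refine (Finset.range _).isCompact_biUnion fun k _ => ?_
  refine ((isCompact_stdSimplex ℝ (Fin k)).prod (isCompact_univ_pi fun _ => hs)).image ?_
  fun_prop

/-- In the plane every linear form is the cross product with a fixed vector. -/
theorem exists_eq_cross (l : ℂ →L[ℝ] ℝ) : ∃ e : ℂ, ∀ x, l x = cross e x := by
  refine ⟨⟨l Complex.I, -l 1⟩, fun x => ?_⟩
  have hx : x = x.re • (1 : ℂ) + x.im • Complex.I := by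
    apply Complex.ext <;> simp
  conv_lhs => rw [hx, map_add, map_smul, map_smul]
  simp only [cross, smul_eq_mul]
  ring

/-- The cross product with a fixed vector, as a continuous linear form. -/
def crossCLM (e : ℂ) : ℂ →L[ℝ] ℝ := e.re • Complex.imCLM - e.im • Complex.reCLM

@[simp]
theorem crossCLM_apply (e x : ℂ) : crossCLM e x = cross e x := by
  simp [crossCLM, cross]

theorem eq_zero_of_crossCLM_eq_zero {e : ℂ} (h : crossCLM e = 0) : e = 0 := by
  have h1 : cross e 1 = 0 := by rw [← crossCLM_apply, h]; rfl
  have h2 : cross e Complex.I = 0 := by rw [← crossCLM_apply, h]; rfl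
  apply Complex.ext <;> simp_all [cross]

/-- A counterclockwise curve has a supporting line at each of its points. -/
theorem Counterclockwise.exists_support {z : ℝ → ℂ} (h : Counterclockwise z)
    (hp : Function.Periodic z 1) (hinj : InjectiveModOne z) (u : ℝ) :
    ∃ e : ℂ, e ≠ 0 ∧ ∀ t, 0 ≤ cross e (z t - z u) := by
  let w : ℕ → ℝ := fun n => 1 / ((n : ℝ) + 2)
  have hw0 : ∀ n, 0 < w n := fun n => by positivity
  have hw1 : ∀ n, w n < 1 := fun n => by
    rw [div_lt_one (by positivity)]
    linarith [(Nat.cast_nonneg n : (0 : ℝ) ≤ n)]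
  have hwlim : Filter.Tendsto w Filter.atTop (nhds 0) := by
    have := (tendsto_one_div_add_atTop_nhds_zero_nat (𝕜 := ℝ)).comp (Filter.tendsto_add_atTop_nat 1)
    refine this.congr fun n => ?_
    simp [w, add_assoc]
    norm_num
  have hne : ∀ n, z (u + w n) - z u ≠ 0 := fun n =>
    hinj.secant_ne_zero ⟨hw0 n, hw1 n⟩ u
  have hmem : ∀ n, unitDir (fun t => z t - z u) (u + w n) ∈ Metric.sphere (0 : ℂ) 1 := fun n => by
    simp only [unitDir, mem_sphere_zero_iff_norm, norm_smul, norm_inv, norm_norm]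
    exact inv_mul_cancel₀ (norm_ne_zero_iff.2 (hne n))
  obtain ⟨e, he, φ, hφ, hlim⟩ := (isCompact_sphere (0 : ℂ) 1).tendsto_subseq hmem
  have key : ∀ t, u < t → t < u + 1 → 0 ≤ cross e (z t - z u) := by
    intro t h1 h2
    have hl : Filter.Tendsto (fun n => cross (unitDir (fun t => z t - z u) (u + w (φ n)))
        (z t - z u)) Filter.atTop (nhds (cross e (z t - z u))) := by
      have hcont : Continuous fun x => cross x (z t - z u) := by
        unfold cross; fun_prop
      exact (hcont.tendsto e).comp hlim
    refine ge_of_tendsto (x := Filter.atTop) hl ?_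
    have hsmall := (hwlim.comp hφ.tendsto_atTop).eventually_lt_const (sub_pos.2 h1)
    filter_upwards [hsmall] with n hn
    have hn' : w (φ n) < t - u := hn
    have := h u (u + w (φ n)) t (by linarith [hw0 (φ n)]) (by linarith) h2
    have e1 : cross (unitDir (fun t => z t - z u) (u + w (φ n))) (z t - z u) =
        ‖z (u + w (φ n)) - z u‖⁻¹ * cross (z (u + w (φ n)) - z u) (z t - z u) := by
      simp only [cross, unitDir, Complex.smul_re, Complex.smul_im, smul_eq_mul]
      ring
    rw [e1]
    positivity
  refine ⟨e, fun h0 => by simp [h0] at he, fun t => ?_⟩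
  obtain ⟨s, hs, hst⟩ := hp.exists_mem_Ico one_pos t u
  rw [hst]
  rcases hs.1.eq_or_lt with h1 | h1
  · simp [← h1, cross]
  · exact key s h1 hs.2

/-- The face of a convex hull cut out by a supporting hyperplane is the convex hull of the
generators lying on that hyperplane. -/
theorem mem_convexHull_inter_of_le {E : Type*} [AddCommGroup E] [Module ℝ E] {s : Set E}
    (l : E →ₗ[ℝ] ℝ) {p : E} (hp : p ∈ convexHull ℝ s) (hl : ∀ x ∈ s, l x ≤ l p) :
    p ∈ convexHull ℝ (s ∩ {x | l x = l p}) := by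
  have hface : ∀ x ∈ convexHull ℝ (s ∩ {x | l x = l p}), l x = l p := by
    have hconv : Convex ℝ {x | l x = l p} := convex_hyperplane l.isLinear _
    exact fun x hx => convexHull_min inter_subset_right hconv hx
  have hconv : Convex ℝ ({x | l x < l p} ∪ convexHull ℝ (s ∩ {x | l x = l p})) := by
    rw [convex_iff_forall_pos]
    rintro x hx y hy a b ha hb hab
    have hle : ∀ x ∈ ({x | l x < l p} ∪ convexHull ℝ (s ∩ {x | l x = l p})), l x ≤ l p := by
      rintro x (hx | hx)
      · exact le_of_lt hx
      · exact (hface x hx).le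
    have hlp : a * l p + b * l p = l p := by rw [← add_mul, hab, one_mul]
    rcases hx with hx | hx
    · left
      have h1 : l x < l p := hx
      have h2 := hle y hy
      simp only [mem_ofPred_eq, map_add, map_smul, smul_eq_mul]
      nlinarith [mul_pos ha (sub_pos.2 h1), mul_nonneg hb.le (sub_nonneg.2 h2)]
    · rcases hy with hy | hy
      · left
        have h1 : l y < l p := hy
        have h2 := (hface x hx).le
        simp only [mem_ofPred_eq, map_add, map_smul, smul_eq_mul]
        nlinarith [mul_pos hb (sub_pos.2 h1), mul_nonneg ha.le (sub_nonneg.2 h2)]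
      · exact Or.inr ((convex_convexHull ℝ _) hx hy ha.le hb.le hab)
  have hs : s ⊆ {x | l x < l p} ∪ convexHull ℝ (s ∩ {x | l x = l p}) := fun x hx =>
    (hl x hx).lt_or_eq.imp id fun h => subset_convexHull ℝ _ ⟨hx, h⟩
  exact (convexHull_min hs hconv hp).resolve_left (lt_irrefl (l p))

/-- The scalar product of two vectors of the plane. -/
def dot (x y : ℂ) : ℝ := x.re * y.re + x.im * y.im

/-- The scalar product with a fixed vector, as a continuous linear form. -/
def dotCLM (e : ℂ) : ℂ →L[ℝ] ℝ := e.re • Complex.reCLM + e.im • Complex.imCLM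

@[simp]
theorem dotCLM_apply (e x : ℂ) : dotCLM e x = dot e x := by
  simp [dotCLM, dot]

theorem dot_self_pos {e : ℂ} (he : e ≠ 0) : 0 < dot e e := by
  have := Complex.normSq_pos.2 he
  rwa [Complex.normSq_apply] at this

theorem eq_of_cross_eq_of_dot_eq {e x y : ℂ} (he : e ≠ 0) (h1 : cross e x = cross e y)
    (h2 : dot e x = dot e y) : x = y := by
  have hpos := dot_self_pos he
  unfold cross at h1
  unfold dot at h2 hpos
  have hre : (e.re * e.re + e.im * e.im) * (x.re - y.re) = 0 := by
    linear_combination e.re * h2 - e.im * h1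
  have him : (e.re * e.re + e.im * e.im) * (x.im - y.im) = 0 := by
    linear_combination e.im * h2 + e.re * h1
  exact Complex.ext (sub_eq_zero.1 ((mul_eq_zero.1 hre).resolve_left hpos.ne'))
    (sub_eq_zero.1 ((mul_eq_zero.1 him).resolve_left hpos.ne'))

/-- A point of the convex hull lying on a supporting line of a counterclockwise curve lies on the
curve. -/
theorem Counterclockwise.mem_range_of_support {z : ℝ → ℂ} (h : Counterclockwise z)
    (hc : Continuous z) (hp : Function.Periodic z 1) {p e : ℂ} (he : e ≠ 0)
    (hmem : p ∈ convexHull ℝ (Set.range z)) (hle : ∀ t, cross e (z t) ≤ cross e p) :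
    p ∈ Set.range z := by
  have hface := mem_convexHull_inter_of_le (crossCLM e).toLinearMap hmem (by
    rintro _ ⟨t, rfl⟩
    simpa using hle t)
  simp only [ContinuousLinearMap.coe_coe, crossCLM_apply] at hface
  obtain ⟨s, hs, hsm⟩ : ∃ s, cross e (z s) = cross e p ∧ dot e (z s) ≤ dot e p := by
    by_contra! hcon
    have hsub := convexHull_min (t := {x | dot e p < dotCLM e x}) (by
      rintro _ ⟨⟨t, rfl⟩, ht⟩
      simpa using hcon t ht) (convex_halfSpace_gt (dotCLM e).isLinear _) hface
    simp at hsub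
  obtain ⟨t₀, ht₀, htm₀⟩ : ∃ t, cross e (z t) = cross e p ∧ dot e p ≤ dot e (z t) := by
    by_contra! hcon
    have hsub := convexHull_min (t := {x | dotCLM e x < dot e p}) (by
      rintro _ ⟨⟨t, rfl⟩, ht⟩
      simpa using hcon t ht) (convex_halfSpace_lt (dotCLM e).isLinear _) hface
    simp at hsub
  obtain ⟨t, hst, hzt⟩ := hp.exists_mem_Ico one_pos t₀ s
  rw [hzt] at ht₀ htm₀
  rcases hst.1.eq_or_lt with rfl | hlt
  · exact ⟨s, eq_of_cross_eq_of_dot_eq he hs (le_antisymm hsm htm₀)⟩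
  rcases (hsm.trans htm₀).eq_or_lt with hd | hd
  · exact ⟨s, eq_of_cross_eq_of_dot_eq he hs (le_antisymm hsm (htm₀.trans hd.ge))⟩
  have harc : ∀ τ ∈ Icc t (s + 1), cross e (z τ) = cross e p := by
    rintro τ ⟨h1, h2⟩
    rcases h1.eq_or_lt with rfl | h1
    · exact ht₀
    rcases h2.eq_or_lt with rfl | h2
    · rwa [hp s]
    refine le_antisymm (hle τ) ?_
    have hcr := h s t τ hlt h1 h2
    have hpos := dot_self_pos he
    have hid : dot e e * cross (z t - z s) (z τ - z s) =
        (dot e (z t) - dot e (z s)) * (cross e (z τ) - cross e (z s)) -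
        (cross e (z t) - cross e (z s)) * (dot e (z τ) - dot e (z s)) := by
      simp only [cross, dot, Complex.sub_re, Complex.sub_im]
      ring
    rw [ht₀, hs, sub_self, zero_mul, sub_zero] at hid
    have hnn : 0 ≤ (dot e (z t) - dot e (z s)) * (cross e (z τ) - cross e p) :=
      hid ▸ mul_nonneg hpos.le hcr
    exact sub_nonneg.1 (nonneg_of_mul_nonneg_right hnn (sub_pos.2 hd))
  have hcont : ContinuousOn (fun τ => dot e (z τ)) (Icc t (s + 1)) := by
    unfold dot; fun_prop
  obtain ⟨τ, hτ, hτp⟩ := intermediate_value_Icc' hst.2.le hcont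
    (show dot e p ∈ Icc (dot e (z (s + 1))) (dot e (z t)) from ⟨by rwa [hp s], htm₀⟩)
  exact ⟨τ, eq_of_cross_eq_of_dot_eq he (harc τ hτ) hτp⟩

/-- A counterclockwise closed curve bounds the convex hull of its image. -/
theorem Counterclockwise.range_eq_frontier {z : ℝ → ℂ} (h : Counterclockwise z)
    (hc : Continuous z) (hp : Function.Periodic z 1) (hinj : InjectiveModOne z)
    (hspan : affineSpan ℝ (Set.range z) = ⊤) :
    Set.range z = frontier (convexHull ℝ (Set.range z)) := by
  have hcomp : IsCompact (convexHull ℝ (Set.range z)) :=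
    isCompact_convexHull (hp.compact_of_continuous one_ne_zero hc)
  rw [hcomp.isClosed.frontier_eq]
  refine Subset.antisymm ?_ ?_
  · rintro _ ⟨u, rfl⟩
    refine ⟨subset_convexHull ℝ _ ⟨u, rfl⟩, fun hint => ?_⟩
    obtain ⟨e, he, hsupp⟩ := h.exists_support hp hinj u
    have hhull : convexHull ℝ (Set.range z) ⊆ {x | cross e (z u) ≤ crossCLM e x} := by
      refine convexHull_min ?_ (convex_halfSpace_ge (crossCLM e).isLinear _)
      rintro _ ⟨t, rfl⟩
      have := hsupp t
      simp only [mem_ofPred_eq, crossCLM_apply]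
      simp only [cross, Complex.sub_re, Complex.sub_im] at this ⊢
      linarith
    have hmin : IsLocalMin (crossCLM e) (z u) :=
      Filter.eventually_of_mem (mem_interior_iff_mem_nhds.1 hint) fun x hx => by
        simpa using hhull hx
    exact he (eq_zero_of_crossCLM_eq_zero (by simpa using hmin.fderiv_eq_zero))
  · rintro p ⟨hpm, hpi⟩
    have hne : (interior (convexHull ℝ (Set.range z))).Nonempty :=
      interior_convexHull_nonempty_iff_affineSpan_eq_top.2 hspan
    obtain ⟨f, hf, hfle⟩ := geometric_hahn_banach_of_nonempty_interior_point
      (convex_convexHull ℝ _) hpi hne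
    obtain ⟨e, he⟩ := exists_eq_cross f
    refine h.mem_range_of_support hc hp (e := e) ?_ hpm fun t => ?_
    · rintro rfl
      exact hf (ContinuousLinearMap.ext fun x => by simp [he, cross])
    · rw [← he, ← he]
      exact hfle _ (subset_convexHull ℝ _ ⟨t, rfl⟩)

/-- If a line separates two points of a set that has a supporting line at its point `y`, then `y`
does not lie strictly between two points of the set on the line. -/
theorem not_dot_lt_of_support {S : Set ℂ} {e e' : ℂ} (he : e ≠ 0) (he' : e' ≠ 0) {x y w p q : ℂ}
    (hsupp : ∀ v ∈ S, cross e' v ≤ cross e' y) (hx : x ∈ S) (hw : w ∈ S) (hp : p ∈ S)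
    (hq : q ∈ S) (hxy : cross e x = cross e y) (hwy : cross e w = cross e y)
    (hpy : cross e p < cross e y) (hqy : cross e y < cross e q) (h1 : dot e x < dot e y) :
    dot e w ≤ dot e y := by
  by_contra! h2
  have hid : ∀ v, dot e e * (cross e' v - cross e' y) =
      (dot e v - dot e y) * cross e' e + (cross e v - cross e y) * dot e e' := by
    intro v
    simp only [cross, dot]
    ring
  have hpos := dot_self_pos he
  have hle : ∀ v ∈ S,
      (dot e v - dot e y) * cross e' e + (cross e v - cross e y) * dot e e' ≤ 0 := fun v hv => by
    rw [← hid]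
    exact mul_nonpos_of_nonneg_of_nonpos hpos.le (sub_nonpos.2 (hsupp v hv))
  have hx' := hle x hx
  have hw' := hle w hw
  rw [hxy, sub_self, zero_mul, add_zero] at hx'
  rw [hwy, sub_self, zero_mul, add_zero] at hw'
  have h0 : cross e' e = 0 := le_antisymm
    (nonpos_of_mul_nonpos_right hw' (sub_pos.2 h2))
    (nonneg_of_mul_nonpos_right hx' (sub_neg.2 h1))
  have hp' := hle p hp
  have hq' := hle q hq
  rw [h0, mul_zero, zero_add] at hp' hq'
  have hd : dot e e' = 0 := le_antisymm
    (nonpos_of_mul_nonpos_right hq' (sub_pos.2 hqy))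
    (nonneg_of_mul_nonpos_right hp' (sub_neg.2 hpy))
  refine he' (eq_of_cross_eq_of_dot_eq he ?_ ?_)
  · rw [cross_swap, h0]
    simp [cross]
  · rw [hd]
    simp [dot]

/-- A closed injective curve with a supporting line at each of its points meets every line
transversally at most twice. -/
theorem twoCrossing_of_support {z : ℝ → ℂ} (hc : Continuous z) (hinj : InjectiveModOne z)
    (h : ∀ u, ∃ e : ℂ, e ≠ 0 ∧ ∀ t, cross e (z t) ≤ cross e (z u)) : TwoCrossing z := by
  intro l κ a b c d hab hbc hcd hda ha hb hcκ
  by_contra! hd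
  obtain ⟨e, hl⟩ := exists_eq_cross l
  rw [hl] at ha hb hcκ hd
  have he : e ≠ 0 := by
    rintro rfl
    simp only [cross, Complex.zero_re, Complex.zero_im, zero_mul, sub_zero] at ha hb
    linarith
  have hcont : Continuous fun t => cross e (z t) := by
    unfold cross; fun_prop
  obtain ⟨t₁, ⟨h1a, h1b⟩, h1⟩ := intermediate_value_Ioo hab.le hcont.continuousOn ⟨ha, hb⟩
  obtain ⟨t₂, ⟨h2a, h2b⟩, h2⟩ := intermediate_value_Ioo' hbc.le hcont.continuousOn ⟨hcκ, hb⟩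
  obtain ⟨t₃, ⟨h3a, h3b⟩, h3⟩ := intermediate_value_Ioo hcd.le hcont.continuousOn ⟨hcκ, hd⟩
  simp only at h1 h2 h3
  have hne : ∀ s t, s < t → t < s + 1 → cross e (z s) = κ → cross e (z t) = κ →
      dot e (z s) ≠ dot e (z t) := fun s t hst hts hs ht heq => by
    have := hinj.eq_of_abs_lt (s := s) (t := t) (abs_lt.2 ⟨by linarith, by linarith⟩)
      (eq_of_cross_eq_of_dot_eq he (hs.trans ht.symm) heq)
    exact hst.ne this
  have hbetween : ∀ r s t, cross e (z r) = κ → cross e (z s) = κ → cross e (z t) = κ →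
      dot e (z r) < dot e (z s) → dot e (z t) ≤ dot e (z s) := by
    intro r s t hr hs ht hlt
    obtain ⟨e', he', hsupp⟩ := h s
    exact not_dot_lt_of_support he he' (S := Set.range z) (y := z s)
      (by rintro _ ⟨t, rfl⟩; exact hsupp t) ⟨r, rfl⟩ ⟨t, rfl⟩ ⟨a, rfl⟩ ⟨b, rfl⟩
      (hr.trans hs.symm) (ht.trans hs.symm) (by rwa [hs]) (by rwa [hs]) hlt
  have n12 := hne t₁ t₂ (by linarith) (by linarith) h1 h2
  have n13 := hne t₁ t₃ (by linarith) (by linarith) h1 h3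
  have n23 := hne t₂ t₃ (by linarith) (by linarith) h2 h3
  have b123 := hbetween t₁ t₂ t₃ h1 h2 h3
  have b321 := hbetween t₃ t₂ t₁ h3 h2 h1
  have b213 := hbetween t₂ t₁ t₃ h2 h1 h3
  have b312 := hbetween t₃ t₁ t₂ h3 h1 h2
  have b132 := hbetween t₁ t₃ t₂ h1 h3 h2
  have b231 := hbetween t₂ t₃ t₁ h2 h3 h1
  rcases n12.lt_or_gt with h12 | h12 <;> rcases n13.lt_or_gt with h13 | h13 <;>
    rcases n23.lt_or_gt with h23 | h23 <;> grind

/-- A closed injective curve parametrizing the boundary of a convex body in the plane meets every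
line transversally at most twice. -/
theorem twoCrossing_of_range_eq_frontier {z : ℝ → ℂ} (hc : Continuous z)
    (hinj : InjectiveModOne z) {K : Set ℂ} (hK : Convex ℝ K) (hspan : affineSpan ℝ K = ⊤)
    (hz : Set.range z = frontier K) : TwoCrossing z := by
  refine twoCrossing_of_support hc hinj fun u => ?_
  have hu : z u ∈ frontier K := hz ▸ mem_range_self u
  obtain ⟨f, hf, hfle⟩ := geometric_hahn_banach_of_nonempty_interior_point hK hu.2
    (hK.interior_nonempty_iff_affineSpan_eq_top.2 hspan)
  obtain ⟨e, he⟩ := exists_eq_cross f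
  refine ⟨e, ?_, fun t => ?_⟩
  · rintro rfl
    exact hf (ContinuousLinearMap.ext fun x => by simp [he, cross])
  · rw [← he, ← he]
    have ht : z t ∈ closure K := frontier_subset_closure (hz ▸ mem_range_self t)
    exact closure_minimal (t := {x | f x ≤ f (z u)}) (fun x hx => hfle x hx)
      (isClosed_le f.continuous continuous_const) ht

/-- For a set spanning the whole space the intrinsic frontier is the frontier. -/
theorem intrinsicFrontier_eq_frontier {E : Type*} [NormedAddCommGroup E] [NormedSpace ℝ E]
    [FiniteDimensional ℝ E] {s : Set E} (hs : affineSpan ℝ s = ⊤) :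
    intrinsicFrontier ℝ s = frontier s := by
  refine intrinsicFrontier_subset_frontier.antisymm ?_
  rw [← closure_sdiff_intrinsicInterior (𝕜 := ℝ) s]
  refine sdiff_subset_sdiff_right ?_
  have hopen : IsOpen (affineSpan ℝ s : Set E) := by
    rw [hs]
    exact isOpen_univ
  refine interior_maximal intrinsicInterior_subset ?_
  exact hopen.isOpenMap_subtype_val _ isOpen_interior

section Planar

variable {E : Type*} [NormedAddCommGroup E] [InnerProductSpace ℝ E]

/-- The affine isometric embedding `x ↦ p + ι x` of the plane. -/
def planeEmbedding (p : E) (ι : ℂ →ₗᵢ[ℝ] E) : ℂ →ᵃⁱ[ℝ] E :=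
  (AffineIsometryEquiv.constVAdd ℝ E p).toAffineIsometry.comp ι.toAffineIsometry

@[simp]
theorem planeEmbedding_apply (p : E) (ι : ℂ →ₗᵢ[ℝ] E) (x : ℂ) :
    planeEmbedding p ι x = p + ι x := rfl

theorem turnRate_map (ι : ℂ →ₗᵢ[ℝ] E) (X X' : ℝ → ℂ) (t : ℝ) :
    turnRate (fun t => ι (X t)) (fun t => ι (X' t)) t = turnRate X X' t := by
  have h1 : unitDir (fun t => ι (X t)) t = ι (unitDir X t) := by
    simp only [unitDir, map_smul, LinearIsometry.norm_map]
  have h2 : projPerp (ι (unitDir X t)) (ι (X' t)) = ι (projPerp (unitDir X t) (X' t)) := by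
    simp only [projPerp, map_sub, map_smul, LinearIsometry.norm_map, LinearIsometry.inner_map_map]
  simp only [turnRate, h1, h2, LinearIsometry.norm_map]

variable {γ γ' : ℝ → E} {p : E} {ι : ℂ →ₗᵢ[ℝ] E} {z : ℝ → ℂ}

theorem InjectiveModOne.of_planar (h : InjectiveModOne γ) (hz : ∀ t, γ t = p + ι (z t)) :
    InjectiveModOne z := fun s t hst => h s t (by rw [hz, hz, hst])

/-- A planar curve meeting every line at most twice is counterclockwise in suitable isometric
coordinates. -/
theorem TwoCrossing.exists_counterclockwise (h : TwoCrossing z) (hinj : InjectiveModOne z)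
    (hp : Function.Periodic z 1) (hz : ∀ t, γ t = p + ι (z t)) :
    ∃ (κ : ℂ →ₗᵢ[ℝ] E) (y : ℝ → ℂ), (∀ t, γ t = p + κ (y t)) ∧ Counterclockwise y := by
  rcases h.counterclockwise_or hinj hp with hcc | hcc
  · exact ⟨ι, z, hz, hcc⟩
  · refine ⟨ι.comp Complex.conjLIE.toLinearIsometry, _, fun t => ?_, hcc⟩
    simp [hz]

theorem affineSpan_range_eq_top {z : ℝ → ℂ} (hinj : InjectiveModOne z) (hc : Continuous z)
    (hp : Function.Periodic z 1) : affineSpan ℝ (Set.range z) = ⊤ := by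
  obtain ⟨x, y, -, -, -, hI⟩ := hinj.exists_linearIndependent hc hp
  rw [AffineSubspace.affineSpan_eq_top_iff_vectorSpan_eq_top_of_nonempty ℝ ℂ ℂ
    (Set.range_nonempty z), eq_top_iff,
    ← hI.span_eq_top_of_card_eq_finrank' (by simp [Complex.finrank_real_complex]),
    Submodule.span_le]
  rintro _ ⟨i, rfl⟩
  fin_cases i
  · exact vsub_mem_vectorSpan ℝ (mem_range_self x) (mem_range_self 0)
  · exact vsub_mem_vectorSpan ℝ (mem_range_self y) (mem_range_self 0)

/-- A counterclockwise curve in a plane bounds a convex planar set. -/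
theorem Counterclockwise.exists_convex (h : Counterclockwise z) (hc : Continuous z)
    (hp : Function.Periodic z 1) (hinj : InjectiveModOne z) (hz : ∀ t, γ t = p + ι (z t)) :
    ∃ K : Set E, Convex ℝ K ∧ Module.finrank ℝ (affineSpan ℝ K).direction = 2 ∧
      Set.range γ = intrinsicFrontier ℝ K := by
  have hspan := affineSpan_range_eq_top hinj hc hp
  have hspan' : affineSpan ℝ (convexHull ℝ (Set.range z)) = ⊤ := by
    rw [affineSpan_convexHull, hspan]
  refine ⟨planeEmbedding p ι '' convexHull ℝ (Set.range z),
    (convex_convexHull ℝ _).affine_image (planeEmbedding p ι).toAffineMap, ?_, ?_⟩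
  · have : affineSpan ℝ (planeEmbedding p ι '' convexHull ℝ (Set.range z)) =
        (⊤ : AffineSubspace ℝ ℂ).map (planeEmbedding p ι).toAffineMap := by
      rw [← hspan', AffineSubspace.map_span]
      rfl
    rw [this, AffineSubspace.map_direction, AffineSubspace.direction_top, Submodule.map_top,
      LinearMap.finrank_range_of_inj, Complex.finrank_real_complex]
    exact ι.injective
  · rw [AffineIsometry.intrinsicFrontier_image, intrinsicFrontier_eq_frontier hspan',
      ← h.range_eq_frontier hc hp hinj hspan, ← Set.range_comp]
    exact congrArg Set.range (funext hz)

variable [FiniteDimensional ℝ E]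

theorem exists_linearIsometry_range_eq {V : Submodule ℝ E} (hV : Module.finrank ℝ V = 2) :
    ∃ ι : ℂ →ₗᵢ[ℝ] E, LinearMap.range ι.toLinearMap = V := by
  let e : ℂ ≃ₗᵢ[ℝ] V := Complex.orthonormalBasisOneI.equiv
    ((stdOrthonormalBasis ℝ V).reindex (finCongr hV)) (Equiv.refl _)
  refine ⟨V.subtypeₗᵢ.comp e.toLinearIsometry, ?_⟩
  ext v
  constructor
  · rintro ⟨x, rfl⟩
    exact (e x).2
  · intro hv
    exact ⟨e.symm ⟨v, hv⟩, by simp⟩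

theorem adjoint_apply_self (ι : ℂ →ₗᵢ[ℝ] E) (x : ℂ) :
    ContinuousLinearMap.adjoint ι.toContinuousLinearMap (ι x) = x := by
  refine ext_inner_right ℝ fun y => ?_
  rw [ContinuousLinearMap.adjoint_inner_left]
  exact ι.inner_map_map x y

theorem IsPrimitive.ae_eq {f f' f'' : ℝ → E} (h : IsPrimitive f f') (h2 : IsPrimitive f f'') :
    f' =ᵐ[volume] f'' := by
  filter_upwards [h.ae_hasDerivAt, h2.ae_hasDerivAt] with t h1 h2
  exact h1.unique h2

theorem eq_adjoint_sub_of_planar (hz : ∀ t, γ t = p + ι (z t)) (t : ℝ) :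
    z t = ContinuousLinearMap.adjoint ι.toContinuousLinearMap (γ t) -
      ContinuousLinearMap.adjoint ι.toContinuousLinearMap p := by
  rw [← map_sub, hz, add_sub_cancel_left, adjoint_apply_self]

theorem periodic_of_planar (h : Function.Periodic γ 1) (hz : ∀ t, γ t = p + ι (z t)) :
    Function.Periodic z 1 := fun t => by
  rw [eq_adjoint_sub_of_planar hz, eq_adjoint_sub_of_planar hz, h]

theorem IsPrimitive.of_planar (h : IsPrimitive γ γ') (hz : ∀ t, γ t = p + ι (z t)) :
    IsPrimitive z fun t => ContinuousLinearMap.adjoint ι.toContinuousLinearMap (γ' t) := by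
  have := (h.clm_comp (ContinuousLinearMap.adjoint ι.toContinuousLinearMap)).sub
    (IsPrimitive.const (ContinuousLinearMap.adjoint ι.toContinuousLinearMap p))
  simpa only [← eq_adjoint_sub_of_planar hz, sub_zero] using this

theorem TwoCrossing.of_planar (h : TwoCrossing γ) (hz : ∀ t, γ t = p + ι (z t)) :
    TwoCrossing z := by
  intro l κ a b c d hab hbc hcd hda ha hb hc
  set A := ContinuousLinearMap.adjoint ι.toContinuousLinearMap with hA
  have hl : ∀ t, l (z t) = l.comp A (γ t) - l (A p) := fun t => by
    rw [eq_adjoint_sub_of_planar hz, map_sub]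
    rfl
  rw [hl] at ha hb hc ⊢
  linarith [h (l.comp A) (κ + l (A p)) a b c d hab hbc hcd hda (by linarith) (by linarith)
    (by linarith)]

theorem integral_turnRate_secant_of_planar (h : IsPrimitive γ γ')
    (hz : ∀ t, γ t = p + ι (z t)) (w : ℝ) :
    ∫ u in (0 : ℝ)..1, turnRate (fun u => γ (u + w) - γ u) (fun u => γ' (u + w) - γ' u) u =
      ∫ u in (0 : ℝ)..1, turnRate (fun u => z (u + w) - z u)
        (fun u => ContinuousLinearMap.adjoint ι.toContinuousLinearMap (γ' (u + w)) -
          ContinuousLinearMap.adjoint ι.toContinuousLinearMap (γ' u)) u := by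
  have hzp := ((h.of_planar hz).secant w).clm_comp ι.toContinuousLinearMap
  have hsec : (fun u => γ (u + w) - γ u) = fun u => ι (z (u + w) - z u) := by
    funext u
    rw [hz, hz, map_sub]
    abel
  have hγ := h.secant w
  rw [hsec] at hγ ⊢
  refine intervalIntegral.integral_congr_ae ?_
  filter_upwards [hγ.ae_eq hzp] with u hu _
  rw [← turnRate_map ι]
  simp only [turnRate, hu]
  rfl

theorem TwoCrossing.exists_planar (h : TwoCrossing γ) (hinj : InjectiveModOne γ)
    (hc : Continuous γ) (hp : Function.Periodic γ 1) :
    ∃ (ι : ℂ →ₗᵢ[ℝ] E) (z : ℝ → ℂ), ∀ t, γ t = γ 0 + ι (z t) := by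
  obtain ⟨x, y, hx, hxy, hy, hI⟩ := hinj.exists_linearIndependent hc hp
  have hV : Module.finrank ℝ (Submodule.span ℝ (Set.range ![γ x - γ 0, γ y - γ 0])) = 2 := by
    simpa using finrank_span_eq_card hI
  obtain ⟨ι, hι⟩ := exists_linearIsometry_range_eq hV
  have hmem : ∀ t, ∃ v, ι v = γ t - γ 0 := fun t => by
    have := h.sub_mem_span hp hx hxy hy hI t
    rw [← Matrix.range_cons_cons_empty _ _ ![], ← hι] at this
    exact this
  choose z hz using hmem
  exact ⟨ι, z, fun t => by rw [hz]; abel⟩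

/-- A closed curve bounding a convex planar set is, in isometric coordinates, the boundary of a
convex set of the plane. -/
theorem exists_planar_of_range_eq_intrinsicFrontier {K : Set E} (hK : Convex ℝ K)
    (hdim : Module.finrank ℝ (affineSpan ℝ K).direction = 2)
    (hγ : Set.range γ = intrinsicFrontier ℝ K) :
    ∃ (p : E) (ι : ℂ →ₗᵢ[ℝ] E) (z : ℝ → ℂ) (L : Set ℂ), (∀ t, γ t = p + ι (z t)) ∧
      Convex ℝ L ∧ affineSpan ℝ L = ⊤ ∧ Set.range z = frontier L := by
  obtain ⟨ι, hι⟩ := exists_linearIsometry_range_eq hdim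
  have hne : K.Nonempty := by
    rw [← intrinsicClosure_nonempty (𝕜 := ℝ)]
    exact ⟨γ 0, intrinsicFrontier_subset_intrinsicClosure (hγ ▸ mem_range_self 0)⟩
  obtain ⟨p, hp⟩ := hne
  have himage : planeEmbedding p ι '' (planeEmbedding p ι ⁻¹' K) = K := by
    refine Set.image_preimage_eq_of_subset fun x hx => ?_
    have : x -ᵥ p ∈ (affineSpan ℝ K).direction :=
      AffineSubspace.vsub_mem_direction (subset_affineSpan ℝ K hx) (subset_affineSpan ℝ K hp)
    rw [← hι] at this
    obtain ⟨v, hv⟩ := this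
    refine ⟨v, ?_⟩
    have hv' : ι v = x - p := hv
    rw [planeEmbedding_apply, hv', add_sub_cancel]
  set L := planeEmbedding p ι ⁻¹' K with hL
  have hLne : L.Nonempty := ⟨0, by simpa [hL] using hp⟩
  have htop : affineSpan ℝ L = ⊤ := by
    rw [← AffineSubspace.direction_eq_top_iff_of_nonempty ((affineSpan_nonempty (k := ℝ)).2 hLne)]
    refine Submodule.eq_top_of_finrank_eq ?_
    have hmap : affineSpan ℝ K = (affineSpan ℝ L).map (planeEmbedding p ι).toAffineMap := by
      rw [AffineSubspace.map_span]
      exact congrArg (affineSpan ℝ) himage.symm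
    rw [hmap, AffineSubspace.map_direction] at hdim
    rw [Complex.finrank_real_complex, ← hdim]
    exact (Submodule.equivMapOfInjective _ ι.injective _).finrank_eq
  have hfront : intrinsicFrontier ℝ K = planeEmbedding p ι '' frontier L := by
    rw [← intrinsicFrontier_eq_frontier htop, ← AffineIsometry.intrinsicFrontier_image, himage]
  have hmem : ∀ t, ∃ v ∈ frontier L, planeEmbedding p ι v = γ t := fun t => by
    have ht : γ t ∈ intrinsicFrontier ℝ K := hγ ▸ mem_range_self t
    rwa [hfront] at ht
  choose z hz hzγ using hmem
  refine ⟨p, ι, z, L, fun t => (hzγ t).symm,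
    hK.affine_preimage (planeEmbedding p ι).toAffineMap, htop, ?_⟩
  refine Subset.antisymm (by rintro _ ⟨t, rfl⟩; exact hz t) fun v hv => ?_
  have hv' : planeEmbedding p ι v ∈ Set.range γ := by
    rw [hγ, hfront]
    exact mem_image_of_mem _ hv
  obtain ⟨t, ht⟩ := hv'
  exact ⟨t, (planeEmbedding p ι).injective ((hzγ t).trans ht)⟩

end Planar

section Secants

variable {E : Type*} [NormedAddCommGroup E] [InnerProductSpace ℝ E] {γ γ' : ℝ → E}

theorem integral_secant_eq_zero (hc : Continuous γ) (hp : Function.Periodic γ 1) (w : ℝ) :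
    ∫ u in (0 : ℝ)..1, (γ (u + w) - γ u) = 0 := by
  have hc' : Continuous fun u => γ (u + w) := by fun_prop
  rw [intervalIntegral.integral_sub (hc'.intervalIntegrable _ _) (hc.intervalIntegrable _ _),
    intervalIntegral.integral_comp_add_right, sub_eq_zero, zero_add, add_comm]
  simpa using hp.intervalIntegral_add_eq w 0

theorem periodic_secant {X : Type*} [AddGroup X] {γ : ℝ → X} (hp : Function.Periodic γ 1)
    (w : ℝ) : Function.Periodic (fun u => γ (u + w) - γ u) 1 := fun u => by
  simp only [add_right_comm u 1 w, hp _]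

variable [FiniteDimensional ℝ E]

theorem two_pi_le_integral_turnRate_secant (h : IsPrimitive γ γ') (hinj : InjectiveModOne γ)
    (hp : Function.Periodic γ 1) (hp' : Function.Periodic γ' 1) {w : ℝ} (hw : w ∈ Ioo (0 : ℝ) 1) :
    2 * π ≤ ∫ u in (0 : ℝ)..1,
      turnRate (fun u => γ (u + w) - γ u) (fun u => γ' (u + w) - γ' u) u :=
  two_pi_le_integral_turnRate (h.secant w) (hinj.secant_ne_zero hw) (periodic_secant hp w)
    (periodic_secant hp' w) (integral_secant_eq_zero h.continuous hp w)

theorem twoCrossing_of_integral_turnRate_secant (h : IsPrimitive γ γ') (hinj : InjectiveModOne γ)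
    (hp : Function.Periodic γ 1) (hp' : Function.Periodic γ' 1)
    (heq : ∀ w ∈ Ioo (0 : ℝ) 1, ∫ u in (0 : ℝ)..1,
      turnRate (fun u => γ (u + w) - γ u) (fun u => γ' (u + w) - γ' u) u = 2 * π) :
    TwoCrossing γ := by
  refine twoCrossing_of_secants h.continuous hp fun w h0 h1 l a b c d hab hbc hcd hda ha hb hc => ?_
  exact not_four_sign_changes (h.secant w) (hinj.secant_ne_zero ⟨h0, h1⟩) (periodic_secant hp w)
    (periodic_secant hp' w) (integral_secant_eq_zero h.continuous hp w) (heq w ⟨h0, h1⟩)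
    l.toLinearMap hab hbc hcd hda ha hb hc

/-- All secant images of a closed curve have length `2π` exactly when the curve bounds a convex
planar set. -/
theorem integral_turnRate_secant_eq_iff (h : IsPrimitive γ γ') (hinj : InjectiveModOne γ)
    (hp : Function.Periodic γ 1) (hp' : Function.Periodic γ' 1) :
    (∀ w ∈ Ioo (0 : ℝ) 1, ∫ u in (0 : ℝ)..1,
      turnRate (fun u => γ (u + w) - γ u) (fun u => γ' (u + w) - γ' u) u = 2 * π) ↔
    ∃ K : Set E, Convex ℝ K ∧ Module.finrank ℝ (affineSpan ℝ K).direction = 2 ∧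
      Set.range γ = intrinsicFrontier ℝ K := by
  constructor
  · intro heq
    have htc := twoCrossing_of_integral_turnRate_secant h hinj hp hp' heq
    obtain ⟨ι, z, hz⟩ := htc.exists_planar hinj h.continuous hp
    obtain ⟨κ, y, hy, hcc⟩ := (htc.of_planar hz).exists_counterclockwise (hinj.of_planar hz)
      (periodic_of_planar hp hz) hz
    exact hcc.exists_convex (h.of_planar hy).continuous (periodic_of_planar hp hy)
      (hinj.of_planar hy) hy
  · rintro ⟨K, hK, hdim, hγ⟩ w hw
    obtain ⟨p, ι, z, L, hz, hL, hspan, hfr⟩ :=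
      exists_planar_of_range_eq_intrinsicFrontier hK hdim hγ
    have htc := twoCrossing_of_range_eq_frontier (h.of_planar hz).continuous (hinj.of_planar hz)
      hL hspan hfr
    obtain ⟨κ, y, hy, hcc⟩ := htc.exists_counterclockwise (hinj.of_planar hz)
      (periodic_of_planar hp hz) hz
    rw [integral_turnRate_secant_of_planar h hy]
    exact hcc.integral_turnRate_secant (h.of_planar hy) (periodic_of_planar hp hy)
      (hinj.of_planar hy) hw

end Secants

theorem isPrimitive_closedCurve {n : ℕ} (γ : ClosedCurve n) :
    IsPrimitive γ.toFun γ.deriv' := by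
  have hint : ∀ a b, IntervalIntegrable γ.deriv' volume a b := by
    refine γ.deriv'_periodic.intervalIntegrable₀ one_ne_zero ?_
    rw [intervalIntegrable_iff_integrableOn_Icc_of_le zero_le_one]
    exact γ.integrableOn
  refine ⟨hint, fun a b => ?_⟩
  rw [γ.eq_integral b, γ.eq_integral a, add_sub_add_left_eq_sub,
    intervalIntegral.integral_interval_sub_left (hint _ _) (hint _ _)]

theorem lintegral_gaussDerivU {n : ℕ} (γ : ClosedCurve n) (hinj : γ.IsInj) {w : ℝ}
    (hw : w ∈ Ioo (0 : ℝ) 1) :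
    ∫⁻ u in Set.Ioc (0 : ℝ) 1, ENNReal.ofReal (gaussDerivU γ u w) =
      ENNReal.ofReal (∫ u in (0 : ℝ)..1, turnRate (fun u => γ.toFun (u + w) - γ.toFun u)
        (fun u => γ.deriv' (u + w) - γ.deriv' u) u) := by
  have hinj' : InjectiveModOne γ.toFun := hinj
  have hint := intervalIntegrable_turnRate ((isPrimitive_closedCurve γ).secant w)
    (hinj'.secant_ne_zero hw) 0 1
  rw [intervalIntegral.integral_of_le zero_le_one, ofReal_integral_eq_lintegral_ofReal hint.1
    (Filter.Eventually.of_forall fun u => turnRate_nonneg _ _ u)]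
  rfl

end GaussFenchel

/-- **Fenchel theorem for Gauss maps, part (i)** (Theorem 1.4 (i) / Lemma 3.7):
for every `w ∈ (0,1)` one has `∫₀¹ |∂_u φ_γ(u,w)| du ≥ 2π`, with equality for all `w`
iff `γ` is a (planar) convex curve. -/
theorem fenchel_gauss_map_u {n : ℕ} (γ : ClosedCurve n) (hinj : γ.IsInj)
    (hreg : γ.IsRegular) :
    (∀ w ∈ Set.Ioo (0:ℝ) 1,
      ENNReal.ofReal (2 * π) ≤
        ∫⁻ u in Set.Ioc (0:ℝ) 1, ENNReal.ofReal (gaussDerivU γ u w)) ∧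
    ((∀ w ∈ Set.Ioo (0:ℝ) 1,
        (∫⁻ u in Set.Ioc (0:ℝ) 1, ENNReal.ofReal (gaussDerivU γ u w)) =
          ENNReal.ofReal (2 * π)) ↔ γ.IsConvex) := by
  have hprim := GaussFenchel.isPrimitive_closedCurve γ
  have hinj' : GaussFenchel.InjectiveModOne γ.toFun := hinj
  have hle : ∀ w ∈ Set.Ioo (0:ℝ) 1, 2 * π ≤ ∫ u in (0:ℝ)..1,
      GaussFenchel.turnRate (fun u => γ.toFun (u + w) - γ.toFun u)
        (fun u => γ.deriv' (u + w) - γ.deriv' u) u := fun w hw =>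
    GaussFenchel.two_pi_le_integral_turnRate_secant hprim hinj' γ.periodic γ.deriv'_periodic hw
  refine ⟨fun w hw => ?_, ?_⟩
  · rw [GaussFenchel.lintegral_gaussDerivU γ hinj hw]
    exact ENNReal.ofReal_le_ofReal (hle w hw)
  · refine Iff.trans (forall₂_congr fun w hw => ?_)
      (GaussFenchel.integral_turnRate_secant_eq_iff hprim hinj' γ.periodic γ.deriv'_periodic)
    rw [GaussFenchel.lintegral_gaussDerivU γ hinj hw, ENNReal.ofReal_eq_ofReal_iff
      (two_pi_pos.le.trans (hle w hw)) two_pi_pos.le]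

end
end

section
/- Let w ∈ (0,1), let γ ∈ W^{1,∞}_{i,a}(𝕋, ℝ^n), and let g: [0, 1/2] → [0, ∞) be concave and strictly monotonically increasing. Then ∫_𝕋 g(|γ(u+w) − γ(u)|²) du ≤ g(sin(πw)²/π²), with equality if and only if the image of γ is a round circle. -/
open MeasureTheory Real Set intervalIntegral
open scoped ENNReal RealInnerProductSpace

noncomputable section

/-- The Fundamental Theorem of Calculus for absolutely continuous functions with an essentially
bounded derivative. -/
theorem AbsolutelyContinuousOnInterval.integral_eq_sub_of_ae_hasDerivAt
    {E : Type*} [NormedAddCommGroup E] [NormedSpace ℝ E] [CompleteSpace E]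
    {F f : ℝ → E} {a b C : ℝ} (hF : AbsolutelyContinuousOnInterval F a b)
    (hd : ∀ᵐ x, HasDerivAt F (f x) x) (hf : LocallyIntegrable f volume)
    (hC : ∀ᵐ x, ‖f x‖ ≤ C) : ∫ x in a..b, f x = F b - F a := by
  have hii (x y : ℝ) : IntervalIntegrable f volume x y :=
    (hf.integrableOn_isCompact isCompact_uIcc).intervalIntegrable
  have hlip : LipschitzWith C.toNNReal (fun x => ∫ t in a..x, f t) := by
    refine LipschitzWith.of_dist_le_mul fun x y => ?_
    rw [dist_eq_norm, integral_interval_sub_left (hii _ _) (hii _ _), Real.dist_eq]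
    refine norm_integral_le_of_norm_le_const_ae ?_
    filter_upwards [hC] with t ht _ using ht.trans (le_coe_toNNReal C)
  obtain ⟨K, hK⟩ := (hF.sub
    hlip.lipschitzOnWith.absolutelyContinuousOnInterval).const_of_ae_hasDerivAt_zero (by
      filter_upwards [hd, LocallyIntegrable.ae_hasDerivAt_integral hf] with x hx hx' _
      simpa using hx.sub (hx' a))
  have ha := hK a left_mem_uIcc
  have hb := hK b right_mem_uIcc
  simp only [Pi.sub_apply, integral_same, sub_zero] at ha hb
  rw [ha, ← hb]
  abel

namespace ClosedCurve

variable {n : ℕ} (γ : ClosedCurve n)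

theorem intervalIntegrable_deriv' (a b : ℝ) : IntervalIntegrable γ.deriv' volume a b :=
  γ.deriv'_periodic.intervalIntegrable₀ one_ne_zero
    ((intervalIntegrable_iff_integrableOn_Icc_of_le zero_le_one).2 γ.integrableOn) a b

theorem locallyIntegrable_deriv' : LocallyIntegrable γ.deriv' volume := by
  refine locallyIntegrable_iff.2 fun K hK => ?_
  obtain ⟨R, hR⟩ := hK.isBounded.subset_closedBall 0
  rw [Real.closedBall_eq_Icc] at hR
  by_cases h : (0:ℝ) - R ≤ 0 + R
  · exact ((intervalIntegrable_iff_integrableOn_Icc_of_le h).1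
      (γ.intervalIntegrable_deriv' _ _)).mono_set hR
  · rw [Icc_eq_empty h] at hR
    simp [subset_empty_iff.1 hR]

theorem ae_hasDerivAt : ∀ᵐ t, HasDerivAt γ.toFun (γ.deriv' t) t := by
  filter_upwards [LocallyIntegrable.ae_hasDerivAt_integral γ.locallyIntegrable_deriv'] with t ht
  rw [funext γ.eq_integral]
  exact (ht 0).const_add _

variable {γ}

theorem IsArclength.lipschitzWith (h : γ.IsArclength) : LipschitzWith 1 γ.toFun := by
  refine LipschitzWith.of_dist_le_mul fun x y => ?_
  rw [dist_eq_norm, γ.eq_integral x, γ.eq_integral y, add_sub_add_left_eq_sub,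
    integral_interval_sub_left (γ.intervalIntegrable_deriv' _ _)
      (γ.intervalIntegrable_deriv' _ _), Real.dist_eq]
  refine norm_integral_le_of_norm_le_const_ae ?_
  filter_upwards [h] with t ht _ using by simp [ht]

end ClosedCurve

/-- The `k`-th Fourier coefficient of a function on `[0, 1]`. -/
def unitFourierCoeff (f : ℝ → ℂ) (k : ℤ) : ℂ :=
  ∫ t in (0:ℝ)..1, Complex.exp (2 * π * Complex.I * (-k : ℤ) * t) * f t

theorem unitFourierCoeff_eq (f : ℝ → ℂ) (k : ℤ) :
    unitFourierCoeff f k = fourierCoeffOn zero_lt_one f k := by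
  rw [fourierCoeffOn_eq_integral]
  simp only [sub_zero, div_one, one_smul, unitFourierCoeff, fourier_coe_apply, smul_eq_mul,
    Complex.ofReal_one]

/-- **Parseval's identity** on the unit interval. -/
theorem hasSum_sq_unitFourierCoeff {f : ℝ → ℂ} (hf : MemLp f 2 (volume.restrict (Ioc 0 1))) :
    HasSum (fun k => ‖unitFourierCoeff f k‖ ^ 2) (∫ t in (0:ℝ)..1, ‖f t‖ ^ 2) := by
  simpa [unitFourierCoeff_eq] using hasSum_sq_fourierCoeffOn zero_lt_one hf

/-- A continuous periodic function all of whose Fourier coefficients of order at least two vanish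
is a trigonometric polynomial of degree one. -/
theorem eq_trigonometric_of_unitFourierCoeff_eq_zero {f : ℝ → ℂ} (hf : Continuous f)
    (hp : Function.Periodic f 1)
    (h : ∀ k : ℤ, k ∉ ({-1, 0, 1} : Finset ℤ) → unitFourierCoeff f k = 0)
    (t : ℝ) :
    f t = ∑ k ∈ ({-1, 0, 1} : Finset ℤ),
      unitFourierCoeff f k * Complex.exp (2 * π * Complex.I * k * t) := by
  let F : C(AddCircle (1:ℝ), ℂ) := ⟨hp.lift, continuous_coinduced_dom.mpr hf⟩
  have hF (k : ℤ) : fourierCoeff F k = unitFourierCoeff f k := by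
    rw [fourierCoeff_eq_intervalIntegral _ _ 0]
    simp only [zero_add, div_one, one_smul, unitFourierCoeff, fourier_coe_apply, smul_eq_mul,
      Complex.ofReal_one]
    rfl
  have h0 (k : ℤ) (hk : k ∉ ({-1, 0, 1} : Finset ℤ)) : fourierCoeff F k = 0 :=
    (hF k).trans (h k hk)
  have hs := has_pointwise_sum_fourier_series_of_summable (f := F)
    (summable_of_ne_finset_zero h0) (t : AddCircle (1:ℝ))
  have hs' := hasSum_sum_of_ne_finset_zero (L := .unconditional _) (s := ({-1, 0, 1} : Finset ℤ))
    (f := fun k => fourierCoeff F k • fourier k (t : AddCircle (1:ℝ)))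
    fun k hk => by rw [h0 k hk, zero_smul]
  have := hs.unique hs'
  simp only [hF, fourier_coe_apply, Complex.ofReal_one, div_one, smul_eq_mul] at this
  exact this

theorem exp_two_pi_I_int_mul_periodic (k : ℤ) :
    Function.Periodic (fun t : ℝ => Complex.exp (2 * π * Complex.I * k * t)) 1 := fun t => by
  beta_reduce
  rw [← Complex.exp_periodic.int_mul k (2 * π * Complex.I * k * t)]
  congr 1
  push_cast
  ring

theorem unitFourierCoeff_comp_add {f : ℝ → ℂ} (hp : Function.Periodic f 1) (w : ℝ) (k : ℤ) :
    unitFourierCoeff (fun t => f (t + w)) k =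
      Complex.exp (2 * π * Complex.I * k * w) * unitFourierCoeff f k := by
  have hG := (exp_two_pi_I_int_mul_periodic (-k)).mul hp
  have h : unitFourierCoeff f k = ∫ t in (0:ℝ)..1,
      (Complex.exp (2 * π * Complex.I * (-k : ℤ) * (t + w : ℝ)) * f (t + w)) := by
    rw [integral_comp_add_right
      (fun t : ℝ => Complex.exp (2 * π * Complex.I * (-k : ℤ) * t) * f t), add_comm 1 w]
    simpa [unitFourierCoeff] using hG.intervalIntegral_add_eq 0 (0 + w)
  rw [h, unitFourierCoeff, ← intervalIntegral.integral_const_mul]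
  congr 1 with t
  rw [← mul_assoc, ← Complex.exp_add]
  congr 2
  push_cast
  ring

theorem unitFourierCoeff_deriv {f f' : ℝ → ℂ} {K : NNReal} {C : ℝ} (hf : LipschitzWith K f)
    (hp : Function.Periodic f 1) (hd : ∀ᵐ t, HasDerivAt f (f' t) t)
    (hf' : LocallyIntegrable f' volume) (hC : ∀ᵐ t, ‖f' t‖ ≤ C) (k : ℤ) :
    unitFourierCoeff f' k = 2 * π * Complex.I * k * unitFourierCoeff f k := by
  set e : ℝ → ℂ := fun t => Complex.exp (2 * π * Complex.I * (-k : ℤ) * t) with he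
  have hec : ContDiff ℝ 1 e := by
    have : ContDiff ℝ 1 (fun t : ℝ => (t : ℂ)) := Complex.ofRealCLM.contDiff
    fun_prop
  have hed (t : ℝ) : HasDerivAt e (2 * π * Complex.I * (-k : ℤ) * e t) t := by
    have := (((hasDerivAt_id (t : ℂ)).const_mul (2 * π * Complex.I * (-k : ℤ))).cexp).comp_ofReal
    convert! this using 1
    simp [he]; ring
  have hen (t : ℝ) : ‖e t‖ = 1 := by
    simp only [he]
    rw [show (2 * π * Complex.I * (-k : ℤ) * t : ℂ) = ((2 * π * (-k : ℤ) * t : ℝ) : ℂ) * Complex.I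
      by push_cast; ring]
    exact Complex.norm_exp_ofReal_mul_I _
  obtain ⟨M, hM⟩ : ∃ M, ∀ t, ‖f t‖ ≤ M := by
    obtain ⟨M, hM⟩ := isCompact_Icc.exists_bound_of_continuousOn hf.continuous.continuousOn
      (s := Icc (0:ℝ) 1)
    refine ⟨M, fun t => ?_⟩
    obtain ⟨y, hy, hty⟩ := hp.exists_mem_Ico₀ one_pos t
    rw [hty]
    exact hM y (Ico_subset_Icc_self hy)
  have hi1 : LocallyIntegrable (fun t => 2 * π * Complex.I * (-k : ℤ) * e t * f t) volume :=
    Continuous.locallyIntegrable (by have := hf.continuous; have := hec.continuous; fun_prop)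
  have hi2 : LocallyIntegrable (fun t => e t * f' t) volume := by
    have := hf'.locallyIntegrableOn univ
    rw [← locallyIntegrableOn_univ]
    simpa using this.continuousOn_smul isOpen_univ.isLocallyClosed hec.continuous.continuousOn
  have key := AbsolutelyContinuousOnInterval.integral_eq_sub_of_ae_hasDerivAt (a := 0) (b := 1)
    (F := fun t => e t * f t) (f := fun t => 2 * π * Complex.I * (-k : ℤ) * e t * f t + e t * f' t)
    (C := ‖(2 * π * Complex.I * (-k : ℤ) : ℂ)‖ * M + C)
    (hec.contDiffOn.absolutelyContinuousOnInterval.smul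
      hf.lipschitzOnWith.absolutelyContinuousOnInterval)
    (by filter_upwards [hd] with t ht using (hed t).mul ht)
    (hi1.add hi2)
    (by
      filter_upwards [hC] with t ht
      refine (norm_add_le _ _).trans (add_le_add ?_ ?_)
      · rw [norm_mul, norm_mul, hen, mul_one]
        gcongr
        exact hM t
      · rwa [norm_mul, hen, one_mul])
  have hper := (exp_two_pi_I_int_mul_periodic (-k)).mul hp 0
  simp only [Pi.mul_apply, zero_add] at hper
  have hii {g : ℝ → ℂ} (hg : LocallyIntegrable g volume) : IntervalIntegrable g volume 0 1 :=
    (hg.integrableOn_isCompact isCompact_uIcc).intervalIntegrable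
  rw [integral_add (hii hi1) (hii hi2)] at key
  have h2 : e 1 * f 1 - e 0 * f 0 = 0 := sub_eq_zero.2 hper
  rw [h2] at key
  have h3 : (∫ t in (0:ℝ)..1, 2 * π * Complex.I * (-k : ℤ) * e t * f t) =
      2 * π * Complex.I * (-k : ℤ) * unitFourierCoeff f k := by
    rw [unitFourierCoeff, ← intervalIntegral.integral_const_mul]
    congr 1 with t
    ring
  rw [h3] at key
  change unitFourierCoeff f' k = _
  have h4 : unitFourierCoeff f' k = ∫ t in (0:ℝ)..1, e t * f' t := rfl
  rw [← h4] at key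
  push_cast at key
  linear_combination key

theorem norm_exp_two_pi_I_sub_one_sq (x : ℝ) :
    ‖Complex.exp (2 * π * Complex.I * x) - 1‖ ^ 2 = 4 * sin (π * x) ^ 2 := by
  have : (2 * π * Complex.I * x : ℂ) = Complex.I * (2 * π * x : ℝ) := by push_cast; ring
  rw [this, Complex.norm_exp_I_mul_ofReal_sub_one]
  rw [show 2 * π * x / 2 = π * x by ring, norm_mul, mul_pow]
  norm_num

theorem abs_sin_nat_mul_le (n : ℕ) (x : ℝ) : |sin (n * x)| ≤ n * |sin x| := by
  induction n with
  | zero => simp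
  | succ n ih =>
    rw [Nat.cast_succ, add_mul, one_mul, sin_add, add_mul, one_mul]
    refine (abs_add_le _ _).trans (add_le_add ?_ ?_)
    · rw [abs_mul]
      exact (mul_le_of_le_one_right (abs_nonneg _) (abs_cos_le_one _)).trans ih
    · rw [abs_mul]
      exact mul_le_of_le_one_left (abs_nonneg _) (abs_cos_le_one _)

theorem abs_sin_nat_mul_lt {n : ℕ} (hn : 2 ≤ n) {x : ℝ} (hx : sin x ≠ 0) :
    |sin (n * x)| < n * |sin x| := by
  obtain ⟨m, rfl⟩ := Nat.exists_eq_add_of_le' (show 1 ≤ n by omega)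
  have hc : |cos x| < 1 := by
    rw [← sq_lt_one_iff_abs_lt_one]
    nlinarith [sin_sq_add_cos_sq x, sq_pos_of_ne_zero hx]
  have hm : (0:ℝ) < m := by exact_mod_cast (show 0 < m by omega)
  rw [Nat.cast_succ, add_mul, one_mul, sin_add, add_mul, one_mul]
  refine (abs_add_le _ _).trans_lt (add_lt_add_of_lt_of_le ?_ ?_)
  · rw [abs_mul]
    calc |sin (m * x)| * |cos x| ≤ m * |sin x| * |cos x| := by
          gcongr; exact abs_sin_nat_mul_le m x
      _ < m * |sin x| * 1 := by
          gcongr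
      _ = m * |sin x| := mul_one _
  · rw [abs_mul]
    exact mul_le_of_le_one_left (abs_nonneg _) (abs_cos_le_one _)

theorem sq_sin_int_mul_eq (k : ℤ) (x : ℝ) : sin (k * x) ^ 2 = |sin (k.natAbs * x)| ^ 2 := by
  rw [sq_abs]
  rcases Int.natAbs_eq k with h | h <;> rw [h] <;> simp

theorem sq_sin_int_mul_le (k : ℤ) (x : ℝ) : sin (k * x) ^ 2 ≤ k ^ 2 * sin x ^ 2 := by
  have := pow_le_pow_left₀ (abs_nonneg _) (abs_sin_nat_mul_le k.natAbs x) 2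
  rwa [← sq_sin_int_mul_eq, mul_pow, sq_abs, Nat.cast_natAbs, Int.cast_abs, sq_abs] at this

theorem sq_sin_int_mul_lt {k : ℤ} (hk : k ∉ ({-1, 0, 1} : Finset ℤ)) {x : ℝ} (hx : sin x ≠ 0) :
    sin (k * x) ^ 2 < k ^ 2 * sin x ^ 2 := by
  have hk2 : 2 ≤ k.natAbs := by
    simp only [Finset.mem_insert, Finset.mem_singleton] at hk
    omega
  have := pow_lt_pow_left₀ (abs_sin_nat_mul_lt hk2 hx) (abs_nonneg _) two_ne_zero
  rwa [← sq_sin_int_mul_eq, mul_pow, sq_abs, Nat.cast_natAbs, Int.cast_abs, sq_abs] at this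

namespace ClosedCurve

variable {n : ℕ} {γ : ClosedCurve n}

theorem IsArclength.hasSum_chord_deficit (harc : γ.IsArclength) (w : ℝ) :
    HasSum (fun k : ℤ => ∑ i, (4 * (k ^ 2 * sin (π * w) ^ 2) - 4 * sin (k * (π * w)) ^ 2) *
        ‖unitFourierCoeff (fun t => (γ.toFun t i : ℂ)) k‖ ^ 2)
      (sin (π * w) ^ 2 / π ^ 2 - ∫ u in (0:ℝ)..1, ‖γ.toFun (u + w) - γ.toFun u‖ ^ 2) := by
  let L (i : Fin n) : EuclideanSpace ℝ (Fin n) →L[ℝ] ℂ :=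
    Complex.ofRealCLM.comp (EuclideanSpace.proj i)
  have hL (i : Fin n) (x : EuclideanSpace ℝ (Fin n)) : ‖L i x‖ ≤ ‖x‖ := by
    simpa [L] using PiLp.norm_apply_le x i
  have hsum (x : EuclideanSpace ℝ (Fin n)) : ∑ i, ‖L i x‖ ^ 2 = ‖x‖ ^ 2 := by
    simp [L, EuclideanSpace.norm_sq_eq]
  have hcont : Continuous γ.toFun := harc.lipschitzWith.continuous
  have hp (i : Fin n) : Function.Periodic (fun t => L i (γ.toFun t)) 1 := fun t => by
    simp only [γ.periodic t]
  have hlip (i : Fin n) : LipschitzWith 1 (fun t => L i (γ.toFun t)) := by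
    refine LipschitzWith.of_dist_le_mul fun x y => ?_
    rw [dist_eq_norm, ← map_sub]
    refine (hL i _).trans ?_
    rw [← dist_eq_norm]
    exact harc.lipschitzWith.dist_le_mul x y
  have hbd (i : Fin n) : ∀ᵐ t, ‖L i (γ.deriv' t)‖ ≤ 1 := by
    filter_upwards [harc] with t ht using (hL i _).trans ht.le
  have hloc (i : Fin n) : LocallyIntegrable (fun t => L i (γ.deriv' t)) volume := by
    have := γ.locallyIntegrable_deriv'
    exact fun x => by
      obtain ⟨s, hs, hs'⟩ := this x
      exact ⟨s, hs, (L i).integrable_comp hs'⟩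
  have hD (i : Fin n) (k : ℤ) : unitFourierCoeff (fun t => L i (γ.deriv' t)) k =
      2 * π * Complex.I * k * unitFourierCoeff (fun t => L i (γ.toFun t)) k :=
    unitFourierCoeff_deriv (hlip i) (hp i) (by
      filter_upwards [γ.ae_hasDerivAt] with t ht
      exact (L i).hasFDerivAt.comp_hasDerivAt t ht) (hloc i) (hbd i) k
  have hS (i : Fin n) (k : ℤ) :
      unitFourierCoeff (fun u => L i (γ.toFun (u + w) - γ.toFun u)) k =
        (Complex.exp (2 * π * Complex.I * k * w) - 1) *
          unitFourierCoeff (fun t => L i (γ.toFun t)) k := by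
    rw [sub_mul, one_mul, ← unitFourierCoeff_comp_add (hp i), unitFourierCoeff, unitFourierCoeff,
      unitFourierCoeff, ← intervalIntegral.integral_sub]
    · simp only [map_sub, mul_sub]
    all_goals exact Continuous.intervalIntegrable (by fun_prop) _ _
  have hPD (i : Fin n) := hasSum_sq_unitFourierCoeff (f := fun t => L i (γ.deriv' t))
    (MemLp.of_bound ((hloc i).aestronglyMeasurable.restrict) 1 (ae_restrict_of_ae (hbd i)))
  have hcS (i : Fin n) : Continuous (fun u => L i (γ.toFun (u + w) - γ.toFun u)) := by fun_prop
  have hPS (i : Fin n) := hasSum_sq_unitFourierCoeff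
    (f := fun u => L i (γ.toFun (u + w) - γ.toFun u))
    (MemLp.of_bound (hcS i).aestronglyMeasurable |w| (ae_of_all _ fun u => (hL i _).trans (by
      simpa [dist_eq_norm] using harc.lipschitzWith.dist_le_mul (u + w) u)))
  have h1 : ∑ i, ∫ t in (0:ℝ)..1, ‖L i (γ.deriv' t)‖ ^ 2 = 1 := by
    rw [← intervalIntegral.integral_finsetSum]
    · simp only [hsum]
      rw [intervalIntegral.integral_congr_ae (g := fun _ => (1:ℝ))]
      · simp
      · filter_upwards [harc] with t ht _ using by rw [ht, one_pow]
    · intro i _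
      refine (intervalIntegrable_const (c := (1:ℝ))).mono_fun
        (((hloc i).aestronglyMeasurable.norm.pow 2).restrict) ?_
      filter_upwards [ae_restrict_of_ae (hbd i)] with t ht
      simpa using ht
  have h2 : ∑ i, ∫ u in (0:ℝ)..1, ‖L i (γ.toFun (u + w) - γ.toFun u)‖ ^ 2 =
      ∫ u in (0:ℝ)..1, ‖γ.toFun (u + w) - γ.toFun u‖ ^ 2 := by
    rw [← intervalIntegral.integral_finsetSum]
    · simp only [hsum]
    · exact fun i _ => ((hcS i).norm.pow 2).intervalIntegrable _ _
  have key := ((hasSum_sum fun i (_ : i ∈ Finset.univ) => hPD i).mul_left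
    (sin (π * w) ^ 2 / π ^ 2)).sub (hasSum_sum fun i (_ : i ∈ Finset.univ) => hPS i)
  rw [h1, h2, mul_one] at key
  convert! key using 1
  ext k
  rw [Finset.mul_sum, ← Finset.sum_sub_distrib]
  refine Finset.sum_congr rfl fun i _ => ?_
  have hk : (2 * π * Complex.I * k * w : ℂ) = 2 * π * Complex.I * ((k * w : ℝ) : ℂ) := by
    push_cast
    ring
  rw [hD, hS, hk, norm_mul (_ * (k : ℂ)), norm_mul (_ - 1), mul_pow, mul_pow,
    norm_exp_two_pi_I_sub_one_sq, show π * (k * w) = k * (π * w) by ring]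
  have hn : ‖(2 * π * Complex.I * k : ℂ)‖ ^ 2 = 4 * π ^ 2 * k ^ 2 := by
    simp only [norm_mul, Complex.norm_ofNat, Complex.norm_real, Complex.norm_I, Complex.norm_intCast,
      mul_pow, norm_eq_abs, sq_abs]
    ring
  rw [hn]
  have : (fun t => (γ.toFun t i : ℂ)) = fun t => L i (γ.toFun t) := rfl
  rw [this]
  field_simp

theorem IsArclength.integral_sq_chord_le (harc : γ.IsArclength) (w : ℝ) :
    ∫ u in (0:ℝ)..1, ‖γ.toFun (u + w) - γ.toFun u‖ ^ 2 ≤ sin (π * w) ^ 2 / π ^ 2 := by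
  refine sub_nonneg.1 ((harc.hasSum_chord_deficit w).nonneg fun k =>
    Finset.sum_nonneg fun i _ => mul_nonneg ?_ (sq_nonneg _))
  linarith [sq_sin_int_mul_le k (π * w)]

/-- If the mean squared chord length is maximal, the curve is an ellipse. -/
theorem IsArclength.exists_eq_trigonometric (harc : γ.IsArclength) {w : ℝ}
    (hw : sin (π * w) ≠ 0)
    (h : ∫ u in (0:ℝ)..1, ‖γ.toFun (u + w) - γ.toFun u‖ ^ 2 = sin (π * w) ^ 2 / π ^ 2) :
    ∃ A B C : EuclideanSpace ℝ (Fin n), ∀ t,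
      γ.toFun t = A + cos (2 * π * t) • B + sin (2 * π * t) • C := by
  have hs := harc.hasSum_chord_deficit w
  have hnn (k : ℤ) (i : Fin n) :
      0 ≤ (4 * (k ^ 2 * sin (π * w) ^ 2) - 4 * sin (k * (π * w)) ^ 2) *
        ‖unitFourierCoeff (fun t => (γ.toFun t i : ℂ)) k‖ ^ 2 := by
    refine mul_nonneg ?_ (sq_nonneg _)
    linarith [sq_sin_int_mul_le k (π * w)]
  rw [h, sub_self, hasSum_zero_iff_of_nonneg fun k => Finset.sum_nonneg fun i _ => hnn k i] at hs
  have hz (i : Fin n) (k : ℤ) (hk : k ∉ ({-1, 0, 1} : Finset ℤ)) :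
      unitFourierCoeff (fun t => (γ.toFun t i : ℂ)) k = 0 := by
    have := (Finset.sum_eq_zero_iff_of_nonneg fun i _ => hnn k i).1 (congr_fun hs k) i
      (Finset.mem_univ i)
    rcases mul_eq_zero.1 this with h0 | h0
    · linarith [sq_sin_int_mul_lt hk hw]
    · simpa using h0
  have hcont : Continuous γ.toFun := harc.lipschitzWith.continuous
  have hrep (i : Fin n) (t : ℝ) := congr_arg Complex.re
    (eq_trigonometric_of_unitFourierCoeff_eq_zero (f := fun t => (γ.toFun t i : ℂ))
      (by fun_prop) (fun t => by simp only [γ.periodic t]) (hz i) t)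
  let c (i : Fin n) := unitFourierCoeff (fun t => (γ.toFun t i : ℂ))
  refine ⟨WithLp.toLp 2 fun i => (c i 0).re, WithLp.toLp 2 fun i => (c i 1).re + (c i (-1)).re,
    WithLp.toLp 2 fun i => (c i (-1)).im - (c i 1).im, fun t => ?_⟩
  ext i
  have h1 := hrep i t
  have e1 : (2 * π * Complex.I * (1 : ℤ) * t : ℂ) = (2 * π * t : ℝ) * Complex.I := by
    push_cast; ring
  have e2 : (2 * π * Complex.I * (-1 : ℤ) * t : ℂ) = (-(2 * π * t) : ℝ) * Complex.I := by
    push_cast; ring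
  rw [Finset.sum_insert (by simp), Finset.sum_insert (by simp), Finset.sum_singleton, e1, e2] at h1
  simp only [Complex.add_re, Complex.mul_re, Complex.exp_ofReal_mul_I_re,
    Complex.exp_ofReal_mul_I_im, Complex.ofReal_re, cos_neg, sin_neg] at h1
  rw [h1]
  simp [c]
  ring

end ClosedCurve

namespace ClosedCurve

variable {n : ℕ} {γ : ClosedCurve n}

theorem IsArclength.isCircle_of_eq_trigonometric (harc : γ.IsArclength)
    {A B C : EuclideanSpace ℝ (Fin n)}
    (h : ∀ t, γ.toFun t = A + cos (2 * π * t) • B + sin (2 * π * t) • C) :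
    IsCircle (range γ.toFun) := by
  have hpi : 0 < 2 * π := two_pi_pos
  have hd (t : ℝ) : HasDerivAt γ.toFun
      ((2 * π) • (-(sin (2 * π * t)) • B + cos (2 * π * t) • C)) t := by
    rw [funext h]
    have h0 : HasDerivAt (fun t : ℝ => 2 * π * t) (2 * π) t := by
      simpa using (hasDerivAt_id t).const_mul (2 * π)
    convert! ((h0.cos.smul_const B).const_add A).add (h0.sin.smul_const C) using 1
    module
  have hn (t : ℝ) : ‖(2 * π) • (-(sin (2 * π * t)) • B + cos (2 * π * t) • C)‖ = 1 := by
    refine congr_fun ((Continuous.ae_eq_iff_eq volume (f := fun t : ℝ =>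
      ‖(2 * π) • (-(sin (2 * π * t)) • B + cos (2 * π * t) • C)‖) (g := fun _ => (1:ℝ))
      (by fun_prop) continuous_const).1 ?_) t
    filter_upwards [harc, γ.ae_hasDerivAt] with t ht ht'
    rw [(hd t).unique ht', ht]
  have hsq (t : ℝ) : (2 * π) ^ 2 * (sin (2 * π * t) ^ 2 * ‖B‖ ^ 2 + cos (2 * π * t) ^ 2 * ‖C‖ ^ 2
      - 2 * (sin (2 * π * t) * cos (2 * π * t) * ⟪B, C⟫)) = 1 := by
    have := congr_arg (· ^ 2) (hn t)
    simp only [norm_smul, mul_pow, norm_add_sq_real, inner_smul_left, inner_smul_right,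
      norm_neg, norm_eq_abs, sq_abs, one_pow, map_neg, conj_trivial] at this
    linear_combination this
  have hC : ‖C‖ ^ 2 = (1 / (2 * π)) ^ 2 := by
    have := hsq 0
    simp at this
    field_simp
    linear_combination this
  have hB : ‖B‖ ^ 2 = (1 / (2 * π)) ^ 2 := by
    have := hsq (1 / 4)
    rw [show 2 * π * (1 / 4) = π / 2 by ring] at this
    simp at this
    field_simp
    linear_combination this
  have hBC : ⟪B, C⟫ = 0 := by
    have := hsq (1 / 8)
    rw [show 2 * π * (1 / 8) = π / 4 by ring, hB, hC, sin_pi_div_four, cos_pi_div_four] at this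
    have h2 : (√2) ^ 2 = (2:ℝ) := sq_sqrt zero_le_two
    field_simp at this
    have h3 : (√2) ^ 2 * (2 * π) ^ 2 * ⟪B, C⟫ = 0 := by
      linear_combination (-1 / 2 : ℝ) * this + h2
    have : (√2) ^ 2 * (2 * π) ^ 2 ≠ 0 := by positivity
    exact (mul_eq_zero.1 h3).resolve_left this
  have hsqn (α β : ℝ) : ‖α • B + β • C‖ ^ 2 = (1 / (2 * π)) ^ 2 * (α ^ 2 + β ^ 2) := by
    rw [norm_add_sq_real, inner_smul_left, inner_smul_right, hBC, norm_smul, norm_smul, mul_pow,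
      mul_pow, hB, hC]
    simp
    ring
  refine ⟨A, 1 / (2 * π), Submodule.span ℝ {B, C}, by positivity, ?_, ?_⟩
  · have hli : LinearIndependent ℝ ![B, C] := by
      rw [LinearIndependent.pair_iff]
      intro s t hst
      have := hsqn s t
      rw [hst] at this
      have h2 : s ^ 2 + t ^ 2 = 0 := by
        have h3 : (1 / (2 * π)) ^ 2 ≠ 0 := by positivity
        simp only [norm_zero] at this
        exact (mul_eq_zero.1 (this.symm.trans (by norm_num))).resolve_left h3
      constructor <;> nlinarith
    have := finrank_span_eq_card hli
    rwa [Matrix.range_cons, Matrix.range_cons, Matrix.range_empty, union_empty, singleton_union,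
      Fintype.card_fin] at this
  · ext x
    constructor
    · rintro ⟨t, rfl⟩
      have : γ.toFun t - A = cos (2 * π * t) • B + sin (2 * π * t) • C := by rw [h]; module
      refine ⟨?_, ?_⟩
      · rw [this, ← sq_eq_sq₀ (norm_nonneg _) (by positivity), hsqn, cos_sq_add_sin_sq, mul_one]
      · rw [this]
        exact Submodule.mem_span_pair.2 ⟨_, _, rfl⟩
    · rintro ⟨hx, hxV⟩
      obtain ⟨α, β, hαβ⟩ := Submodule.mem_span_pair.1 hxV
      have h1 := hsqn α β
      rw [hαβ, hx] at h1
      have h2 : α ^ 2 + β ^ 2 = 1 := by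
        have h3 : (1 / (2 * π)) ^ 2 ≠ 0 := by positivity
        exact mul_left_cancel₀ h3 (by rw [mul_one, ← h1])
      have h3 : ‖(⟨α, β⟩ : ℂ)‖ = 1 := by
        rw [← sq_eq_sq₀ (norm_nonneg _) zero_le_one, Complex.sq_norm, Complex.normSq_mk]
        linear_combination h2
      have h4 : (⟨α, β⟩ : ℂ) ≠ 0 := fun h => by simp [h] at h3
      refine ⟨(⟨α, β⟩ : ℂ).arg / (2 * π), ?_⟩
      rw [h, mul_div_cancel₀ _ hpi.ne', Complex.cos_arg h4, Complex.sin_arg, h3, div_one, div_one,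
        add_assoc, hαβ]
      abel

end ClosedCurve

theorem lipschitzWith_exp_I_mul_ofReal :
    LipschitzWith 1 (fun x : ℝ => Complex.exp (Complex.I * x)) := by
  refine LipschitzWith.of_dist_le_mul fun x y => ?_
  have h : Complex.exp (Complex.I * x) - Complex.exp (Complex.I * y) =
      Complex.exp (Complex.I * y) * (Complex.exp (Complex.I * (x - y : ℝ)) - 1) := by
    rw [mul_sub, mul_one, ← Complex.exp_add]
    congr 2
    push_cast
    ring
  rw [dist_eq_norm, h, norm_mul, Complex.norm_exp_I_mul_ofReal, one_mul, NNReal.coe_one, one_mul,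
    dist_eq_norm]
  exact norm_exp_I_mul_ofReal_sub_one_le

/-- A continuous function that is injective on an open interval and has derivative of constant
absolute value almost everywhere has derivative of constant sign. -/
theorem exists_sign_ae_eq_of_injOn_Ioo {θ ω : ℝ → ℝ} {a b v : ℝ} (hab : a < b)
    (hθ : ContinuousOn θ (Ioo a b)) (hinj : InjOn θ (Ioo a b))
    (hd : ∀ᵐ t, HasDerivAt θ (ω t) t) (hω : ∀ᵐ t, |ω t| = v) :
    ∃ ε : ℝ, (ε = 1 ∨ ε = -1) ∧ ∀ᵐ t, t ∈ Ioo a b → ω t = ε * v := by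
  have hacc {t : ℝ} (ht : t ∈ Ioo a b) := (isOpen_Ioo.uniqueDiffWithinAt (𝕜 := ℝ) ht).accPt
  rcases hθ.strictMonoOn_of_injOn_Ioo hab hinj with h | h
  · refine ⟨1, .inl rfl, ?_⟩
    filter_upwards [hd, hω] with t ht ht' hmem
    rw [one_mul, ← ht', abs_of_nonneg
      (ht.hasDerivWithinAt.nonneg_of_monotoneOn (hacc hmem) h.monotoneOn)]
  · refine ⟨-1, .inr rfl, ?_⟩
    filter_upwards [hd, hω] with t ht ht' hmem
    rw [neg_one_mul, ← ht', abs_of_nonpos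
      (ht.hasDerivWithinAt.nonpos_of_antitoneOn (hacc hmem) h.antitoneOn), neg_neg]

/-- A Lipschitz curve on a circle around the origin is the exponential of the integral of its
angular velocity. -/
theorem eq_mul_exp_integral_of_norm_eq {z p : ℝ → ℂ} {r : ℝ} {K : NNReal} (hr : 0 < r)
    (hz : LipschitzWith K z) (hzr : ∀ t, ‖z t‖ = r) (hd : ∀ᵐ t, HasDerivAt z (p t) t)
    (hp : LocallyIntegrable p) (hp1 : ∀ᵐ t, ‖p t‖ = 1) :
    ∃ ω : ℝ → ℝ, LocallyIntegrable ω ∧ (∀ᵐ t, |ω t| = 1 / r) ∧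
      ∀ t, z t = z 0 * Complex.exp (Complex.I * (∫ s in (0:ℝ)..t, ω s : ℝ)) := by
  set ω : ℝ → ℝ := fun t => (starRingEnd ℂ (z t) * p t).im / r ^ 2 with hω
  have hzc := hz.continuous
  have hloc : LocallyIntegrable ω := by
    have h1 := hp.continuous_smul (g := fun t => starRingEnd ℂ (z t)) (by fun_prop)
    intro x
    obtain ⟨s, hs, hs'⟩ := h1 x
    exact ⟨s, hs, (Complex.imCLM.integrable_comp hs').div_const _⟩
  have hre : ∀ᵐ t, (starRingEnd ℂ (z t) * p t).re = 0 := by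
    filter_upwards [hd] with t ht
    have h1 := ht.norm_sq
    simp only [hzr] at h1
    have h2 := h1.unique (hasDerivAt_const t (r ^ 2))
    simpa [Complex.inner, mul_comm] using h2
  have hzp : ∀ᵐ t, p t = Complex.I * ω t * z t := by
    filter_upwards [hre] with t ht
    have h1 : starRingEnd ℂ (z t) * p t = Complex.I * (ω t * r ^ 2 : ℝ) := by
      apply Complex.ext
      · rw [ht, Complex.I_mul_re, Complex.ofReal_im, neg_zero]
      · rw [Complex.I_mul_im, Complex.ofReal_re]
        exact (div_mul_cancel₀ _ (by positivity)).symm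
    have h2 : z t * starRingEnd ℂ (z t) = (r ^ 2 : ℝ) := by
      rw [Complex.mul_conj, Complex.normSq_eq_norm_sq, hzr]
    have h3 : ((r ^ 2 : ℝ) : ℂ) ≠ 0 := by
      exact_mod_cast (pow_pos hr 2).ne'
    apply mul_left_cancel₀ h3
    rw [← h2, mul_assoc, h1]
    push_cast at h2 ⊢
    rw [h2]
    ring
  have habs : ∀ᵐ t, |ω t| = 1 / r := by
    filter_upwards [hp1, hzp] with t h1 h2
    rw [h2, norm_mul, norm_mul, Complex.norm_I, one_mul, hzr, Complex.norm_real, norm_eq_abs] at h1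
    field_simp
    exact h1
  refine ⟨ω, hloc, habs, fun t => ?_⟩
  set θ : ℝ → ℝ := fun t => ∫ s in (0:ℝ)..t, ω s with hθ
  have hii (a b : ℝ) : IntervalIntegrable ω volume a b :=
    (hloc.integrableOn_isCompact isCompact_uIcc).intervalIntegrable
  have hlip : LipschitzWith (1 / r).toNNReal (fun t => -θ t) := by
    refine LipschitzWith.of_dist_le_mul fun x y => ?_
    rw [dist_neg_neg, dist_eq_norm, integral_interval_sub_left (hii _ _) (hii _ _), Real.dist_eq]
    refine norm_integral_le_of_norm_le_const_ae ?_
    filter_upwards [habs] with t ht _ using ht.le.trans (le_coe_toNNReal _)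
  obtain ⟨c, hc⟩ := AbsolutelyContinuousOnInterval.const_of_ae_hasDerivAt_zero (a := 0) (b := t)
    (f := fun t => Complex.exp (Complex.I * (-θ t : ℝ)) * z t)
    ((lipschitzWith_exp_I_mul_ofReal.comp hlip).lipschitzOnWith.absolutelyContinuousOnInterval.smul
      hz.lipschitzOnWith.absolutelyContinuousOnInterval) (by
      filter_upwards [hd, hzp, LocallyIntegrable.ae_hasDerivAt_integral hloc] with x h1 h2 h3 _
      have h4 := (((h3 0).neg.ofReal_comp.const_mul Complex.I).cexp).mul h1
      convert! h4 using 1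
      rw [h2]
      simp only [Complex.ofReal_neg]
      ring)
  have h0 := hc 0 left_mem_uIcc
  have ht := hc t right_mem_uIcc
  simp only [hθ, integral_same, neg_zero, Complex.ofReal_zero, mul_zero, Complex.exp_zero,
    one_mul] at h0
  rw [h0, ← ht, mul_right_comm, ← Complex.exp_add]
  simp [hθ]

/-- A simple closed curve of length one on a circle around the origin in the complex plane runs
through the circle exactly once. -/
theorem norm_sub_sq_eq_of_norm_eq {z p : ℝ → ℂ} {r : ℝ} {K : NNReal} (hr : 0 < r)
    (hz : LipschitzWith K z) (hper : Function.Periodic z 1)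
    (hinj : ∀ s t, z s = z t → ∃ k : ℤ, s - t = k) (hzr : ∀ t, ‖z t‖ = r)
    (hd : ∀ᵐ t, HasDerivAt z (p t) t)
    (hp : LocallyIntegrable p) (hp1 : ∀ᵐ t, ‖p t‖ = 1) (u w : ℝ) :
    ‖z (u + w) - z u‖ ^ 2 = sin (π * w) ^ 2 / π ^ 2 := by
  obtain ⟨ω, hloc, habs, hexp⟩ := eq_mul_exp_integral_of_norm_eq hr hz hzr hd hp hp1
  have hii (a b : ℝ) : IntervalIntegrable ω volume a b :=
    (hloc.integrableOn_isCompact isCompact_uIcc).intervalIntegrable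
  have hz0 : z 0 ≠ 0 := fun h => by simpa [h, hr.ne] using hzr 0
  obtain ⟨ε, hε, hεω⟩ := exists_sign_ae_eq_of_injOn_Ioo (θ := fun t => ∫ s in (0:ℝ)..t, ω s)
    zero_lt_one (intervalIntegral.continuous_primitive hii 0).continuousOn
    (fun s hs t ht hst => by
      obtain ⟨k, hk⟩ := hinj s t (by rw [hexp s, hexp t]; beta_reduce at hst; rw [hst])
      have h1 : (-1:ℝ) < k := by rw [← hk]; linarith [hs.1, ht.2]
      have h2 : (k:ℝ) < 1 := by rw [← hk]; linarith [hs.2, ht.1]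
      have h3 : k = 0 := by
        have h1' : -1 < k := by exact_mod_cast h1
        have h2' : k < 1 := by exact_mod_cast h2
        omega
      rw [h3, Int.cast_zero] at hk
      linarith)
    (by filter_upwards [LocallyIntegrable.ae_hasDerivAt_integral hloc] with t ht using ht 0) habs
  have hz1 (t : ℝ) (ht : t ∈ Icc 0 1) :
      z t = z 0 * Complex.exp (Complex.I * (ε * (t / r) : ℝ)) := by
    rw [hexp t]
    congr 4
    rw [intervalIntegral.integral_congr_ae (g := fun _ => ε * (1 / r))]
    · rw [intervalIntegral.integral_const, smul_eq_mul]
      ring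
    · have h1 : ∀ᵐ t : ℝ, t ≠ 1 := by simp [ae_iff]
      filter_upwards [hεω, h1] with s hs hs1 hmem
      rw [uIoc_of_le ht.1] at hmem
      exact hs ⟨hmem.1, (hmem.2.trans ht.2).lt_of_ne hs1⟩
  have hexp_one {x : ℝ} (m : ℤ) (hx : x = m * (2 * π)) :
      Complex.exp (Complex.I * (ε * x : ℝ)) = 1 := by
    rw [Complex.exp_eq_one_iff, hx]
    rcases hε with rfl | rfl
    · exact ⟨m, by push_cast; ring⟩
    · exact ⟨-m, by push_cast; ring⟩
  obtain ⟨m, hm⟩ : ∃ m : ℤ, 1 / r = m * (2 * π) := by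
    have h1 := hz1 1 (by simp)
    have h2 : z 1 = z 0 := by simpa using hper 0
    rw [h2] at h1
    obtain ⟨m, hm⟩ := Complex.exp_eq_one_iff.1 (mul_left_cancel₀ hz0 ((mul_one _).trans h1)).symm
    have h3 : ε * (1 / r) = m * (2 * π) := by
      have h4 := congr_arg Complex.im hm
      simpa using h4
    rcases hε with rfl | rfl
    · exact ⟨m, by linarith⟩
    · exact ⟨-m, by push_cast; linarith⟩
  have hm0 : (0:ℝ) < m := by
    have : 0 < 1 / r := by positivity
    rw [hm] at this
    exact pos_of_mul_pos_left this two_pi_pos.le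
  have hm1 : (1:ℝ) ≤ m := by
    have : 0 < m := by exact_mod_cast hm0
    exact_mod_cast this
  obtain ⟨k, hk⟩ := hinj (1 / m) 0 (by
    rw [hz1 (1 / m) ⟨by positivity, by rw [div_le_one hm0]; exact hm1⟩, hexp_one 1, mul_one]
    rw [div_eq_mul_one_div, hm]
    field_simp
    simp)
  have hmk : (m:ℝ) = 1 := by
    have h1 : (k * m : ℝ) = 1 := by
      rw [← hk]
      field_simp
      ring
    have h2 : k * m = 1 := by exact_mod_cast h1
    have h3 : 0 < m := by exact_mod_cast hm0
    exact_mod_cast Int.eq_one_of_mul_eq_one_left h3.le h2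
  rw [hmk, one_mul] at hm
  have hr' : r = 1 / (2 * π) := by
    rw [← hm, one_div_one_div]
  have hall (t : ℝ) : z t = z 0 * Complex.exp (2 * π * Complex.I * (ε * t : ℝ)) := by
    have h1 := hz1 (Int.fract t) ⟨Int.fract_nonneg t, (Int.fract_lt_one t).le⟩
    have h2 : z (Int.fract t) = z t := by
      rw [Int.fract]
      simpa using (hper.sub_int_mul_eq ⌊t⌋ (x := t))
    rw [← h2, h1, div_eq_mul_one_div, hm]
    congr 1
    have h3 := hexp_one (x := ⌊t⌋ * (2 * π)) ⌊t⌋ rfl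
    rw [← mul_one (Complex.exp _), ← h3, ← Complex.exp_add, Int.fract]
    congr 1
    push_cast
    ring
  have key : z (u + w) - z u = z u * (Complex.exp (2 * π * Complex.I * (ε * w : ℝ)) - 1) := by
    rw [mul_sub, mul_one, hall (u + w), hall u, mul_assoc (z 0), ← Complex.exp_add]
    congr 3
    push_cast
    ring
  have hsin : sin (π * (ε * w)) ^ 2 = sin (π * w) ^ 2 := by
    rcases hε with rfl | rfl <;> simp
  rw [key, norm_mul, mul_pow, norm_exp_two_pi_I_sub_one_sq, hzr, hsin, hr']
  field_simp
  ring

namespace ClosedCurve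

variable {n : ℕ} {γ : ClosedCurve n}

/-- The chords of a circle of length one. -/
theorem norm_chord_sq_eq_of_isCircle (hinj : γ.IsInj) (harc : γ.IsArclength)
    (hcirc : IsCircle (range γ.toFun)) (u w : ℝ) :
    ‖γ.toFun (u + w) - γ.toFun u‖ ^ 2 = sin (π * w) ^ 2 / π ^ 2 := by
  obtain ⟨c, r, V, hr, hV, hrange⟩ := hcirc
  have hγ (t : ℝ) : ‖γ.toFun t - c‖ = r ∧ γ.toFun t - c ∈ V := by
    have : γ.toFun t ∈ range γ.toFun := mem_range_self t
    rwa [hrange] at this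
  let e : V ≃ₗᵢ[ℝ] ℂ := ((stdOrthonormalBasis ℝ V).reindex (finCongr hV)).equiv
    Complex.orthonormalBasisOneI (Equiv.refl _)
  let L : EuclideanSpace ℝ (Fin n) →L[ℝ] ℂ :=
    (e.toContinuousLinearEquiv : V →L[ℝ] ℂ).comp V.orthogonalProjectionOnto
  have hL {x : EuclideanSpace ℝ (Fin n)} (hx : x ∈ V) : ‖L x‖ = ‖x‖ := by
    have : V.orthogonalProjectionOnto x = ⟨x, hx⟩ :=
      V.orthogonalProjectionOnto_mem_subspace_eq_self ⟨x, hx⟩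
    simp [L, this]
  have hsub (s t : ℝ) : γ.toFun s - γ.toFun t ∈ V := by
    simpa using V.sub_mem (hγ s).2 (hγ t).2
  have hLsub (s t : ℝ) :
      ‖L (γ.toFun s - c) - L (γ.toFun t - c)‖ = ‖γ.toFun s - γ.toFun t‖ := by
    rw [← map_sub, sub_sub_sub_cancel_right, hL (hsub s t)]
  have hmem : ∀ᵐ t, γ.deriv' t ∈ V := by
    filter_upwards [γ.ae_hasDerivAt] with t ht
    have h1 := (V.subtypeL.comp V.orthogonalProjectionOnto).hasFDerivAt.comp_hasDerivAt t
      (ht.sub_const c)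
    have h2 : (V.subtypeL.comp V.orthogonalProjectionOnto) ∘ (fun t => γ.toFun t - c) =
        fun t => γ.toFun t - c := by
      ext1 s
      exact congr_arg Subtype.val (V.orthogonalProjectionOnto_mem_subspace_eq_self ⟨_, (hγ s).2⟩)
    rw [h2] at h1
    rw [(ht.sub_const c).unique h1]
    exact Subtype.coe_prop _
  rw [← hLsub]
  refine norm_sub_sq_eq_of_norm_eq (z := fun t => L (γ.toFun t - c)) (p := fun t => L (γ.deriv' t))
    (K := 1) hr ?_ (fun t => by simp only [γ.periodic t]) (fun s t hst => hinj s t ?_)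
    (fun t => (hL (hγ t).2).trans (hγ t).1) ?_ (fun x => ?_) ?_ u w
  · refine LipschitzWith.of_dist_le_mul fun s t => ?_
    rw [dist_eq_norm, hLsub, ← dist_eq_norm]
    exact harc.lipschitzWith.dist_le_mul s t
  · have := hLsub s t
    rwa [sub_eq_zero.2 hst, norm_zero, eq_comm, norm_sub_eq_zero_iff] at this
  · filter_upwards [γ.ae_hasDerivAt] with t ht
    exact L.hasFDerivAt.comp_hasDerivAt t (ht.sub_const c)
  · obtain ⟨s, hs, hs'⟩ := γ.locallyIntegrable_deriv' x
    exact ⟨s, hs, L.integrable_comp hs'⟩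
  · filter_upwards [hmem, harc] with t ht ht'
    rw [hL ht, ht']

end ClosedCurve

namespace ClosedCurve

variable {n : ℕ} {γ : ClosedCurve n}

theorem IsArclength.chord_sq_le (harc : γ.IsArclength) (u w : ℝ) :
    ‖γ.toFun (u + w) - γ.toFun u‖ ^ 2 ≤ 1 / 4 := by
  have h1 : γ.toFun (u + w) = γ.toFun (u + w - round w) := by
    simpa using (γ.periodic.sub_int_mul_eq (round w) (x := u + w)).symm
  have h2 := harc.lipschitzWith.dist_le_mul (u + w - round w) u
  rw [← h1, dist_eq_norm, NNReal.coe_one, one_mul, Real.dist_eq,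
    show u + w - round w - u = w - round w by ring] at h2
  have h3 := h2.trans (abs_sub_round w)
  nlinarith [norm_nonneg (γ.toFun (u + w) - γ.toFun u)]

theorem exists_pos_le_chord_sq (harc : γ.IsArclength) (hinj : γ.IsInj) {w : ℝ} (hw0 : 0 < w)
    (hw1 : w < 1) : ∃ m > 0, ∀ u, m ≤ ‖γ.toFun (u + w) - γ.toFun u‖ ^ 2 := by
  have hc : Continuous fun u => ‖γ.toFun (u + w) - γ.toFun u‖ ^ 2 := by
    have := harc.lipschitzWith.continuous
    fun_prop
  have hp : Function.Periodic (fun u => ‖γ.toFun (u + w) - γ.toFun u‖ ^ 2) 1 := fun u => by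
    simp only [γ.periodic u, add_right_comm u 1 w, γ.periodic (u + w)]
  obtain ⟨x, -, hx⟩ := isCompact_Icc.exists_isMinOn (nonempty_Icc.2 (zero_le_one' ℝ))
    hc.continuousOn
  refine ⟨‖γ.toFun (x + w) - γ.toFun x‖ ^ 2, pow_pos (norm_pos_iff.2 fun h => ?_) 2,
    fun u => ?_⟩
  · obtain ⟨k, hk⟩ := hinj _ _ (sub_eq_zero.1 h)
    rw [add_sub_cancel_left] at hk
    have h1 : 0 < k := by exact_mod_cast hk ▸ hw0
    have h2 : k < 1 := by exact_mod_cast hk ▸ hw1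
    omega
  · obtain ⟨y, hy, hty⟩ := hp.exists_mem_Ico₀ one_pos u
    rw [hty]
    exact hx (Ico_subset_Icc_self hy)

end ClosedCurve

/-- **Wirtinger-type estimate** (Lemma 2.3): for an arc-length parametrized injective
closed curve and a concave strictly increasing `g : [0,1/2] → [0,∞)`,
`∫_𝕋 g(|γ(u+w) − γ(u)|²) du ≤ g(sin(πw)²/π²)`, with equality iff the image of `γ`
is a circle. -/
theorem wirtinger_concave_bound {n : ℕ} (w : ℝ) (hw : w ∈ Set.Ioo (0:ℝ) 1)
    (γ : ClosedCurve n) (hinj : γ.IsInj) (harc : γ.IsArclength)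
    (g : ℝ → ℝ) (hconc : ConcaveOn ℝ (Set.Icc 0 (1/2)) g)
    (hmono : StrictMonoOn g (Set.Icc 0 (1/2)))
    (hnonneg : ∀ x ∈ Set.Icc (0:ℝ) (1/2), 0 ≤ g x) :
    (∫ u in (0:ℝ)..1, g (‖γ.toFun (u + w) - γ.toFun u‖ ^ 2)) ≤
      g (Real.sin (π * w) ^ 2 / π ^ 2) ∧
    ((∫ u in (0:ℝ)..1, g (‖γ.toFun (u + w) - γ.toFun u‖ ^ 2)) =
        g (Real.sin (π * w) ^ 2 / π ^ 2) ↔ IsCircle (Set.range γ.toFun)) := by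
  obtain ⟨hw0, hw1⟩ := hw
  have hsin : sin (π * w) ≠ 0 :=
    (sin_pos_of_pos_of_lt_pi (by positivity) (by nlinarith [pi_pos])).ne'
  set X : ℝ → ℝ := fun u => ‖γ.toFun (u + w) - γ.toFun u‖ ^ 2
  obtain ⟨m, hm, hXm⟩ := ClosedCurve.exists_pos_le_chord_sq harc hinj hw0 hw1
  have hXc : Continuous X := by
    have := harc.lipschitzWith.continuous
    fun_prop
  have hmem (u : ℝ) : X u ∈ Icc m (1 / 4) := ⟨hXm u, harc.chord_sq_le u w⟩
  have hsub : Icc m (1 / 4) ⊆ Ioo (0:ℝ) (1 / 2) := Icc_subset_Ioo hm (by norm_num)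
  have hsub' : Icc m (1 / 4) ⊆ Icc (0:ℝ) (1 / 2) := hsub.trans Ioo_subset_Icc_self
  have hgc : ContinuousOn g (Icc m (1 / 4)) := by
    have := hconc.continuousOn_interior
    rw [interior_Icc] at this
    exact this.mono hsub
  have hgX : Continuous (g ∘ X) := hgc.comp_continuous hXc hmem
  have : IsProbabilityMeasure (volume.restrict (Ioc (0:ℝ) 1)) := ⟨by simp⟩
  have hint {f : ℝ → ℝ} (hf : Continuous f) : Integrable f (volume.restrict (Ioc (0:ℝ) 1)) :=
    (hf.intervalIntegrable 0 1).1
  have hconc' := hconc.subset hsub' (convex_Icc _ _)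
  have hJ : ∫ u in (0:ℝ)..1, X u ∈ Icc m (1 / 4) := by
    rw [integral_of_le zero_le_one]
    exact (convex_Icc _ _).integral_mem isClosed_Icc (ae_of_all _ hmem) (hint hXc)
  have hjensen : ∫ u in (0:ℝ)..1, g (X u) ≤ g (∫ u in (0:ℝ)..1, X u) := by
    rw [integral_of_le zero_le_one, integral_of_le zero_le_one]
    exact hconc'.le_map_integral hgc isClosed_Icc (ae_of_all _ hmem) (hint hXc) (hint hgX)
  have hJS := harc.integral_sq_chord_le w
  have hS : sin (π * w) ^ 2 / π ^ 2 ∈ Icc (0:ℝ) (1 / 2) := by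
    refine ⟨by positivity, ?_⟩
    rw [div_le_iff₀ (by positivity)]
    nlinarith [sin_sq_le_one (π * w), pi_gt_three]
  have hg := hmono.monotoneOn (hsub' hJ) hS hJS
  refine ⟨hjensen.trans hg, fun h => ?_, fun h => ?_⟩
  · obtain ⟨A, B, C, hABC⟩ := harc.exists_eq_trigonometric hsin
      (hmono.injOn (hsub' hJ) hS (hg.antisymm (h ▸ hjensen)))
    exact harc.isCircle_of_eq_trigonometric hABC
  · simp [ClosedCurve.norm_chord_sq_eq_of_isCircle hinj harc h]

end
end

section
/- Let γ ∈ W^{1,1}_{i,r}(𝕋, ℝ^n). Then γ is convex if and only if for almost every u ∈ 𝕋 the image of the map η_{γ,u}: (0,1) → S^{n−1}, η_{γ,u}(w) = (γ(u+w) − γ(u))/|γ(u+w) − γ(u)|, is contained in half of a great circle of S^{n−1}. -/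
open MeasureTheory Real Set intervalIntegral
open scoped ENNReal RealInnerProductSpace

noncomputable section

section PeriodicCurves

/-- A continuous real function of period one takes some value at two incongruent points. -/
theorem not_injective_mod_int_of_continuous_periodic {f : ℝ → ℝ} (hf : Continuous f)
    (hper : Function.Periodic f 1) (hinj : ∀ s t, f s = f t → ∃ k : ℤ, s - t = (k : ℝ)) :
    False := by
  have h1 : f 1 = f 0 := by simpa using hper 0
  set m := (f 0 + f (1 / 2)) / 2 with hm
  have hne : f 0 ≠ f (1 / 2) := by
    intro h
    obtain ⟨k, hk⟩ := hinj _ _ h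
    have h2 : ((2 * k : ℤ) : ℝ) = ((-1 : ℤ) : ℝ) := by push_cast; linarith
    have := Int.cast_injective h2
    omega
  have hmem : m ∈ uIcc (f 0) (f (1 / 2)) := by
    rw [mem_uIcc, hm]
    rcases le_total (f 0) (f (1 / 2)) with h | h
    · left; constructor <;> linarith
    · right; constructor <;> linarith
  obtain ⟨s, hs, hsm⟩ := intermediate_value_uIcc (a := 0) (b := 1 / 2) hf.continuousOn hmem
  have hmem' : m ∈ uIcc (f (1 / 2)) (f 1) := by rwa [uIcc_comm, h1]
  obtain ⟨t, ht, htm⟩ := intermediate_value_uIcc (a := 1 / 2) (b := 1) hf.continuousOn hmem'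
  rw [uIcc_of_le (by norm_num)] at hs ht
  have hne0 : m ≠ f 0 := fun h => hne (by linarith)
  have hne1 : m ≠ f (1 / 2) := fun h => hne (by linarith)
  have hs0 : 0 < s := lt_of_le_of_ne hs.1 (by rintro rfl; exact hne0 hsm.symm)
  have hs1 : s < 1 / 2 := lt_of_le_of_ne hs.2 (by rintro rfl; exact hne1 hsm.symm)
  have ht1 : t < 1 := lt_of_le_of_ne ht.2 (by rintro rfl; exact hne0 (by rw [← htm, h1]))
  have ht0 := ht.1
  obtain ⟨k, hk⟩ := hinj t s (by rw [hsm, htm])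
  have h0 : (0 : ℝ) < k := by linarith
  have h2 : (k : ℝ) < 1 := by linarith
  norm_cast at h0 h2
  omega

/-- An injective continuous closed curve is not contained in a line. -/
theorem not_collinear_of_injective_mod_int {F : Type*} [AddCommGroup F] [TopologicalSpace F]
    [Module ℝ F] {g : ℝ → F} (hg : Continuous g)
    (hper : Function.Periodic g 1) (hinj : ∀ s t, g s = g t → ∃ k : ℤ, s - t = (k : ℝ))
    (ℓ : F →L[ℝ] ℝ) (a p : F) (h : ∀ t, g t = p + ℓ (g t) • a) : False := by
  refine not_injective_mod_int_of_continuous_periodic (f := fun t => ℓ (g t))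
    (ℓ.continuous.comp hg) (fun t => by simp only [hper t]) fun s t hst => hinj s t ?_
  rw [h s, h t]
  rw [show ℓ (g s) = ℓ (g t) from hst]

end PeriodicCurves

section ConvexSets

/-- A ray issuing from an interior point of a convex set meets the frontier at most once. -/
theorem Convex.eq_of_mem_frontier_of_sub_eq_smul {F : Type*} [NormedAddCommGroup F]
    [NormedSpace ℝ F] {K : Set F} (hK : Convex ℝ K) {c x y : F} (hc : c ∈ interior K)
    (hx : x ∈ frontier K) (hy : y ∈ frontier K) {s : ℝ} (hs : 0 < s)
    (h : y - c = s • (x - c)) : y = x := by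
  have key : ∀ x y : F, x ∈ frontier K → y ∈ frontier K → ∀ s : ℝ, 1 < s →
      y - c = s • (x - c) → False := by
    intro x y hx hy s hs h
    have hs0 : (0 : ℝ) < s := by linarith
    apply hx.2
    refine hK.openSegment_interior_closure_subset_interior hc hy.1
      ⟨1 - s⁻¹, s⁻¹, ?_, by positivity, by ring, ?_⟩
    · linarith [inv_lt_one_of_one_lt₀ hs]
    · rw [sub_smul, one_smul, sub_add, ← smul_sub, ← neg_sub y c, smul_neg, h, smul_smul,
        inv_mul_cancel₀ hs0.ne', one_smul]
      abel
  rcases lt_trichotomy s 1 with h1 | h1 | h1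
  · exfalso
    refine key y x hy hx s⁻¹ ((one_lt_inv₀ hs).2 h1) ?_
    rw [h, smul_smul, inv_mul_cancel₀ hs.ne', one_smul]
  · simpa [h1] using h
  · exact (key x y hx hy s h1 h).elim

theorem Convex.exists_unit_inner_sub_nonneg {F : Type*} [NormedAddCommGroup F]
    [InnerProductSpace ℝ F] [CompleteSpace F] {K : Set F} (hK : Convex ℝ K)
    (hne : (interior K).Nonempty) {z : F} (hz : z ∈ frontier K) :
    ∃ ν : F, ‖ν‖ = 1 ∧ ∀ y ∈ closure K, 0 ≤ ⟪ν, y - z⟫ := by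
  obtain ⟨f, hf⟩ := geometric_hahn_banach_open_point hK.interior isOpen_interior hz.2
  set v := (InnerProductSpace.toDual ℝ F).symm f with hv
  have hfv : ∀ y, f y = ⟪v, y⟫ := fun y => by simp [hv]
  have hv0 : v ≠ 0 := by
    intro h
    obtain ⟨y, hy⟩ := hne
    have := hf y hy
    simp [hfv, h] at this
  have hcl : closure K ⊆ {y | f y ≤ f z} := by
    rw [← hK.closure_interior_eq_closure_of_nonempty_interior hne]
    exact closure_minimal (fun y hy => (hf y hy).le) (isClosed_le f.continuous continuous_const)
  refine ⟨-(‖v‖⁻¹ • v), by 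
    rw [norm_neg, norm_smul, norm_inv, norm_norm, inv_mul_cancel₀ (norm_ne_zero_iff.2 hv0)],
    fun y hy => ?_⟩
  have h1 : f y ≤ f z := hcl hy
  rw [inner_neg_left, real_inner_smul_left, inner_sub_right, ← hfv, ← hfv, ← mul_neg]
  exact mul_nonneg (by positivity) (by linarith)

theorem mem_frontier_of_inner_sub_nonneg {F : Type*} [NormedAddCommGroup F]
    [InnerProductSpace ℝ F] {K : Set F} {z ν : F} (hz : z ∈ K) (hν : ν ≠ 0)
    (h : ∀ y ∈ K, 0 ≤ ⟪ν, y - z⟫) : z ∈ frontier K := by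
  refine ⟨subset_closure hz, fun h_int => ?_⟩
  have hcont : Continuous fun ε : ℝ => z - ε • ν := by fun_prop
  have hnhds : ∀ᶠ ε : ℝ in nhds 0, z - ε • ν ∈ K :=
    hcont.continuousAt.eventually (by simpa using mem_interior_iff_mem_nhds.1 h_int)
  obtain ⟨ε, hε, hpos⟩ := ((hnhds.filter_mono nhdsWithin_le_nhds).and
    (self_mem_nhdsWithin (s := Ioi (0 : ℝ)))).exists
  have h1 := h _ hε
  have h2 : 0 < ⟪ν, ν⟫ := real_inner_self_pos.2 hν
  have h3 : (0 : ℝ) < ε := hpos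
  rw [sub_sub_cancel_left, inner_neg_right, real_inner_smul_right] at h1
  nlinarith [mul_pos h3 h2]

theorem intrinsicFrontier_eq_frontier {F : Type*} [NormedAddCommGroup F] [NormedSpace ℝ F]
    {K : Set F} (h : affineSpan ℝ K = ⊤) : intrinsicFrontier ℝ K = frontier K := by
  have ho : IsOpen (affineSpan ℝ K : Set F) := by simp [h]
  have hpre : (Subtype.val : affineSpan ℝ K → F) ⁻¹' frontier K = frontier (Subtype.val ⁻¹' K) :=
    ho.isOpenMap_subtype_val.preimage_frontier_eq_frontier_preimage continuous_subtype_val K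
  rw [intrinsicFrontier, ← hpre]
  refine image_preimage_eq_of_subset fun x _ => ⟨⟨x, ?_⟩, rfl⟩
  simp [h]

end ConvexSets

section PlaneCurves

variable {g : ℝ → ℂ}

theorem Complex.eq_re_add_im_mul_unit {ν : ℂ} (hν : ‖ν‖ = 1) (z : ℂ) :
    z = ⟪Complex.I * ν, z⟫ • (Complex.I * ν) + ⟪ν, z⟫ • ν := by
  have h : ν.re * ν.re + ν.im * ν.im = 1 := by
    rw [← Complex.normSq_apply, Complex.normSq_eq_norm_sq, hν, one_pow]
  apply Complex.ext
  · simp [Complex.inner]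
    linear_combination (-z.re) * h
  · simp [Complex.inner]
    linear_combination (-z.im) * h

/-- If a curve has a support line at a dense set of parameters, then it has one
at every parameter. -/
theorem exists_unit_inner_sub_nonneg_of_dense (hg : Continuous g)
    (hd : Dense {u | ∃ ν : ℂ, ν ≠ 0 ∧ ∀ t, 0 ≤ ⟪ν, g t - g u⟫}) (u : ℝ) :
    ∃ ν : ℂ, ‖ν‖ = 1 ∧ ∀ t, 0 ≤ ⟪ν, g t - g u⟫ := by
  let C : Set (ℝ × Metric.sphere (0 : ℂ) 1) := {p | ∀ t, 0 ≤ ⟪(p.2 : ℂ), g t - g p.1⟫}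
  have hC : IsClosed C := by
    simp only [C, ofPred_forall]
    refine isClosed_iInter fun t => isClosed_le continuous_const ?_
    fun_prop
  have hcl : IsClosed (Prod.fst '' C) := isClosedMap_fst_of_compactSpace _ hC
  have hsub : {u | ∃ ν : ℂ, ν ≠ 0 ∧ ∀ t, 0 ≤ ⟪ν, g t - g u⟫} ⊆ Prod.fst '' C := by
    rintro v ⟨ν, hν, h⟩
    refine ⟨(v, ⟨‖ν‖⁻¹ • ν, by
      simp [inv_mul_cancel₀ (norm_ne_zero_iff.2 hν)]⟩), fun t => ?_, rfl⟩
    simp only [real_inner_smul_left]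
    exact mul_nonneg (by positivity) (h t)
  have hu : u ∈ Prod.fst '' C := hcl.closure_subset_iff.2 hsub (hd u)
  obtain ⟨⟨v, ν, hν⟩, h, rfl⟩ := hu
  exact ⟨ν, by simpa using hν, h⟩

/-- An injective closed plane curve spans the plane. -/
theorem affineSpan_range_eq_top_of_injective_mod_int (hg : Continuous g)
    (hper : Function.Periodic g 1) (hinj : ∀ s t, g s = g t → ∃ k : ℤ, s - t = (k : ℝ)) :
    affineSpan ℝ (range g) = ⊤ := by
  by_contra hne
  have hmem : ∀ t, g t ∈ affineSpan ℝ (range g) :=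
    fun t => subset_affineSpan ℝ _ (mem_range_self t)
  have hdir : (affineSpan ℝ (range g)).direction ≠ ⊤ := fun h =>
    hne ((AffineSubspace.direction_eq_top_iff_of_nonempty ⟨g 0, hmem 0⟩).1 h)
  have horth : (affineSpan ℝ (range g)).directionᗮ ≠ ⊥ := by
    rwa [Ne, Submodule.orthogonal_eq_bot_iff]
  obtain ⟨v, hv, hv0⟩ := Submodule.exists_mem_ne_zero_of_ne_bot horth
  set ν : ℂ := ‖v‖⁻¹ • v with hνdef
  have hν : ‖ν‖ = 1 := by
    rw [hνdef, norm_smul, norm_inv, norm_norm, inv_mul_cancel₀ (norm_ne_zero_iff.2 hv0)]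
  have h0 : ∀ t, ⟪ν, g t⟫ = ⟪ν, g 0⟫ := by
    intro t
    rw [← sub_eq_zero, ← inner_sub_right, hνdef, real_inner_smul_left, real_inner_comm,
      ← vsub_eq_sub, (Submodule.mem_orthogonal _ v).1 hv _
      (AffineSubspace.vsub_mem_direction (hmem t) (hmem 0)), mul_zero]
  refine not_collinear_of_injective_mod_int hg hper hinj (innerSL ℝ (Complex.I * ν))
    (Complex.I * ν) (⟪ν, g 0⟫ • ν) fun t => ?_
  rw [innerSL_apply_apply, ← h0 t, add_comm]
  exact Complex.eq_re_add_im_mul_unit hν (g t)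

/-- An injective closed plane curve all of whose points lie on the frontier of a convex set with
nonempty interior parametrizes that frontier. -/
theorem range_eq_frontier_of_injective_mod_int (hg : Continuous g)
    (hper : Function.Periodic g 1) (hinj : ∀ s t, g s = g t → ∃ k : ℤ, s - t = (k : ℝ))
    {K : Set ℂ} (hK : Convex ℝ K) (hne : (interior K).Nonempty)
    (hsub : range g ⊆ frontier K) : range g = frontier K := by
  refine hsub.antisymm fun x hx => ?_
  by_contra hxr
  obtain ⟨c, hc⟩ := hne
  have hfc : ∀ y ∈ frontier K, y - c ≠ 0 := fun y hy h =>
    hy.2 (by rwa [sub_eq_zero.1 h])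
  have hgc : ∀ t, g t - c ≠ 0 := fun t => hfc _ (hsub (mem_range_self t))
  have hxc := hfc x hx
  set q : ℝ → ℂ := fun t => (g t - c) / (-(x - c)) with hq
  have hq0 : ∀ t, q t ≠ 0 := fun t => div_ne_zero (hgc t) (neg_ne_zero.2 hxc)
  have hgq : ∀ t, g t - c = q t * (-(x - c)) := fun t =>
    (div_mul_cancel₀ _ (neg_ne_zero.2 hxc)).symm
  have hslit : ∀ t, q t ∈ Complex.slitPlane := by
    intro t
    rw [Complex.mem_slitPlane_iff_arg]
    refine ⟨fun h => hxr ⟨t, ?_⟩, hq0 t⟩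
    obtain ⟨hre, him⟩ := Complex.arg_eq_pi_iff.1 h
    refine hK.eq_of_mem_frontier_of_sub_eq_smul hc hx (hsub (mem_range_self t))
      (s := -(q t).re) (by linarith) ?_
    have : q t = ((q t).re : ℂ) := Complex.ext (by simp) (by simpa using him)
    rw [hgq t, Complex.real_smul]
    nth_rewrite 1 [this]
    push_cast
    ring
  have hqc : Continuous q := by
    simp only [hq]
    fun_prop
  refine not_injective_mod_int_of_continuous_periodic (f := fun t => Complex.arg (q t))
    (continuous_iff_continuousAt.2 fun t =>
      (Complex.continuousAt_arg (hslit t)).comp hqc.continuousAt)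
    (fun t => by simp only [hq, hper t]) fun s t hst => hinj s t ?_
  have h := (Complex.arg_eq_arg_iff (hq0 t) (hq0 s)).1 hst.symm
  refine hK.eq_of_mem_frontier_of_sub_eq_smul hc (hsub (mem_range_self t))
    (hsub (mem_range_self s)) (s := ‖q s‖ / ‖q t‖)
    (div_pos (norm_pos_iff.2 (hq0 s)) (norm_pos_iff.2 (hq0 t))) ?_
  rw [hgq s, hgq t, Complex.real_smul, ← mul_assoc]
  push_cast
  rw [h]

/-- An injective closed plane curve with a support line at a dense set of parameters parametrizes
the frontier of its convex hull. -/
theorem range_eq_frontier_convexHull (hg : Continuous g)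
    (hper : Function.Periodic g 1) (hinj : ∀ s t, g s = g t → ∃ k : ℤ, s - t = (k : ℝ))
    (hd : Dense {u | ∃ ν : ℂ, ν ≠ 0 ∧ ∀ t, 0 ≤ ⟪ν, g t - g u⟫}) :
    range g = frontier (convexHull ℝ (range g)) := by
  refine range_eq_frontier_of_injective_mod_int hg hper hinj (convex_convexHull ℝ _)
    (interior_convexHull_nonempty_iff_affineSpan_eq_top.2
      (affineSpan_range_eq_top_of_injective_mod_int hg hper hinj)) ?_
  rintro _ ⟨u, rfl⟩
  obtain ⟨ν, hν, h⟩ := exists_unit_inner_sub_nonneg_of_dense hg hd u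
  have hν0 : ν ≠ 0 := norm_ne_zero_iff.1 (by rw [hν]; exact one_ne_zero)
  have hhalf : Convex ℝ {y : ℂ | ⟪ν, g u⟫ ≤ ⟪ν, y⟫} :=
    convex_halfSpace_ge (innerSL ℝ ν).toLinearMap.isLinear _
  refine mem_frontier_of_inner_sub_nonneg (subset_convexHull ℝ _ (mem_range_self u)) hν0
    fun y hy => ?_
  have := convexHull_min (t := {y : ℂ | ⟪ν, g u⟫ ≤ ⟪ν, y⟫}) (by
    rintro _ ⟨t, rfl⟩
    have := h t
    rw [inner_sub_right] at this
    exact sub_nonneg.1 this) hhalf hy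
  rw [inner_sub_right]
  exact sub_nonneg.2 this

end PlaneCurves

section HalfPlanes

variable {F : Type*} [NormedAddCommGroup F] [InnerProductSpace ℝ F]

theorem norm_sq_smul_add_smul {a b : F} (ha : ‖a‖ = 1) (hb : ‖b‖ = 1) (hab : ⟪a, b⟫ = 0)
    (x y : ℝ) : ‖x • a + y • b‖ ^ 2 = x ^ 2 + y ^ 2 := by
  rw [norm_add_sq_real, real_inner_smul_left, real_inner_smul_right, hab, norm_smul, norm_smul,
    ha, hb]
  simp

/-- The isometric embedding of the plane determined by an orthonormal pair. -/
def planeIsometry (a b : F) (ha : ‖a‖ = 1) (hb : ‖b‖ = 1) (hab : ⟪a, b⟫ = 0) : ℂ →ₗᵢ[ℝ] F where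
  toFun z := z.re • a + z.im • b
  map_add' z w := by simp only [Complex.add_re, Complex.add_im, add_smul]; abel
  map_smul' r z := by simp [mul_smul]
  norm_map' z := by
    rw [← sq_eq_sq₀ (norm_nonneg _) (norm_nonneg _)]
    change ‖z.re • a + z.im • b‖ ^ 2 = _
    rw [norm_sq_smul_add_smul ha hb hab, ← Complex.normSq_eq_norm_sq, Complex.normSq_apply]
    ring

theorem planeIsometry_apply {a b : F} (ha : ‖a‖ = 1) (hb : ‖b‖ = 1) (hab : ⟪a, b⟫ = 0) (z : ℂ) :
    planeIsometry a b ha hb hab z = z.re • a + z.im • b := rfl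

/-- The image of `ℂ` under a linear isometry, translated to pass through `p`. -/
def LinearIsometry.translate (L : ℂ →ₗᵢ[ℝ] F) (p : F) : ℂ →ᵃⁱ[ℝ] F :=
  (AffineIsometryEquiv.vaddConst ℝ p).toAffineIsometry.comp L.toAffineIsometry

theorem LinearIsometry.translate_apply (L : ℂ →ₗᵢ[ℝ] F) (p : F) (z : ℂ) :
    L.translate p z = L z + p := rfl

end HalfPlanes

namespace ClosedCurve

variable {n : ℕ}

theorem continuous_toFun (γ : ClosedCurve n) : Continuous γ.toFun := by
  have h_int : IntervalIntegrable γ.deriv' volume 0 1 :=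
    (intervalIntegrable_iff_integrableOn_Icc_of_le zero_le_one).2 γ.integrableOn
  rw [funext γ.eq_integral]
  exact continuous_const.add
    (continuous_primitive (γ.deriv'_periodic.intervalIntegrable₀ one_ne_zero h_int) 0)

/-- The secant directions at `u` lie in half of a great circle iff the curve lies in a half-plane
whose boundary line passes through `γ(u)`. -/
theorem exists_halfGreatCircle_iff (γ : ClosedCurve n) (hinj : γ.IsInj) (u : ℝ) :
    (∃ S : Set (EuclideanSpace ℝ (Fin n)),
      IsHalfGreatCircle S ∧ (fun w => gaussMap γ u w) '' Set.Ioo 0 1 ⊆ S) ↔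
    ∃ a b : EuclideanSpace ℝ (Fin n), ‖a‖ = 1 ∧ ‖b‖ = 1 ∧ ⟪a, b⟫ = 0 ∧
      ∀ t, ∃ x y : ℝ, 0 ≤ y ∧ γ.toFun t - γ.toFun u = x • a + y • b := by
  have hpos : ∀ w ∈ Ioo (0 : ℝ) 1, 0 < ‖γ.toFun (u + w) - γ.toFun u‖ := by
    intro w hw
    rw [norm_pos_iff, sub_ne_zero]
    intro h
    obtain ⟨k, hk⟩ := hinj _ _ h
    rw [add_sub_cancel_left] at hk
    have h0 := hw.1
    have h1 := hw.2
    rw [hk] at h0 h1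
    norm_cast at h0 h1
    omega
  constructor
  · rintro ⟨S, ⟨a, b, ha, hb, hab, rfl⟩, hS⟩
    refine ⟨a, b, ha, hb, hab, fun t => ?_⟩
    have ht : γ.toFun t = γ.toFun (u + Int.fract (t - u)) := by
      have := γ.periodic.sub_int_mul_eq (x := t) ⌊t - u⌋
      rw [← this]
      congr 1
      rw [Int.fract]
      ring
    rcases (Int.fract_nonneg (t - u)).eq_or_lt with h0 | h0
    · refine ⟨0, 0, le_rfl, ?_⟩
      rw [ht, ← h0]
      simp
    · have hw : Int.fract (t - u) ∈ Ioo (0 : ℝ) 1 := ⟨h0, Int.fract_lt_one _⟩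
      obtain ⟨θ, hθ, h⟩ := hS ⟨_, hw, rfl⟩
      set r := ‖γ.toFun (u + Int.fract (t - u)) - γ.toFun u‖ with hr
      refine ⟨r * Real.cos θ, r * Real.sin θ,
        mul_nonneg (norm_nonneg _) (Real.sin_nonneg_of_mem_Icc hθ), ?_⟩
      simp only [gaussMap, ← hr] at h
      rw [mul_smul, mul_smul, ← smul_add, h, smul_smul, mul_inv_cancel₀ (hpos _ hw).ne', one_smul,
        ht]
  · rintro ⟨a, b, ha, hb, hab, h⟩
    refine ⟨_, ⟨a, b, ha, hb, hab, rfl⟩, ?_⟩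
    rintro _ ⟨w, hw, rfl⟩
    obtain ⟨x, y, hy, hxy⟩ := h (u + w)
    have hr := hpos w hw
    simp only [gaussMap]
    set r := ‖γ.toFun (u + w) - γ.toFun u‖ with hrdef
    have hsq : r ^ 2 = x ^ 2 + y ^ 2 := by
      rw [hrdef, hxy, norm_sq_smul_add_smul ha hb hab]
    have hunit : (r⁻¹ * x) ^ 2 + (r⁻¹ * y) ^ 2 = 1 := by
      field_simp
      exact hsq.symm
    have hy' : 0 ≤ r⁻¹ * y := by positivity
    have hcos : Real.cos (Real.arccos (r⁻¹ * x)) = r⁻¹ * x :=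
      Real.cos_arccos (by nlinarith) (by nlinarith)
    have hsin : Real.sin (Real.arccos (r⁻¹ * x)) = r⁻¹ * y := by
      rw [Real.sin_arccos, ← hunit, add_sub_cancel_left, Real.sqrt_sq hy']
    refine ⟨Real.arccos (r⁻¹ * x), ⟨Real.arccos_nonneg _, Real.arccos_le_pi _⟩, ?_⟩
    simp only [hcos, hsin, hxy, smul_add, mul_smul]

/-- A convex curve lies in a half-plane through each of its points. -/
theorem IsConvex.exists_halfPlane {γ : ClosedCurve n} (h : γ.IsConvex) (u : ℝ) :
    ∃ a b : EuclideanSpace ℝ (Fin n), ‖a‖ = 1 ∧ ‖b‖ = 1 ∧ ⟪a, b⟫ = 0 ∧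
      ∀ t, ∃ x y : ℝ, 0 ≤ y ∧ γ.toFun t - γ.toFun u = x • a + y • b := by
  obtain ⟨K, hK, hdim, hrange⟩ := h
  have hKne : K.Nonempty := by
    rw [nonempty_iff_ne_empty]
    intro h
    rw [h, AffineSubspace.span_empty, AffineSubspace.direction_bot, finrank_bot] at hdim
    omega
  obtain ⟨p, hp⟩ := hKne
  let V := (affineSpan ℝ K).direction
  let e := Complex.isometryOfOrthonormal
    ((stdOrthonormalBasis ℝ V).reindex (finCongr hdim))
  let L : ℂ →ₗᵢ[ℝ] EuclideanSpace ℝ (Fin n) := V.subtypeₗᵢ.comp e.toLinearIsometry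
  let φ := L.translate p
  have hsurj : ∀ y ∈ K, ∃ z, φ z = y := by
    intro y hy
    have hV : y - p ∈ V := AffineSubspace.vsub_mem_direction
      (subset_affineSpan ℝ K hy) (subset_affineSpan ℝ K hp)
    refine ⟨e.symm ⟨y - p, hV⟩, ?_⟩
    simp [φ, L, LinearIsometry.translate_apply]
  have himage : φ '' (φ ⁻¹' K) = K := image_preimage_eq_of_subset hsurj
  have hK0 : Convex ℝ (φ ⁻¹' K) := hK.affine_preimage φ.toAffineMap
  have hspan : affineSpan ℝ (φ ⁻¹' K) = ⊤ := by
    have h1 : (affineSpan ℝ (φ ⁻¹' K)).map φ.toAffineMap = affineSpan ℝ K := by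
      rw [AffineSubspace.map_span]
      exact congrArg _ himage
    have hne : (affineSpan ℝ (φ ⁻¹' K) : Set ℂ).Nonempty := by
      obtain ⟨z, hz⟩ := hsurj p hp
      exact ⟨z, subset_affineSpan ℝ _ (by rwa [mem_preimage, hz])⟩
    rw [← AffineSubspace.direction_eq_top_iff_of_nonempty hne]
    apply Submodule.eq_top_of_finrank_eq
    rw [Complex.finrank_real_complex, ← hdim, ← h1, AffineSubspace.map_direction]
    exact (Submodule.equivMapOfInjective φ.toAffineMap.linear φ.linearIsometry.injective
      _).finrank_eq
  have h_int : (interior (φ ⁻¹' K)).Nonempty :=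
    hK0.interior_nonempty_iff_affineSpan_eq_top.2 hspan
  have hmem : ∀ t, ∃ z ∈ frontier (φ ⁻¹' K), φ z = γ.toFun t := by
    intro t
    have : γ.toFun t ∈ φ '' intrinsicFrontier ℝ (φ ⁻¹' K) := by
      rw [← φ.intrinsicFrontier_image, himage, ← hrange]
      exact mem_range_self t
    obtain ⟨z, hz, hzt⟩ := this
    exact ⟨z, intrinsicFrontier_subset_frontier hz, hzt⟩
  obtain ⟨z, hz, hzu⟩ := hmem u
  obtain ⟨ν, hν, hsupp⟩ := hK0.exists_unit_inner_sub_nonneg h_int hz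
  refine ⟨L (Complex.I * ν), L ν, by simp [hν], by simp [hν], ?_, fun t => ?_⟩
  · rw [L.inner_map_map, Complex.inner]
    simp
    ring
  · obtain ⟨y, hy, hyt⟩ := hmem t
    refine ⟨⟪Complex.I * ν, y - z⟫, _, hsupp y (frontier_subset_closure hy), ?_⟩
    rw [← hyt, ← hzu, ← map_smul, ← map_smul, ← map_add,
      ← Complex.eq_re_add_im_mul_unit hν (y - z), map_sub]
    simp [φ, LinearIsometry.translate_apply]

/-- An injective curve which lies in a half-plane through almost every one of its points is
convex. -/
theorem isConvex_of_ae_exists_halfPlane (γ : ClosedCurve n) (hinj : γ.IsInj)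
    (h : ∀ᵐ u : ℝ ∂volume, ∃ a b : EuclideanSpace ℝ (Fin n), ‖a‖ = 1 ∧ ‖b‖ = 1 ∧ ⟪a, b⟫ = 0 ∧
      ∀ t, ∃ x y : ℝ, 0 ≤ y ∧ γ.toFun t - γ.toFun u = x • a + y • b) : γ.IsConvex := by
  have hcont := γ.continuous_toFun
  have hdense := Measure.dense_of_ae h
  obtain ⟨u₀, a, b, ha, hb, hab, hplane⟩ := h.exists
  let L := planeIsometry a b ha hb hab
  let φ := L.translate (γ.toFun u₀)
  choose x y _ hxy using hplane
  let g : ℝ → ℂ := fun t => ⟨x t, y t⟩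
  have hφg : ∀ t, φ (g t) = γ.toFun t := fun t => by
    rw [LinearIsometry.translate_apply, planeIsometry_apply, ← hxy t, sub_add_cancel]
  have hsub : ∀ s t, γ.toFun s - γ.toFun t = L (g s - g t) := fun s t => by
    rw [← hφg, ← hφg, map_sub]
    simp [φ, LinearIsometry.translate_apply]
  have hg : Continuous g := by
    rw [φ.isometry.isEmbedding.continuous_iff]
    exact hcont.congr fun t => (hφg t).symm
  have hper : Function.Periodic g 1 := fun t =>
    φ.injective (by rw [hφg, hφg, γ.periodic])
  have hginj : ∀ s t, g s = g t → ∃ k : ℤ, s - t = (k : ℝ) := fun s t hst =>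
    hinj s t (by rw [← hφg, ← hφg, hst])
  have hspan := affineSpan_range_eq_top_of_injective_mod_int hg hper hginj
  have hd : Dense {u | ∃ ν : ℂ, ν ≠ 0 ∧ ∀ t, 0 ≤ ⟪ν, g t - g u⟫} := by
    refine hdense.mono ?_
    rintro u ⟨a', b', ha', hb', hab', hu⟩
    have hadj : ∀ z, ⟪(L.toContinuousLinearMap.adjoint b' : ℂ), z⟫ = ⟪b', L z⟫ := fun z =>
      L.toContinuousLinearMap.adjoint_inner_left z b'
    choose x' y' hy' hxy' using hu
    have hinner : ∀ t, ⟪b', γ.toFun t - γ.toFun u⟫ = y' t := fun t => by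
      rw [hxy' t, inner_add_right, real_inner_smul_right, real_inner_smul_right,
        real_inner_comm, hab', real_inner_self_eq_norm_sq, hb']
      simp
    have hinner' : ∀ t, ⟪a', γ.toFun t - γ.toFun u⟫ = x' t := fun t => by
      rw [hxy' t, inner_add_right, real_inner_smul_right, real_inner_smul_right,
        hab', real_inner_self_eq_norm_sq, ha']
      simp
    refine ⟨L.toContinuousLinearMap.adjoint b', fun h0 => ?_, fun t => ?_⟩
    · refine not_collinear_of_injective_mod_int hcont γ.periodic hinj (innerSL ℝ a') a'
        (γ.toFun u - ⟪a', γ.toFun u⟫ • a') fun t => ?_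
      have hy0 : y' t = 0 := by
        rw [← hinner t, hsub, ← hadj, h0, inner_zero_left]
      have h1 := hxy' t
      rw [hy0, zero_smul, add_zero, ← hinner' t, inner_sub_right, sub_smul] at h1
      rw [innerSL_apply_apply, ← sub_eq_zero, ← sub_eq_zero.2 h1]
      abel
    · rw [hadj, ← hsub, hinner]
      exact hy' t
  have hfrontier := range_eq_frontier_convexHull hg hper hginj hd
  have hrange : range γ.toFun = φ '' range g := by
    rw [← range_comp]
    exact congrArg range (funext fun t => (hφg t).symm)
  refine ⟨φ '' convexHull ℝ (range g), (convex_convexHull ℝ _).affine_image φ.toAffineMap, ?_, ?_⟩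
  · have h1 : affineSpan ℝ (φ '' convexHull ℝ (range g)) =
        (affineSpan ℝ (convexHull ℝ (range g))).map φ.toAffineMap :=
      (AffineSubspace.map_span _ _).symm
    rw [h1, affineSpan_convexHull, hspan, AffineSubspace.map_direction,
      AffineSubspace.direction_top,
      ← (Submodule.equivMapOfInjective φ.toAffineMap.linear φ.linearIsometry.injective
        ⊤).finrank_eq,
      finrank_top, Complex.finrank_real_complex]
  · rw [φ.intrinsicFrontier_image, intrinsicFrontier_eq_frontier
      (by rw [affineSpan_convexHull, hspan]), ← hfrontier, hrange]

end ClosedCurve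

/-- **Convexity via secant directions** (Lemma 3.2): `γ` is convex iff for almost every
`u` the image of `η_{γ,u} = φ_γ(u,·)` on `(0,1)` is contained in half of a great circle. -/
theorem convex_iff_eta_in_half_great_circle {n : ℕ} (γ : ClosedCurve n)
    (hinj : γ.IsInj) (hreg : γ.IsRegular) :
    γ.IsConvex ↔ ∀ᵐ u : ℝ ∂volume, ∃ S : Set (EuclideanSpace ℝ (Fin n)),
      IsHalfGreatCircle S ∧ (fun w => gaussMap γ u w) '' Set.Ioo 0 1 ⊆ S := by
  simp only [γ.exists_halfGreatCircle_iff hinj]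
  exact ⟨fun h => .of_forall h.exists_halfPlane, γ.isConvex_of_ae_exists_halfPlane hinj⟩

end
end
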